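/- Let (ρ, u) be a very weak solution of the stationary barotropic Navier–Stokes system on ℝ³ with pressure p and potential G, where p : [0,∞) → ℝ is continuous, p(0) = 0, p(s) ≥ 0 for all s ≥ 0, and p is continuously differentiable on (0,∞). Assume either G ∈ D₀^{1,q}(ℝ³) for some 3/2 < q < ∞ or G ∈ W^{1,∞}(ℝ³), and assume ρ ∈ L¹(ℝ³) ∩ L^∞(ℝ³) and u ∈ L^∞(ℝ³;ℝ³). If ess limsup_{|x|→∞} |u(x)| = 0, then u = 0 almost everywhere. -/

import Mathlib

noncomputable section

open MeasureTheory Metric Filter Topology Set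

/-- Three-dimensional Euclidean space. -/
abbrev E3 : Type := EuclideanSpace ℝ (Fin 3)

/-- Partial derivative of a scalar function in the `i`-th coordinate direction. -/
def pd (f : E3 → ℝ) (i : Fin 3) : E3 → ℝ :=
  fun x => fderiv ℝ f x (EuclideanSpace.single i 1)

/-- Classical gradient matrix of a vector field: `(tgrad φ x) i j = ∂_j φ_i (x)`. -/
def tgrad (φ : E3 → Fin 3 → ℝ) (x : E3) : Fin 3 → Fin 3 → ℝ :=
  fun i j => pd (fun y => φ y i) j x

/-- Smooth compactly supported scalar test function with support in `Ω`. -/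
def IsTest (Ω : Set E3) (φ : E3 → ℝ) : Prop :=
  ContDiff ℝ ((⊤ : ℕ∞) : WithTop ℕ∞) φ ∧ HasCompactSupport φ ∧ tsupport φ ⊆ Ω

/-- `C^n` compactly supported vector-valued test function with support in `Ω`. -/
def IsTestVec (n : WithTop ℕ∞) (Ω : Set E3) (φ : E3 → Fin 3 → ℝ) : Prop :=
  ContDiff ℝ n φ ∧ HasCompactSupport φ ∧ tsupport φ ⊆ Ω

/-- The Newtonian viscous stress tensor
`S(M) = μ (M + Mᵗ - (2/3) (tr M) I) + η (tr M) I`. -/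
def Smat (μ η : ℝ) (M : Fin 3 → Fin 3 → ℝ) : Fin 3 → Fin 3 → ℝ :=
  fun i j =>
    μ * (M i j + M j i - (2 / 3) * (∑ k, M k k) * (if i = j then (1 : ℝ) else 0))
      + η * (∑ k, M k k) * (if i = j then (1 : ℝ) else 0)

/-- `dG` is the weak gradient of the scalar function `G` on `Ω`. -/
def HasWeakGradOn (Ω : Set E3) (G : E3 → ℝ) (dG : E3 → Fin 3 → ℝ) : Prop :=
  ∀ φ : E3 → ℝ, IsTest Ω φ → ∀ i : Fin 3,
    ∫ x in Ω, G x * pd φ i x = - ∫ x in Ω, dG x i * φ x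

/-- `du` is the weak gradient (Jacobian) of the vector field `u` on `Ω`. -/
def HasWeakGradVecOn (Ω : Set E3) (u : E3 → Fin 3 → ℝ) (du : E3 → Fin 3 → Fin 3 → ℝ) : Prop :=
  ∀ φ : E3 → ℝ, IsTest Ω φ → ∀ i j : Fin 3,
    ∫ x in Ω, u x i * pd φ j x = - ∫ x in Ω, du x i j * φ x

/-- `u ∈ D₀^{1,2}(Ω; ℝ³)` with weak gradient `du`: `u` is locally integrable on `Ω`, its weak
gradient belongs to `L²(Ω)`, and `u` can be approximated by smooth compactly supported fields
`uₙ` with `∇uₙ → ∇u` in `L²(Ω)` and `uₙ → u` in `L⁶(Ω)`. -/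
def MemD012 (Ω : Set E3) (u : E3 → Fin 3 → ℝ) (du : E3 → Fin 3 → Fin 3 → ℝ) : Prop :=
  LocallyIntegrableOn u Ω volume ∧
  HasWeakGradVecOn Ω u du ∧
  MemLp du 2 (volume.restrict Ω) ∧
  ∃ un : ℕ → E3 → Fin 3 → ℝ,
    (∀ n, IsTestVec ((⊤ : ℕ∞) : WithTop ℕ∞) Ω (un n)) ∧
    Tendsto (fun n => eLpNorm (fun x => tgrad (un n) x - du x) 2 (volume.restrict Ω))
      atTop (𝓝 0) ∧
    Tendsto (fun n => eLpNorm (fun x => un n x - u x) 6 (volume.restrict Ω)) atTop (𝓝 0)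

/-- `G ∈ D₀^{1,q}(Ω)` with weak gradient `dG`. -/
def MemD01q (Ω : Set E3) (G : E3 → ℝ) (dG : E3 → Fin 3 → ℝ) (q : ℝ) : Prop :=
  HasWeakGradOn Ω G dG ∧
  MemLp dG (ENNReal.ofReal q) (volume.restrict Ω) ∧
  ∃ Gn : ℕ → E3 → ℝ,
    (∀ n, IsTest Ω (Gn n)) ∧
    Tendsto (fun n =>
        eLpNorm (fun x => (fun i => pd (Gn n) i x) - dG x) (ENNReal.ofReal q)
          (volume.restrict Ω)) atTop (𝓝 0) ∧
    ∀ K : Set E3, IsCompact K → K ⊆ Ω →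
      Tendsto (fun n => ∫ x in K, |Gn n x - G x|) atTop (𝓝 0)

/-- `G ∈ W^{1,∞}(Ω)` with weak gradient `dG`: both `G` and `∇G` are essentially bounded. -/
def MemW1inf (Ω : Set E3) (G : E3 → ℝ) (dG : E3 → Fin 3 → ℝ) : Prop :=
  HasWeakGradOn Ω G dG ∧
  MemLp G ⊤ (volume.restrict Ω) ∧ MemLp dG ⊤ (volume.restrict Ω)

/-- Weak solution `(ρ, u)` (with weak gradient `du` of `u` and weak gradient `dG` of `G`) of the
stationary barotropic Navier–Stokes system
`div(ρu) = 0`, `div(ρ u⊗u) + ∇p(ρ) − div S(∇u) = ρ∇G` on `Ω` with no-slip boundary condition. -/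
structure WeakSolution (Ω : Set E3) (μ η : ℝ) (p : ℝ → ℝ)
    (G : E3 → ℝ) (dG : E3 → Fin 3 → ℝ)
    (ρ : E3 → ℝ) (u : E3 → Fin 3 → ℝ) (du : E3 → Fin 3 → Fin 3 → ℝ) : Prop where
  aemeas_ρ : AEMeasurable ρ volume
  aemeas_u : AEMeasurable u volume
  weakGrad_G : HasWeakGradOn Ω G dG
  ρ_nonneg : ∀ᵐ x ∂(volume.restrict Ω), 0 ≤ ρ x
  ρu_locInt : LocallyIntegrableOn (fun x => fun i => ρ x * u x i) (closure Ω) volume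
  mass : ∀ φ : E3 → ℝ, ContDiff ℝ ((⊤ : ℕ∞) : WithTop ℕ∞) φ → HasCompactSupport φ →
    ∫ x in Ω, ρ x * (∑ i, u x i * pd φ i x) = 0
  ρ_locInt : LocallyIntegrableOn ρ Ω volume
  ρu2_locInt : LocallyIntegrableOn (fun x => ρ x * (∑ i, (u x i) ^ 2)) Ω volume
  pρ_locInt : LocallyIntegrableOn (fun x => p (ρ x)) Ω volume
  ρdG_locInt : LocallyIntegrableOn (fun x => fun i => ρ x * dG x i) Ω volume
  u_D012 : MemD012 Ω u du
  momentum : ∀ φ : E3 → Fin 3 → ℝ, IsTestVec 1 Ω φ →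
    ∫ x in Ω, ((∑ i, ∑ j, ρ x * u x i * u x j * tgrad φ x i j)
        + p (ρ x) * (∑ i, tgrad φ x i i))
      = (∫ x in Ω, ∑ i, ∑ j, Smat μ η (du x) i j * tgrad φ x i j)
        - ∫ x in Ω, ∑ i, ρ x * dG x i * φ x i

/-- Componentwise Laplacian of a vector field: `lap φ i x = Δφ_i(x)`. -/
def lap (φ : E3 → Fin 3 → ℝ) (i : Fin 3) : E3 → ℝ :=
  fun x => ∑ j, pd (pd (fun y => φ y i) j) j x

/-- `i`-th component of the gradient of the divergence: `∂_i (div φ)(x)`. -/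
def gradDivg (φ : E3 → Fin 3 → ℝ) (i : Fin 3) : E3 → ℝ :=
  pd (fun y => ∑ j, pd (fun z => φ z j) j y) i

/-- Euclidean norm of a vector in `ℝ³` (represented as `Fin 3 → ℝ`). -/
def vnorm (v : Fin 3 → ℝ) : ℝ := Real.sqrt (∑ i, (v i) ^ 2)

/-- Very weak solution `(ρ, u)` of the stationary barotropic Navier–Stokes system
`div(ρu) = 0`, `div(ρ u⊗u) + ∇p(ρ) − div S(∇u) = ρ∇G` on `ℝ³`, where the viscous term is
tested using `div S(∇φ) = μΔφ + (μ/3 + η)∇(div φ)` for `C²` test functions `φ`. -/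
structure VeryWeakSolution (μ η : ℝ) (p : ℝ → ℝ) (G : E3 → ℝ) (dG : E3 → Fin 3 → ℝ)
    (ρ : E3 → ℝ) (u : E3 → Fin 3 → ℝ) : Prop where
  aemeas_ρ : AEMeasurable ρ volume
  aemeas_u : AEMeasurable u volume
  weakGrad_G : HasWeakGradOn univ G dG
  ρ_nonneg : ∀ᵐ x, 0 ≤ ρ x
  ρu_locInt : LocallyIntegrable (fun x => fun i => ρ x * u x i) volume
  mass : ∀ φ : E3 → ℝ, ContDiff ℝ ((⊤ : ℕ∞) : WithTop ℕ∞) φ → HasCompactSupport φ →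
    ∫ x, ρ x * (∑ i, u x i * pd φ i x) = 0
  ρ_locInt : LocallyIntegrable ρ volume
  ρu2_locInt : LocallyIntegrable (fun x => ρ x * (∑ i, (u x i) ^ 2)) volume
  pρ_locInt : LocallyIntegrable (fun x => p (ρ x)) volume
  ρdG_locInt : LocallyIntegrable (fun x => fun i => ρ x * dG x i) volume
  u_locInt : LocallyIntegrable u volume
  momentum : ∀ φ : E3 → Fin 3 → ℝ, ContDiff ℝ 2 φ → HasCompactSupport φ →
    ∫ x, ((∑ i, ∑ j, ρ x * u x i * u x j * tgrad φ x i j)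
        + p (ρ x) * (∑ i, tgrad φ x i i))
      = - (∫ x, ∑ i, (μ * lap φ i x + (μ / 3 + η) * gradDivg φ i x) * u x i)
        - ∫ x, ∑ i, ρ x * dG x i * φ x i



/-! ### Calculus of partial derivatives -/

/-- Smooth functions. -/
abbrev Sm (f : E3 → ℝ) : Prop := ContDiff ℝ ((⊤ : ℕ∞) : WithTop ℕ∞) f

/-- basis vector -/
abbrev bv (i : Fin 3) : E3 := EuclideanSpace.single i 1

theorem pd_contDiff {f : E3 → ℝ} {m n : WithTop ℕ∞} (hf : ContDiff ℝ n f) (h : m + 1 ≤ n) (i : Fin 3) :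
    ContDiff ℝ m (pd f i) :=
  (hf.fderiv_right h).clm_apply contDiff_const

theorem Sm.pd {f : E3 → ℝ} (hf : Sm f) (i : Fin 3) : Sm (pd f i) :=
  pd_contDiff hf (by simp) i

theorem Sm.d {f : E3 → ℝ} (hf : Sm f) : Differentiable ℝ f := hf.differentiable (by simp)
theorem Sm.c1 {f : E3 → ℝ} (hf : Sm f) : ContDiff ℝ 1 f := hf.of_le (by exact_mod_cast le_top)
theorem Sm.c2 {f : E3 → ℝ} (hf : Sm f) : ContDiff ℝ 2 f :=
  hf.of_le (WithTop.coe_le_coe.mpr (le_top : (2 : ℕ∞) ≤ ⊤))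
theorem c1d {f : E3 → ℝ} (hf : ContDiff ℝ 1 f) : Differentiable ℝ f := hf.differentiable (by simp)

theorem pd_cont {f : E3 → ℝ} (hf : ContDiff ℝ 1 f) (i : Fin 3) : Continuous (pd f i) :=
  (pd_contDiff (m := 0) hf (by simp) i).continuous

theorem pd_add {f g : E3 → ℝ} (hf : Differentiable ℝ f) (hg : Differentiable ℝ g) (i : Fin 3) :
    pd (fun x => f x + g x) i = fun x => pd f i x + pd g i x := by
  ext x; simp only [pd]; rw [fderiv_fun_add (hf x) (hg x)]; rfl

theorem pd_sub {f g : E3 → ℝ} (hf : Differentiable ℝ f) (hg : Differentiable ℝ g) (i : Fin 3) :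
    pd (fun x => f x - g x) i = fun x => pd f i x - pd g i x := by
  ext x; simp only [pd]; rw [fderiv_fun_sub (hf x) (hg x)]; rfl

theorem pd_mul {f g : E3 → ℝ} (hf : Differentiable ℝ f) (hg : Differentiable ℝ g) (i : Fin 3) :
    pd (fun x => f x * g x) i = fun x => f x * pd g i x + pd f i x * g x := by
  ext x; simp only [pd]; rw [fderiv_fun_mul (hf x) (hg x)]; simp; ring

theorem pd_const_mul {f : E3 → ℝ} (c : ℝ) (hf : Differentiable ℝ f) (i : Fin 3) :
    pd (fun x => c * f x) i = fun x => c * pd f i x := by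
  ext x; simp only [pd]; rw [fderiv_const_mul (hf x)]; rfl

theorem pd_const (c : ℝ) (i : Fin 3) : pd (fun _ => c) i = fun _ => 0 := by
  ext x; simp [pd]

theorem pd_sum {ι : Type*} (s : Finset ι) {f : ι → E3 → ℝ} (hf : ∀ k ∈ s, Differentiable ℝ (f k)) (i : Fin 3) :
    pd (fun x => ∑ k ∈ s, f k x) i = fun x => ∑ k ∈ s, pd (f k) i x := by
  ext x; simp only [pd]; rw [fderiv_fun_sum (fun k hk => hf k hk x)]; simp

theorem pd_comp {f : E3 → ℝ} {b : ℝ → ℝ} {b' : ℝ → ℝ} (hf : Differentiable ℝ f)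
    (hb : ∀ s, HasDerivAt b (b' s) s) (i : Fin 3) :
    pd (fun x => b (f x)) i = fun x => b' (f x) * pd f i x := by
  ext x; simp only [pd]
  have := ((hb (f x)).comp_hasFDerivAt x (hf x).hasFDerivAt).fderiv
  simp only [Function.comp_def] at this
  rw [this]; simp

theorem pd_comm {f : E3 → ℝ} (hf : ContDiff ℝ 2 f) (i j : Fin 3) :
    pd (pd f i) j = pd (pd f j) i := by
  ext x
  have h1 : Differentiable ℝ (fderiv ℝ f) := (hf.fderiv_right (m := 1) (by norm_num)).differentiable (by simp)
  have hs : IsSymmSndFDerivAt ℝ f x := hf.contDiffAt.isSymmSndFDerivAt (by simp)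
  have key : ∀ a b : E3, fderiv ℝ (fun y => fderiv ℝ f y a) x b = fderiv ℝ (fderiv ℝ f) x b a := by
    intro a b
    rw [fderiv_clm_apply (h1 x) (differentiableAt_const _)]; simp
  unfold pd
  rw [key, key]; exact hs _ _

theorem hcs_pd {f : E3 → ℝ} (hf : HasCompactSupport f) (i : Fin 3) : HasCompactSupport (pd f i) :=
  HasCompactSupport.comp_left (hf.fderiv ℝ) (g := fun L : E3 →L[ℝ] ℝ => L (bv i)) (by simp)

theorem integral_pd_zero {f : E3 → ℝ} (hf : ContDiff ℝ 1 f) (hc : HasCompactSupport f) (i : Fin 3) :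
    ∫ x, pd f i x = 0 := by
  have h := integral_mul_fderiv_eq_neg_fderiv_mul_of_integrable (μ := (volume : Measure E3))
    (f := fun _ : E3 => (1:ℝ)) (g := f) (v := bv i) (by simp)
    (by simp only [one_mul]; exact ((pd_cont hf i).integrable_of_hasCompactSupport (hcs_pd hc i)))
    (by simpa using (hf.continuous.integrable_of_hasCompactSupport hc))
    (fun x _ => differentiableAt_const _) (fun x _ => c1d hf x)
  simp only [one_mul, fderiv_fun_const, Pi.zero_apply, _root_.zero_apply, zero_mul,
    integral_zero, neg_zero] at h
  exact h

theorem integral_ibp {f g : E3 → ℝ} (hf : ContDiff ℝ 1 f) (hg : ContDiff ℝ 1 g) (hc : HasCompactSupport g)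
    (i : Fin 3) : ∫ x, f x * pd g i x = - ∫ x, pd f i x * g x := by
  apply integral_mul_fderiv_eq_neg_fderiv_mul_of_integrable
  · exact ((pd_cont hf i).mul hg.continuous).integrable_of_hasCompactSupport hc.mul_left
  · exact (hf.continuous.mul (pd_cont hg i)).integrable_of_hasCompactSupport (hcs_pd hc i).mul_left
  · exact (hf.continuous.mul hg.continuous).integrable_of_hasCompactSupport hc.mul_left
  · exact fun x _ => c1d hf x
  · exact fun x _ => c1d hg x

theorem integral_div_zero {V : Fin 3 → E3 → ℝ} (hV : ∀ j, ContDiff ℝ 1 (V j)) (hc : ∀ j, HasCompactSupport (V j)) :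
    ∫ x, ∑ j, pd (V j) j x = 0 := by
  rw [integral_finsetSum]
  · exact Finset.sum_eq_zero fun j _ => integral_pd_zero (hV j) (hc j) j
  · exact fun j _ => (pd_cont (hV j) j).integrable_of_hasCompactSupport (hcs_pd (hc j) j)

/-- second-derivative criterion at a maximum -/
theorem pd_pd_nonpos {f : E3 → ℝ} (hf : ContDiff ℝ 2 f) {x : E3} (hx : IsLocalMax f x) (i : Fin 3) :
    pd (pd f i) i x ≤ 0 := by
  by_contra hcon
  push Not at hcon
  set g : ℝ → ℝ := fun t => f (x + t • bv i) with hg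
  have hl : ∀ t : ℝ, HasDerivAt (fun t : ℝ => x + t • bv i) (bv i) t := by
    intro t
    simpa using ((hasDerivAt_id t).smul_const (bv i)).const_add x
  have h1 : ∀ t, HasDerivAt g (pd f i (x + t • bv i)) t := fun t =>
    ((hf.differentiable (by simp)) _).hasFDerivAt.comp_hasDerivAt t (hl t)
  have hd : deriv g = fun t => pd f i (x + t • bv i) := funext fun t => (h1 t).deriv
  have hpd : ContDiff ℝ 1 (pd f i) := pd_contDiff hf (by norm_num) i
  have h2 : ∀ t, HasDerivAt (deriv g) (pd (pd f i) i (x + t • bv i)) t := fun t => by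
    rw [hd]; exact (c1d hpd _).hasFDerivAt.comp_hasDerivAt t (hl t)
  have hmax : IsLocalMax g 0 := by
    have hc : ContinuousAt (fun t : ℝ => x + t • bv i) 0 := (hl 0).continuousAt
    have : Tendsto (fun t : ℝ => x + t • bv i) (𝓝 0) (𝓝 x) := by simpa [ContinuousAt] using hc
    have := this.eventually hx
    simpa [IsLocalMax, IsMaxFilter, hg] using this
  have h0 : deriv g 0 = 0 := hmax.deriv_eq_zero
  have h20 : deriv (deriv g) 0 > 0 := by rw [(h2 0).deriv]; simpa using hcon
  have hmin := isLocalMin_of_deriv_deriv_pos h20 h0 (h1 0).continuousAt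
  have heq : g =ᶠ[𝓝 0] fun _ => g 0 := by
    filter_upwards [hmin, hmax] with t a b using le_antisymm b a
  have : deriv g =ᶠ[𝓝 0] fun _ => 0 := by
    have := heq.deriv
    simpa using this
  have := this.deriv_eq
  simp at this
  linarith

/-- Liouville: a harmonic function vanishing at infinity is zero. -/
theorem liouville_harm_le {f : E3 → ℝ} (hf : ContDiff ℝ 2 f) (hh : ∀ x, ∑ i, pd (pd f i) i x = 0)
    (h0 : Tendsto f (cocompact E3) (𝓝 0)) (x : E3) : f x ≤ 0 := by
  by_contra hcon
  push Not at hcon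
  have hev : ∀ᶠ y in cocompact E3, f y < f x / 2 := h0.eventually (gt_mem_nhds (by linarith))
  obtain ⟨R, hR⟩ : ∃ R : ℝ, ∀ y, R ≤ ‖y‖ → f y < f x / 2 := by
    obtain ⟨K, hK, hKs⟩ := mem_cocompact.mp hev
    obtain ⟨R, hR⟩ := hK.isBounded.exists_norm_le
    refine ⟨R + 1, fun y hy => hKs ?_⟩
    intro hyK
    have := hR y hyK
    linarith
  set S := max R (max (‖x‖) 1) with hS
  have hS1 : 1 ≤ S := le_max_of_le_right (le_max_right _ _)
  set δ := f x / (4 * S ^ 2) with hδ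
  have hδ0 : 0 < δ := by positivity
  set N : E3 → ℝ := fun y => ∑ k, y k * y k with hN
  have hNn : ∀ y, N y = ‖y‖ ^ 2 := fun y => by
    rw [EuclideanSpace.norm_sq_eq]; simp [hN, sq]
  set F : E3 → ℝ := fun y => f y + δ * N y with hF
  have hco : ∀ k : Fin 3, ContDiff ℝ 2 (fun y : E3 => y k) := fun k =>
    (EuclideanSpace.proj k : E3 →L[ℝ] ℝ).contDiff
  have hNc : ContDiff ℝ 2 N := ContDiff.sum fun k _ => (hco k).mul (hco k)
  have hFc : ContDiff ℝ 2 F := hf.add (contDiff_const.mul hNc)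
  obtain ⟨m, hm, hmax⟩ := (isCompact_closedBall (0:E3) S).exists_isMaxOn
    ⟨0, by simp; linarith⟩ hFc.continuous.continuousOn
  have hxm : F x ≤ F m := hmax (by simp [hS])
  have hmS : ‖m‖ < S := by
    have hm' : ‖m‖ ≤ S := by simpa using hm
    rcases hm'.lt_or_eq with h | h
    · exact h
    exfalso
    have h1 := hR m (by rw [h]; exact le_max_left _ _)
    have h2 : F m = f m + f x / 4 := by
      simp only [hF, hNn, h, hδ]; field_simp
    have h3 : f x ≤ F x := by simp only [hF, hNn]; nlinarith [sq_nonneg ‖x‖]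
    linarith
  have hloc : IsLocalMax F m := by
    refine hmax.isLocalMax ?_
    exact mem_of_superset (isOpen_ball.mem_nhds (by simpa using hmS)) ball_subset_closedBall
  have hsum : ∑ i, pd (pd F i) i m ≤ 0 := Finset.sum_nonpos fun i _ => pd_pd_nonpos hFc hloc i
  have hpc : ∀ k i : Fin 3, pd (fun y : E3 => y k) i = fun _ => if k = i then 1 else 0 := by
    intro k i; ext y
    have : HasFDerivAt (fun y : E3 => y k) (EuclideanSpace.proj k : E3 →L[ℝ] ℝ) y :=
      (EuclideanSpace.proj k : E3 →L[ℝ] ℝ).hasFDerivAt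
    simp [pd, this.fderiv]
  have d2 : ∀ {g : E3 → ℝ}, ContDiff ℝ 2 g → Differentiable ℝ g := fun h => h.differentiable (by simp)
  have hpN : ∀ i, pd N i = fun y => 2 * y i := by
    intro i
    rw [hN, pd_sum _ (fun k _ => d2 ((hco k).mul (hco k)))]
    ext y
    simp only [pd_mul (d2 (hco _)) (d2 (hco _)), hpc]
    simp [Finset.sum_add_distrib, two_mul]
  have hFi : ∀ i, pd (pd F i) i m = pd (pd f i) i m + 2 * δ := by
    intro i
    rw [hF, pd_add (d2 hf) ((d2 hNc).const_mul δ), pd_const_mul δ (d2 hNc), hpN,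
      pd_add (c1d (pd_contDiff hf (by norm_num) i)) (((d2 (hco i)).const_mul 2).const_mul δ),
      pd_const_mul δ ((d2 (hco i)).const_mul 2), pd_const_mul 2 (d2 (hco i)), hpc]
    simp; ring
  simp only [hFi, Finset.sum_add_distrib, hh] at hsum
  simp at hsum
  linarith

theorem liouville_harm {f : E3 → ℝ} (hf : ContDiff ℝ 2 f) (hh : ∀ x, ∑ i, pd (pd f i) i x = 0)
    (h0 : Tendsto f (cocompact E3) (𝓝 0)) : ∀ x, f x = 0 := by
  intro x
  refine le_antisymm (liouville_harm_le hf hh h0 x) ?_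
  have d2 : ∀ {g : E3 → ℝ}, ContDiff ℝ 2 g → Differentiable ℝ g := fun h => h.differentiable (by simp)
  have e : ∀ {g : E3 → ℝ} (i : Fin 3), pd (fun y => - g y) i = fun y => - pd g i y := by
    intro g i; ext y; simp only [pd]; rw [fderiv_fun_neg]; rfl
  have := liouville_harm_le (f := fun y => - f y) hf.neg (by
    intro y; simp only [e]; simp [hh]) (by simpa using h0.neg) x
  linarith


/-! ### Convolution and mollification -/

/-- convolution with a kernel -/
def cv (K f : E3 → ℝ) (x : E3) : ℝ := ∫ y, f y * K (x - y)

theorem cv_eq (K f : E3 → ℝ) :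
    cv K f = convolution f K (ContinuousLinearMap.lsmul ℝ ℝ) volume := by
  ext x; simp [cv, convolution]

theorem cv_int {K f : E3 → ℝ} (hK : Continuous K) (hc : HasCompactSupport K)
    (hf : LocallyIntegrable f volume) (x : E3) : Integrable (fun y => f y * K (x - y)) volume := by
  have := HasCompactSupport.convolutionExists_right (ContinuousLinearMap.lsmul ℝ ℝ) hc hf hK x
  simpa [ConvolutionExistsAt] using this

theorem cv_sm {K f : E3 → ℝ} (hK : Sm K) (hc : HasCompactSupport K)
    (hf : LocallyIntegrable f volume) : Sm (cv K f) := by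
  rw [cv_eq]; exact hc.contDiff_convolution_right _ hf hK

theorem cv_pd {K f : E3 → ℝ} (hK : Sm K) (hc : HasCompactSupport K)
    (hf : LocallyIntegrable f volume) (i : Fin 3) : pd (cv K f) i = cv (pd K i) f := by
  ext x
  have h := hc.hasFDerivAt_convolution_right (ContinuousLinearMap.lsmul ℝ ℝ) hf hK.c1 x
  have hi : Integrable (fun t => (f t) • fderiv ℝ K (x - t)) volume :=
    (hc.fderiv ℝ).convolutionExists_right
      (ContinuousLinearMap.lsmul ℝ ℝ (E := E3 →L[ℝ] ℝ)) hf (hK.c1.continuous_fderiv (by simp)) x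
  have e : (convolution f (fderiv ℝ K) ((ContinuousLinearMap.lsmul ℝ ℝ).precompR E3) volume) x
      = ∫ t, (f t) • fderiv ℝ K (x - t) := by
    rw [convolution]
    refine integral_congr_ae (ae_of_all _ fun t => ?_)
    ext v
    rfl
  rw [cv_eq, pd, h.fderiv, e, cv, ContinuousLinearMap.integral_apply hi]
  rfl

theorem cv_add {K f g : E3 → ℝ} (hK : Continuous K) (hc : HasCompactSupport K)
    (hf : LocallyIntegrable f volume) (hg : LocallyIntegrable g volume) (x : E3) :
    cv K (fun y => f y + g y) x = cv K f x + cv K g x := by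
  simp only [cv, add_mul]
  exact integral_add (cv_int hK hc hf x) (cv_int hK hc hg x)

theorem cv_sub {K f g : E3 → ℝ} (hK : Continuous K) (hc : HasCompactSupport K)
    (hf : LocallyIntegrable f volume) (hg : LocallyIntegrable g volume) (x : E3) :
    cv K (fun y => f y - g y) x = cv K f x - cv K g x := by
  simp only [cv, sub_mul]
  exact integral_sub (cv_int hK hc hf x) (cv_int hK hc hg x)

theorem cv_const_mul (K f : E3 → ℝ) (c : ℝ) (x : E3) :
    cv K (fun y => c * f y) x = c * cv K f x := by
  simp only [cv, mul_assoc]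
  exact integral_const_mul c _

theorem cv_zero (K : E3 → ℝ) (x : E3) : cv K (fun _ => 0) x = 0 := by simp [cv]

theorem cv_sum {K : E3 → ℝ} {ι : Type*} (s : Finset ι) {f : ι → E3 → ℝ} (hK : Continuous K)
    (hc : HasCompactSupport K) (hf : ∀ k, LocallyIntegrable (f k) volume) (x : E3) :
    cv K (fun y => ∑ k ∈ s, f k y) x = ∑ k ∈ s, cv K (f k) x := by
  simp only [cv, Finset.sum_mul]
  exact integral_finsetSum _ fun k _ => cv_int hK hc (hf k) x

theorem cv_congr {K f g : E3 → ℝ} (h : ∀ᵐ x, f x = g x) (x : E3) : cv K f x = cv K g x := by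
  apply integral_congr_ae
  filter_upwards [h] with y hy
  rw [hy]

/-- the reflected kernel as a test function -/
theorem refl_sm {K : E3 → ℝ} {n : WithTop ℕ∞} (hK : ContDiff ℝ n K) (x : E3) :
    ContDiff ℝ n (fun y => K (x - y)) := hK.comp (contDiff_const.sub contDiff_id)

theorem refl_hcs {K : E3 → ℝ} (hc : HasCompactSupport K) (x : E3) :
    HasCompactSupport (fun y => K (x - y)) :=
  hc.comp_homeomorph (Homeomorph.subLeft x)

theorem refl_pd (K : E3 → ℝ) (hK : Differentiable ℝ K) (x : E3) (i : Fin 3) :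
    pd (fun y => K (x - y)) i = fun y => - pd K i (x - y) := by
  ext y
  have h1 : HasFDerivAt (fun y : E3 => x - y) (-(ContinuousLinearMap.id ℝ E3)) y :=
    (hasFDerivAt_id y).const_sub x
  have h2 : HasFDerivAt (fun y => K (x - y)) ((fderiv ℝ K (x - y)).comp (-(ContinuousLinearMap.id ℝ E3))) y :=
    HasFDerivAt.comp y (f := fun y : E3 => x - y) (hK (x - y)).hasFDerivAt h1
  simp only [pd]; rw [h2.fderiv]; simp

/-- base mollifier -/
def kap : E3 → ℝ := (⟨1/2, 1, by norm_num, by norm_num⟩ : ContDiffBump (0 : E3)).normed volume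

theorem kap_sm : Sm kap := ContDiffBump.contDiff_normed _
theorem kap_hcs : HasCompactSupport kap := ContDiffBump.hasCompactSupport_normed _
theorem kap_nonneg (x : E3) : 0 ≤ kap x := ContDiffBump.nonneg_normed _ x
theorem kap_int : ∫ x, kap x = 1 := ContDiffBump.integral_normed _
theorem kap_tsupp : tsupport kap = closedBall 0 1 := ContDiffBump.tsupport_normed_eq _

/-- rescaled kernel -/
def scl (K : E3 → ℝ) (n : ℕ) (x : E3) : ℝ := ((n:ℝ) + 1) ^ 3 * K (((n:ℝ) + 1) • x)

theorem np (n : ℕ) : (0:ℝ) < (n:ℝ) + 1 := by positivity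

theorem scl_sm {K : E3 → ℝ} {m : WithTop ℕ∞} (hK : ContDiff ℝ m K) (n : ℕ) : ContDiff ℝ m (scl K n) :=
  contDiff_const.mul (hK.comp (contDiff_const_smul _))

theorem scl_cont {K : E3 → ℝ} (hK : Continuous K) (n : ℕ) : Continuous (scl K n) :=
  continuous_const.mul (hK.comp (continuous_const_smul _))

theorem scl_hcs {K : E3 → ℝ} (hK : HasCompactSupport K) (n : ℕ) : HasCompactSupport (scl K n) :=
  HasCompactSupport.mul_left (hK.comp_smul (np n).ne')

theorem scl_pd {K : E3 → ℝ} (hK : Differentiable ℝ K) (n : ℕ) (i : Fin 3) :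
    pd (scl K n) i = fun x => ((n:ℝ) + 1) * scl (pd K i) n x := by
  ext x
  have h1 : HasFDerivAt (fun y : E3 => ((n:ℝ) + 1) • y) (((n:ℝ) + 1) • (ContinuousLinearMap.id ℝ E3)) x :=
    (((n:ℝ) + 1) • (ContinuousLinearMap.id ℝ E3)).hasFDerivAt
  have h2 := (HasFDerivAt.comp x (f := fun y : E3 => ((n:ℝ) + 1) • y) (hK _).hasFDerivAt h1).const_mul (((n:ℝ) + 1) ^ 3)
  have h3 : HasFDerivAt (scl K n) _ x := h2
  simp only [pd]; rw [h3.fderiv]; simp [scl, pd]; ring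

theorem scl_int (K : E3 → ℝ) (n : ℕ) : ∫ x, scl K n x = ∫ x, K x := by
  simp only [scl]
  rw [integral_const_mul, Measure.integral_comp_smul]
  simp only [finrank_euclideanSpace, Fintype.card_fin, smul_eq_mul]
  rw [abs_of_pos (by have := np n; positivity)]
  have := np n
  field_simp

theorem scl_supp {K : E3 → ℝ} (hK : tsupport K ⊆ closedBall 0 1) (n : ℕ) {x : E3} (hx : ((n:ℝ)+1)⁻¹ < ‖x‖) :
    scl K n x = 0 := by
  have : K (((n:ℝ) + 1) • x) = 0 := by
    apply image_eq_zero_of_notMem_tsupport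
    intro h
    have h := hK h
    rw [mem_closedBall_zero_iff, norm_smul, Real.norm_of_nonneg (np n).le] at h
    rw [inv_lt_iff_one_lt_mul₀ (np n)] at hx
    linarith
  simp [scl, this]

abbrev ker (n : ℕ) : E3 → ℝ := scl kap n
abbrev mo (n : ℕ) (f : E3 → ℝ) : E3 → ℝ := cv (ker n) f

theorem ker_sm (n : ℕ) : Sm (ker n) := scl_sm kap_sm n
theorem ker_cont (n : ℕ) : Continuous (ker n) := (ker_sm n).continuous
theorem ker_hcs (n : ℕ) : HasCompactSupport (ker n) := scl_hcs kap_hcs n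
theorem ker_nonneg (n : ℕ) (x : E3) : 0 ≤ ker n x :=
  mul_nonneg (pow_nonneg (np n).le 3) (kap_nonneg _)
theorem ker_int (n : ℕ) : ∫ x, ker n x = 1 := (scl_int _ n).trans kap_int
theorem ker_supp (n : ℕ) {x : E3} (hx : ((n:ℝ)+1)⁻¹ < ‖x‖) : ker n x = 0 :=
  scl_supp kap_tsupp.le n hx
theorem ker_integrable (n : ℕ) : Integrable (ker n) volume :=
  (ker_cont n).integrable_of_hasCompactSupport (ker_hcs n)
theorem ker_int' (n : ℕ) (x : E3) : ∫ y, ker n (x - y) = 1 := by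
  rw [integral_sub_left_eq_self (ker n) volume x]; exact ker_int n
theorem mo_sm (n : ℕ) {f : E3 → ℝ} (hf : LocallyIntegrable f volume) : Sm (mo n f) :=
  cv_sm (ker_sm n) (ker_hcs n) hf
theorem mo_pd (n : ℕ) {f : E3 → ℝ} (hf : LocallyIntegrable f volume) (i : Fin 3) :
    pd (mo n f) i = cv (pd (ker n) i) f := cv_pd (ker_sm n) (ker_hcs n) hf i

theorem mo_le (n : ℕ) {f : E3 → ℝ} (hf : LocallyIntegrable f volume) {M : ℝ} (h : ∀ᵐ x, f x ≤ M) (x : E3) :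
    mo n f x ≤ M := by
  have h1 : ∫ y, M * ker n (x - y) = M := by rw [integral_const_mul, ker_int', mul_one]
  rw [← h1]
  refine integral_mono_ae (cv_int (ker_cont n) (ker_hcs n) hf x) ?_ ?_
  · exact ((ker_integrable n).comp_sub_left x).const_mul M
  · filter_upwards [h] with y hy
    exact mul_le_mul_of_nonneg_right hy (ker_nonneg n _)

theorem mo_ge (n : ℕ) {f : E3 → ℝ} (hf : LocallyIntegrable f volume) {M : ℝ} (h : ∀ᵐ x, M ≤ f x) (x : E3) :
    M ≤ mo n f x := by
  have h1 : ∫ y, M * ker n (x - y) = M := by rw [integral_const_mul, ker_int', mul_one]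
  rw [← h1]
  refine integral_mono_ae ?_ (cv_int (ker_cont n) (ker_hcs n) hf x) ?_
  · exact ((ker_integrable n).comp_sub_left x).const_mul M
  · filter_upwards [h] with y hy
    exact mul_le_mul_of_nonneg_right hy (ker_nonneg n _)

theorem mo_abs_le (n : ℕ) {f : E3 → ℝ} (hf : LocallyIntegrable f volume) {M : ℝ} (h : ∀ᵐ x, |f x| ≤ M) (x : E3) :
    |mo n f x| ≤ M :=
  abs_le.mpr ⟨mo_ge n hf (h.mono fun x hx => (abs_le.mp hx).1) x,
    mo_le n hf (h.mono fun x hx => (abs_le.mp hx).2) x⟩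

/-- sup bound for general rescaled kernels -/
theorem scl_cv_abs_le {K : E3 → ℝ} (hK : Continuous K) (hc : HasCompactSupport K) (n : ℕ) {f : E3 → ℝ}
    {M : ℝ} (h : ∀ᵐ x, |f x| ≤ M) (x : E3) : |cv (scl K n) f x| ≤ M * ∫ y, |K y| := by
  have e : ∫ y, |scl K n (x - y)| = ∫ y, |K y| := by
    rw [integral_sub_left_eq_self (fun y => |scl K n y|) volume x, ← scl_int (fun y => |K y|) n]
    congr 1; ext y; simp [scl, abs_mul, abs_of_pos (np n)]
  rw [← e, ← integral_const_mul, cv, ← Real.norm_eq_abs]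
  have hi : Integrable (fun y => |scl K n (x - y)|) volume :=
    (((scl_cont hK n).integrable_of_hasCompactSupport (scl_hcs hc n)).comp_sub_left x).abs
  refine (norm_integral_le_integral_norm _).trans (integral_mono_of_nonneg
    (ae_of_all _ fun y => norm_nonneg _) (hi.const_mul M) ?_)
  filter_upwards [h] with y hy
  simp only [Real.norm_eq_abs, abs_mul]
  exact mul_le_mul_of_nonneg_right hy (abs_nonneg _)

/-- a.e. convergence -/
theorem ae_tendsto_scl {K : E3 → ℝ} (hK : Continuous K) (hs : tsupport K ⊆ closedBall 0 1)
    {f : E3 → ℝ} (hf : LocallyIntegrable f volume) :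
    ∀ᵐ x, Tendsto (fun n => cv (scl K n) f x) atTop (𝓝 ((∫ y, K y) * f x)) := by
  have hc : HasCompactSupport K := (isCompact_closedBall (0:E3) 1).of_isClosed_subset (isClosed_tsupport _) hs
  obtain ⟨C, hC⟩ := hc.exists_bound_of_continuous hK
  filter_upwards [IsUnifLocDoublingMeasure.ae_tendsto_average_norm_sub (volume : Measure E3) hf 1] with x hx
  have hδ : Tendsto (fun n : ℕ => ((n:ℝ)+1)⁻¹) atTop (𝓝[>] 0) := by
    refine tendsto_nhdsWithin_iff.mpr ⟨?_, Eventually.of_forall fun n => inv_pos.mpr (np n)⟩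
    exact tendsto_inv_atTop_zero.comp (tendsto_atTop_add_const_right _ _ tendsto_natCast_atTop_atTop)
  have h1 := hx (fun _ => x) (fun n : ℕ => ((n:ℝ)+1)⁻¹) hδ
    (Eventually.of_forall fun n => by simpa using (np n).le)
  rw [tendsto_iff_norm_sub_tendsto_zero]
  have h2 := h1.const_mul (C * volume.real (closedBall (0:E3) 1))
  rw [mul_zero] at h2
  refine squeeze_zero (fun _ => norm_nonneg _) (fun n => ?_) h2
  have hsi : Integrable (fun y => scl K n (x - y)) volume :=
    ((scl_cont hK n).integrable_of_hasCompactSupport (scl_hcs hc n)).comp_sub_left x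
  have e1 : cv (scl K n) f x - (∫ y, K y) * f x = ∫ y, (f y - f x) * scl K n (x - y) := by
    simp only [sub_mul]
    rw [integral_sub (cv_int (scl_cont hK n) (scl_hcs hc n) hf x) (hsi.const_mul _), integral_const_mul,
      integral_sub_left_eq_self (scl K n) volume x, scl_int, mul_comm (f x)]; rfl
  rw [e1]
  have hsz : ∀ y ∉ closedBall x ((n:ℝ)+1)⁻¹, (f y - f x) * scl K n (x - y) = 0 := by
    intro y hy
    rw [scl_supp hs n, mul_zero]
    rw [mem_closedBall, not_le, dist_comm, dist_eq_norm] at hy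
    exact hy
  rw [← setIntegral_eq_integral_of_forall_compl_eq_zero hsz]
  have hIn : IntegrableOn (fun y => ‖f y - f x‖) (closedBall x ((n:ℝ)+1)⁻¹) volume :=
    ((hf.integrableOn_isCompact (isCompact_closedBall _ _)).sub
      (integrableOn_const (isCompact_closedBall x _).measure_lt_top.ne)).norm
  refine (norm_integral_le_integral_norm _).trans ?_
  have : ∫ y in closedBall x ((n:ℝ)+1)⁻¹, ‖(f y - f x) * scl K n (x - y)‖ ≤
      ∫ y in closedBall x ((n:ℝ)+1)⁻¹, (((n:ℝ)+1)^3 * C) * ‖f y - f x‖ := by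
    refine integral_mono_of_nonneg (ae_of_all _ fun y => norm_nonneg _) (hIn.const_mul _) (ae_of_all _ fun y => ?_)
    simp only [norm_mul, scl]
    rw [mul_comm ‖f y - f x‖, norm_pow, Real.norm_of_nonneg (np n).le]
    have := hC (((n:ℝ)+1) • (x - y))
    gcongr
  refine this.trans (le_of_eq ?_)
  rw [integral_const_mul, setAverage_eq, Measure.addHaar_real_closedBall' _ _ (inv_pos.mpr (np n)).le]
  have hv : volume.real (closedBall (0:E3) 1) ≠ 0 := by
    rw [measureReal_def, ENNReal.toReal_ne_zero]
    exact ⟨(measure_closedBall_pos _ _ one_pos).ne', (isCompact_closedBall _ _).measure_lt_top.ne⟩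
  simp only [finrank_euclideanSpace, Fintype.card_fin, smul_eq_mul]
  have := np n
  field_simp

theorem ae_tendsto_mo {f : E3 → ℝ} (hf : LocallyIntegrable f volume) :
    ∀ᵐ x, Tendsto (fun n => mo n f x) atTop (𝓝 (f x)) := by
  filter_upwards [ae_tendsto_scl kap_sm.continuous kap_tsupp.le hf] with x hx
  simpa [kap_int] using hx

theorem tsupp_pd_kap (i : Fin 3) : tsupport (pd kap i) ⊆ closedBall 0 1 := by
  rw [← kap_tsupp]
  refine closure_minimal ?_ (isClosed_tsupport _)
  intro x hx
  by_contra h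
  apply hx
  have : fderiv ℝ kap x = 0 := by
    by_contra h2
    exact h (support_fderiv_subset ℝ h2)
  simp [pd, this]

theorem ae_tendsto_pd_mo {f : E3 → ℝ} (hf : LocallyIntegrable f volume) (i : Fin 3) :
    ∀ᵐ x, Tendsto (fun n : ℕ => ((n:ℝ)+1)⁻¹ * pd (mo n f) i x) atTop (𝓝 0) := by
  filter_upwards [ae_tendsto_scl (pd_cont kap_sm.c1 i) (tsupp_pd_kap i) hf] with x hx
  rw [integral_pd_zero kap_sm.c1 kap_hcs, zero_mul] at hx
  refine hx.congr fun n => ?_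
  rw [mo_pd n hf, scl_pd kap_sm.d]
  have : cv (fun x => ((n:ℝ)+1) * scl (pd kap i) n x) f x = ((n:ℝ)+1) * cv (scl (pd kap i) n) f x := by
    simp only [cv]; rw [← integral_const_mul]; congr 1; ext y; ring
  rw [this, ← mul_assoc, inv_mul_cancel₀ (np n).ne', one_mul]

theorem pd_mo_abs_le {f : E3 → ℝ} (hf : LocallyIntegrable f volume) {M : ℝ} (h : ∀ᵐ x, |f x| ≤ M) (i : Fin 3)
    (n : ℕ) (x : E3) : |((n:ℝ)+1)⁻¹ * pd (mo n f) i x| ≤ M * ∫ y, |pd kap i y| := by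
  have e : ((n:ℝ)+1)⁻¹ * pd (mo n f) i x = cv (scl (pd kap i) n) f x := by
    rw [mo_pd n hf, scl_pd kap_sm.d]
    have : cv (fun x => ((n:ℝ)+1) * scl (pd kap i) n x) f x = ((n:ℝ)+1) * cv (scl (pd kap i) n) f x := by
      simp only [cv]; rw [← integral_const_mul]; congr 1; ext y; ring
    rw [this, ← mul_assoc, inv_mul_cancel₀ (np n).ne', one_mul]
  rw [e]
  exact scl_cv_abs_le (pd_cont kap_sm.c1 i) (hcs_pd kap_hcs i) n h x

/-- vanishing at infinity in a weak sense -/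
def VI (f : E3 → ℝ) : Prop := ∀ δ : ℝ, 0 < δ → ∃ g : E3 → ℝ, Integrable g volume ∧ ∀ᵐ x, |f x - g x| ≤ δ

theorem cv_tendsto_zero {K f : E3 → ℝ} (hK : Continuous K) (hc : HasCompactSupport K)
    (hf : LocallyIntegrable f volume) (hv : VI f) : Tendsto (cv K f) (cocompact E3) (𝓝 0) := by
  obtain ⟨C, hC⟩ := hc.exists_bound_of_continuous hK
  have hC0 : 0 ≤ C := (norm_nonneg _).trans (hC 0)
  have hKi : Integrable K volume := hK.integrable_of_hasCompactSupport hc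
  set I := ∫ y, |K y| with hI
  have hI0 : 0 ≤ I := integral_nonneg fun y => abs_nonneg _
  rw [Metric.tendsto_nhds]
  intro ε hε
  set δ := ε / (2 * (C + I + 1)) with hδ
  have hδ0 : 0 < δ := by positivity
  obtain ⟨g, hg, hfg⟩ := hv δ hδ0
  obtain ⟨g', hg'c, hgg', hg'cont, hg'i⟩ := hg.exists_hasCompactSupport_integral_sub_le hδ0
  obtain ⟨A, hA⟩ := hc.isCompact.isBounded.exists_norm_le
  obtain ⟨B, hB⟩ := hg'c.isCompact.isBounded.exists_norm_le
  have hev : ∀ᶠ x : E3 in cocompact E3, A + B < ‖x‖ :=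
    tendsto_norm_cocompact_atTop.eventually_gt_atTop _
  filter_upwards [hev] with x hx
  have z : cv K g' x = 0 := by
    refine integral_eq_zero_of_ae (ae_of_all _ fun y => ?_)
    show g' y * K (x - y) = 0
    by_contra h
    have h1 : y ∈ tsupport g' := subset_closure (left_ne_zero_of_mul h)
    have h2 : x - y ∈ tsupport K := subset_closure (right_ne_zero_of_mul h)
    have := hA _ h2; have := hB _ h1
    have : ‖x‖ ≤ ‖x - y‖ + ‖y‖ := by simpa using norm_add_le (x - y) y
    linarith
  have hgl := hg.locallyIntegrable
  have hgl' := hg'i.locallyIntegrable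
  have e : cv K f x = cv K (fun y => f y - g y) x + cv K (fun y => g y - g' y) x := by
    rw [cv_sub hK hc hf hgl, cv_sub hK hc hgl hgl', z]; ring
  have b1 : |cv K (fun y => f y - g y) x| ≤ δ * I := by
    rw [hI, ← integral_sub_left_eq_self (fun y => |K y|) volume x, ← integral_const_mul, cv, ← Real.norm_eq_abs]
    refine (norm_integral_le_integral_norm _).trans (integral_mono_of_nonneg
      (ae_of_all _ fun y => norm_nonneg _) ((hKi.abs.comp_sub_left x).const_mul δ) ?_)
    filter_upwards [hfg] with y hy
    simp only [Real.norm_eq_abs, abs_mul]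
    exact mul_le_mul_of_nonneg_right hy (abs_nonneg _)
  have b2 : |cv K (fun y => g y - g' y) x| ≤ C * δ := by
    rw [cv, ← Real.norm_eq_abs]
    refine (norm_integral_le_integral_norm _).trans ?_
    refine le_trans (integral_mono_of_nonneg (g := fun y => C * ‖g y - g' y‖)
      (ae_of_all _ fun y => norm_nonneg _) ((hg.sub hg'i).norm.const_mul C) (ae_of_all _ fun y => ?_)) ?_
    · simp only [norm_mul]; rw [mul_comm]
      exact mul_le_mul_of_nonneg_right (hC _) (norm_nonneg _)
    · rw [integral_const_mul]; gcongr
  rw [dist_zero_right, e]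
  refine (norm_add_le _ _).trans_lt ?_
  rw [Real.norm_eq_abs, Real.norm_eq_abs]
  have : δ * I + C * δ < ε := by
    have h3 : δ * (C + I + 1) = ε / 2 := by rw [hδ]; field_simp
    nlinarith
  linarith

/-- L¹ contraction and convergence -/
theorem mo_integrable (n : ℕ) {f : E3 → ℝ} (hf : Integrable f volume) : Integrable (mo n f) volume := by
  rw [mo, cv_eq]; exact hf.integrable_convolution _ (ker_integrable n)

theorem mo_integral (n : ℕ) {f : E3 → ℝ} (hf : Integrable f volume) : ∫ x, mo n f x = ∫ x, f x := by
  rw [mo, cv_eq, integral_convolution _ hf (ker_integrable n), ker_int]; simp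

theorem mo_abs (n : ℕ) (f : E3 → ℝ) (x : E3) : |mo n f x| ≤ mo n (fun y => |f y|) x := by
  rw [mo, cv, mo, cv, ← Real.norm_eq_abs]
  refine (norm_integral_le_integral_norm _).trans (le_of_eq ?_)
  congr 1; ext y
  rw [norm_mul, Real.norm_eq_abs, Real.norm_of_nonneg (ker_nonneg n _)]

theorem mo_tendsto_L1 {f : E3 → ℝ} (hf : Integrable f volume) :
    Tendsto (fun n => ∫ x, |mo n f x - f x|) atTop (𝓝 0) := by
  have hA : ∀ n, Integrable (mo n fun y => |f y|) volume := fun n => mo_integrable n hf.abs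
  have ha : ∀ n, Integrable (mo n f) volume := fun n => mo_integrable n hf
  have t1 := ae_tendsto_mo hf.locallyIntegrable
  have t2 := ae_tendsto_mo hf.abs.locallyIntegrable
  have hA0 : ∀ n x, 0 ≤ mo n (fun y => |f y|) x := fun n x => (abs_nonneg _).trans (mo_abs n f x)
  have s1 : Tendsto (fun n => ∫ x, max (|f x| - mo n (fun y => |f y|) x) 0) atTop (𝓝 (∫ x : E3, (0:ℝ))) := by
    refine tendsto_integral_of_dominated_convergence (fun x => |f x|) (fun n => ?_) hf.abs (fun n => ?_) ?_
    · exact ((hf.abs.sub (hA n)).pos_part).aestronglyMeasurable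
    · refine ae_of_all _ fun x => ?_
      rw [Real.norm_of_nonneg (le_max_right _ _)]
      exact max_le (by linarith [hA0 n x]) (abs_nonneg _)
    · filter_upwards [t2] with x hx
      have := (tendsto_const_nhds (x := |f x|)).sub hx
      simpa using this.max (tendsto_const_nhds (x := (0:ℝ)))
  have s2 : Tendsto (fun n => ∫ x, abs (mo n (fun y => |f y|) x - |f x|)) atTop (𝓝 0) := by
    have : ∀ n, ∫ x, abs (mo n (fun y => |f y|) x - |f x|) = 2 * ∫ x, max (|f x| - mo n (fun y => |f y|) x) 0 := by
      intro n
      have e : ∀ x, abs (mo n (fun y => |f y|) x - |f x|) =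
          2 * max (|f x| - mo n (fun y => |f y|) x) 0 + (mo n (fun y => |f y|) x - |f x|) := by
        intro x
        rcases le_total (mo n (fun y => |f y|) x) |f x| with h | h
        · rw [max_eq_left (by linarith), abs_of_nonpos (by linarith)]; ring
        · rw [max_eq_right (by linarith), abs_of_nonneg (by linarith)]; ring
      simp_rw [e]
      have i1 : Integrable (fun x => 2 * max (|f x| - mo n (fun y => |f y|) x) 0) volume :=
        ((hf.abs.sub (hA n)).pos_part).const_mul 2
      have i2 : Integrable (fun x => mo n (fun y => |f y|) x - |f x|) volume := (hA n).sub hf.abs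
      rw [integral_add i1 i2, integral_const_mul,
        integral_sub (hA n) hf.abs, mo_integral n hf.abs]; ring
    simp_rw [this]
    simpa using s1.const_mul 2
  have s3 : Tendsto (fun n => ∫ x, max (|mo n f x - f x| - abs (mo n (fun y => |f y|) x - |f x|)) 0) atTop
      (𝓝 (∫ x : E3, (0:ℝ))) := by
    refine tendsto_integral_of_dominated_convergence (fun x => 2 * |f x|) (fun n => ?_) (hf.abs.const_mul 2)
      (fun n => ?_) ?_
    · exact ((((ha n).sub hf).abs.sub ((hA n).sub hf.abs).abs).pos_part).aestronglyMeasurable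
    · refine ae_of_all _ fun x => ?_
      rw [Real.norm_of_nonneg (le_max_right _ _)]
      refine max_le ?_ (by positivity)
      have h1 := abs_sub (mo n f x) (f x)
      have h2 := mo_abs n f x
      have h3 := le_abs_self (mo n (fun y => |f y|) x - |f x|)
      linarith
    · filter_upwards [t1, t2] with x h1 h2
      have a := (h1.sub (tendsto_const_nhds (x := f x))).abs
      have b := (h2.sub (tendsto_const_nhds (x := |f x|))).abs
      simpa using (a.sub b).max (tendsto_const_nhds (x := (0:ℝ)))
  have s4 := s3.add s2
  simp only [integral_zero, add_zero] at s4
  refine squeeze_zero (fun n => integral_nonneg fun x => abs_nonneg _) (fun n => ?_) s4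
  have i1 : Integrable (fun x => max (|mo n f x - f x| - abs (mo n (fun y => |f y|) x - |f x|)) 0) volume :=
    (((ha n).sub hf).abs.sub ((hA n).sub hf.abs).abs).pos_part
  have i2 : Integrable (fun x => abs (mo n (fun y => |f y|) x - |f x|)) volume := ((hA n).sub hf.abs).abs
  rw [← integral_add i1 i2]
  refine integral_mono ((ha n).sub hf).abs (i1.add i2) fun x => ?_
  have := le_max_left (|mo n f x - f x| - abs (mo n (fun y => |f y|) x - |f x|)) 0
  simp only [Pi.sub_apply, Pi.add_apply]
  linarith


/-! ### Weak formulation and its pointwise mollified form -/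

abbrev LI (f : E3 → ℝ) : Prop := LocallyIntegrable f volume

/-- pairing -/
def Ip (f φ : E3 → ℝ) : ℝ := ∫ y, f y * φ y

theorem Ip_integrable {f φ : E3 → ℝ} (hf : LI f) (hφ : Continuous φ) (hc : HasCompactSupport φ) :
    Integrable (fun y => f y * φ y) volume := by
  have := hf.integrable_smul_right_of_hasCompactSupport hφ hc
  exact this

theorem Ip_sub {f g φ : E3 → ℝ} (hf : LI f) (hg : LI g) (hφ : Continuous φ) (hc : HasCompactSupport φ) :
    Ip (fun y => f y - g y) φ = Ip f φ - Ip g φ := by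
  simp only [Ip, sub_mul]
  exact integral_sub (Ip_integrable hf hφ hc) (Ip_integrable hg hφ hc)

theorem Ip_add {f g φ : E3 → ℝ} (hf : LI f) (hg : LI g) (hφ : Continuous φ) (hc : HasCompactSupport φ) :
    Ip (fun y => f y + g y) φ = Ip f φ + Ip g φ := by
  simp only [Ip, add_mul]
  exact integral_add (Ip_integrable hf hφ hc) (Ip_integrable hg hφ hc)

/-- very weak equation `μ Δ z + κ ∇ div z = div T - g` -/
structure VW (μ κ : ℝ) (z : Fin 3 → E3 → ℝ) (T : Fin 3 → Fin 3 → E3 → ℝ) (g : Fin 3 → E3 → ℝ) : Prop where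
  lz : ∀ i, LI (z i)
  lT : ∀ i j, LI (T i j)
  lg : ∀ i, LI (g i)
  eq : ∀ i, ∀ φ : E3 → ℝ, Sm φ → HasCompactSupport φ →
    -(μ * ∑ j, Ip (z i) (pd (pd φ j) j) + κ * ∑ k, Ip (z k) (pd (pd φ i) k))
      = ∑ j, Ip (T i j) (pd φ j) + Ip (g i) φ

theorem VW.sub {μ κ : ℝ} {z z' : Fin 3 → E3 → ℝ} {T T' : Fin 3 → Fin 3 → E3 → ℝ} {g g' : Fin 3 → E3 → ℝ}
    (h : VW μ κ z T g) (h' : VW μ κ z' T' g') :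
    VW μ κ (fun i x => z i x - z' i x) (fun i j x => T i j x - T' i j x) (fun i x => g i x - g' i x) where
  lz i := (h.lz i).sub (h'.lz i)
  lT i j := (h.lT i j).sub (h'.lT i j)
  lg i := (h.lg i).sub (h'.lg i)
  eq i φ hφ hc := by
    have e1 := h.eq i φ hφ hc
    have e2 := h'.eq i φ hφ hc
    have a1 : ∀ j k l, Ip (fun x => z j x - z' j x) (pd (pd φ k) l) = _ := fun j k l =>
      Ip_sub (h.lz j) (h'.lz j) ((hφ.pd k).pd l).continuous (hcs_pd (hcs_pd hc k) l)
    have a2 : ∀ j k, Ip (fun x => T i j x - T' i j x) (pd φ k) = _ := fun j k =>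
      Ip_sub (h.lT i j) (h'.lT i j) (hφ.pd k).continuous (hcs_pd hc k)
    have a3 : Ip (fun x => g i x - g' i x) φ = _ := Ip_sub (h.lg i) (h'.lg i) hφ.continuous hc
    simp only [a1, a2, a3, Finset.sum_sub_distrib]
    linarith

theorem Ip_refl (f K : E3 → ℝ) (x : E3) : Ip f (fun y => K (x - y)) = cv K f x := rfl

theorem Ip_neg (f K : E3 → ℝ) : Ip f (fun y => -K y) = - Ip f K := by
  simp only [Ip, mul_neg]; exact integral_neg _

theorem pd_neg (f : E3 → ℝ) (i : Fin 3) : pd (fun y => - f y) i = fun y => - pd f i y := by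
  ext x; simp only [pd]
  have : fderiv ℝ (fun y => - f y) x = - fderiv ℝ f x := fderiv_fun_neg
  rw [this]; rfl

theorem VW.pointwise {μ κ : ℝ} {z : Fin 3 → E3 → ℝ} {T : Fin 3 → Fin 3 → E3 → ℝ} {g : Fin 3 → E3 → ℝ}
    (h : VW μ κ z T g) (n : ℕ) (i : Fin 3) (x : E3) :
    μ * ∑ j, pd (pd (mo n (z i)) j) j x + κ * ∑ k, pd (pd (mo n (z k)) k) i x
      = ∑ j, pd (mo n (T i j)) j x - mo n (g i) x := by
  have hK := ker_sm n
  have hc := ker_hcs n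
  have e := h.eq i (fun y => ker n (x - y)) (refl_sm hK x) (refl_hcs hc x)
  have r1 : ∀ j, pd (fun y => ker n (x - y)) j = fun y => - pd (ker n) j (x - y) :=
    fun j => refl_pd _ hK.d x j
  have r2 : ∀ j k, pd (pd (fun y => ker n (x - y)) j) k = fun y => pd (pd (ker n) j) k (x - y) := by
    intro j k
    rw [r1, pd_neg, refl_pd _ (hK.pd j).d x k]
    ext y; ring
  have s1 : ∀ l j k, pd (pd (mo n (z l)) j) k x = cv (pd (pd (ker n) j) k) (z l) x := by
    intro l j k
    rw [mo_pd n (h.lz l), cv_pd (hK.pd j) (hcs_pd hc j) (h.lz l)]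
  have s3 : ∀ j k, pd (mo n (T i j)) k x = cv (pd (ker n) k) (T i j) x := by
    intro j k; rw [mo_pd n (h.lT i j)]
  simp only [r2] at e
  have r3 : ∀ j, Ip (T i j) (pd (fun y => ker n (x - y)) j) = - cv (pd (ker n) j) (T i j) x := by
    intro j
    rw [r1]; exact Ip_neg _ (fun y => pd (ker n) j (x - y))
  simp only [r3] at e
  simp only [Ip_refl, Finset.sum_neg_distrib] at e
  simp only [s1, s3]
  have s2 : ∀ k, cv (pd (pd (ker n) k) i) (z k) x = cv (pd (pd (ker n) i) k) (z k) x := by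
    intro k
    have : pd (pd (ker n) k) i = pd (pd (ker n) i) k := pd_comm hK.c2 k i
    rw [this]
  simp only [s2]
  linarith

theorem hcs_single {φ : E3 → ℝ} (hc : HasCompactSupport φ) (i : Fin 3) :
    HasCompactSupport (fun y => fun k : Fin 3 => if k = i then φ y else 0) := by
  refine hc.comp_left (g := fun t : ℝ => fun k : Fin 3 => if k = i then t else 0) ?_
  ext k; simp

theorem sm_single {φ : E3 → ℝ} {m : WithTop ℕ∞} (h : ContDiff ℝ m φ) (i : Fin 3) :
    ContDiff ℝ m (fun y => fun k : Fin 3 => if k = i then φ y else 0) := by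
  rw [contDiff_pi]
  intro k
  by_cases hk : k = i
  · simpa [hk] using h
  · simp only [hk, if_false]; exact contDiff_const

theorem pd_single (φ : E3 → ℝ) (i k j : Fin 3) :
    pd (fun y => if k = i then φ y else 0) j = fun x => if k = i then pd φ j x else 0 := by
  by_cases hk : k = i
  · simp [hk]
  · ext x; simp only [hk, if_false]
    simp [pd]

theorem vw_of_sol {μ η : ℝ} {p : ℝ → ℝ} {G : E3 → ℝ} {dG : E3 → Fin 3 → ℝ} {ρ : E3 → ℝ} {u : E3 → Fin 3 → ℝ}
    (h : VeryWeakSolution μ η p G dG ρ u) (lF : ∀ i j, LI (fun x => ρ x * u x i * u x j)) 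
    (lu : ∀ i, LI (fun x => u x i)) (lg : ∀ i, LI (fun x => ρ x * dG x i)) :
    VW μ (μ/3+η) (fun i x => u x i)
      (fun i j x => ρ x * u x i * u x j + if i = j then p (ρ x) else 0) (fun i x => ρ x * dG x i) := by
  have lP : ∀ i j : Fin 3, LI (fun x => if i = j then p (ρ x) else 0) := by
    intro i j
    by_cases hij : i = j
    · simpa [hij] using h.pρ_locInt
    · simp only [hij, if_false]; exact locallyIntegrable_const 0
  refine ⟨lu, fun i j => (lF i j).add (lP i j), lg, ?_⟩
  intro i φ hφ hc
  have e := h.momentum (fun y => fun k => if k = i then φ y else 0) (sm_single hφ.c2 i) (hcs_single hc i)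
  have l1 : ∀ k x, lap (fun y => fun k => if k = i then φ y else 0) k x =
      if k = i then ∑ j, pd (pd φ j) j x else 0 := by
    intro k x
    simp only [lap, pd_single]
    by_cases hk : k = i <;> simp [hk]
  have l2 : ∀ k x, gradDivg (fun y => fun k => if k = i then φ y else 0) k x = pd (pd φ i) k x := by
    intro k x
    simp only [gradDivg, pd_single, Finset.sum_ite_eq', Finset.mem_univ, if_true]
  have l3 : ∀ x k j, tgrad (fun y => fun k => if k = i then φ y else 0) x k j = if k = i then pd φ j x else 0 := by
    intro x k j
    simp only [tgrad, pd_single]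
  simp only [l1, l2, l3] at e
  have c1 : ∀ j, Continuous (pd φ j) := fun j => (hφ.pd j).continuous
  have c2 : ∀ j k, Continuous (pd (pd φ j) k) := fun j k => ((hφ.pd j).pd k).continuous
  have k1 : ∀ j, HasCompactSupport (pd φ j) := fun j => hcs_pd hc j
  have k2 : ∀ j k, HasCompactSupport (pd (pd φ j) k) := fun j k => hcs_pd (hcs_pd hc j) k
  have E1 : ∫ x, ((∑ k, ∑ j, ρ x * u x k * u x j * (if k = i then pd φ j x else 0))
        + p (ρ x) * (∑ k, if k = i then pd φ k x else 0)) =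
      ∑ j, Ip (fun x => ρ x * u x i * u x j + if i = j then p (ρ x) else 0) (pd φ j) := by
    simp only [Ip]
    have lFP : ∀ j, LI (fun x => ρ x * u x i * u x j + if i = j then p (ρ x) else 0) :=
      fun j => (lF i j).add (lP i j)
    rw [← integral_finsetSum _ fun j _ => Ip_integrable (lFP j) (c1 j) (k1 j)]
    refine integral_congr_ae (ae_of_all _ fun x => ?_)
    simp only [mul_ite, mul_zero, Finset.sum_ite_eq', Finset.mem_univ, if_true, add_mul, Finset.sum_add_distrib,
      ite_mul, zero_mul, Finset.sum_ite_eq]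
    congr 1
    rw [Finset.sum_comm]
    simp
  have E2 : ∫ x, ∑ k, (μ * (if k = i then ∑ j, pd (pd φ j) j x else 0) + (μ / 3 + η) * pd (pd φ i) k x) * u x k
      = μ * ∑ j, Ip (fun x => u x i) (pd (pd φ j) j) + (μ/3+η) * ∑ k, Ip (fun x => u x k) (pd (pd φ i) k) := by
    simp only [Ip]
    rw [← integral_finsetSum _ fun j _ => Ip_integrable (lu i) (c2 j j) (k2 j j),
      ← integral_finsetSum _ fun k _ => Ip_integrable (lu k) (c2 i k) (k2 i k), ← integral_const_mul,
      ← integral_const_mul, ← integral_add]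
    · refine integral_congr_ae (ae_of_all _ fun x => ?_)
      simp only [Fin.sum_univ_three]
      fin_cases i <;> simp <;> ring
    · exact (integrable_finsetSum _ fun j _ => Ip_integrable (lu i) (c2 j j) (k2 j j)).const_mul _
    · exact (integrable_finsetSum _ fun k _ => Ip_integrable (lu k) (c2 i k) (k2 i k)).const_mul _
  have E3' : ∫ x, ∑ k, ρ x * dG x k * (if k = i then φ x else 0) = Ip (fun x => ρ x * dG x i) φ := by
    simp only [Ip, mul_ite, mul_zero, Finset.sum_ite_eq', Finset.mem_univ, if_true]
  rw [E1, E2, E3'] at e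
  linarith

theorem mass_pointwise {ρ : E3 → ℝ} {u : E3 → Fin 3 → ℝ} (lm : ∀ i, LI (fun x => ρ x * u x i))
    (hm : ∀ φ : E3 → ℝ, Sm φ → HasCompactSupport φ → ∫ x, ρ x * (∑ i, u x i * pd φ i x) = 0) (n : ℕ) (x : E3) :
    ∑ i, pd (mo n (fun y => ρ y * u y i)) i x = 0 := by
  have hK := ker_sm n
  have hc := ker_hcs n
  have e := hm (fun y => ker n (x - y)) (refl_sm hK x) (refl_hcs hc x)
  simp only [refl_pd _ hK.d x] at e
  simp only [mo_pd n (lm _)]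
  rw [← neg_eq_zero, ← e, ← Finset.sum_neg_distrib]
  simp only [cv]
  rw [← Finset.sum_congr rfl (fun i _ => integral_neg _), ← integral_finsetSum]
  · refine integral_congr_ae (ae_of_all _ fun y => ?_)
    simp only [Finset.mul_sum]
    exact Finset.sum_congr rfl fun k _ => by ring
  · intro i _
    exact (cv_int (hK.pd i).continuous (hcs_pd hc i) (lm i) x).neg


/-! ### Lp tools -/

abbrev ML (f : E3 → ℝ) (p : ENNReal) : Prop := MemLp f p volume

/-- convergence in Lp -/
def LpT (p : ENNReal) (f : ℕ → E3 → ℝ) (g : E3 → ℝ) : Prop :=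
  Tendsto (fun n => eLpNorm (fun x => f n x - g x) p volume) atTop (𝓝 0)

/-- real valued Lp norm -/
def nm (p : ENNReal) (f : E3 → ℝ) : ℝ := (eLpNorm f p volume).toReal

theorem nm_nonneg (p : ENNReal) (f : E3 → ℝ) : 0 ≤ nm p f := ENNReal.toReal_nonneg

theorem hold_int {p q : ENNReal} {f g : E3 → ℝ} (hpq : p⁻¹ + q⁻¹ = 1) (hf : ML f p) (hg : ML g q) :
    Integrable (fun x => f x * g x) volume := by
  have : ENNReal.HolderTriple p q 1 := ⟨by simpa using hpq⟩
  exact hf.integrable_mul hg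

theorem hold_mem {p q r : ENNReal} {f g : E3 → ℝ} (hpq : p⁻¹ + q⁻¹ = r⁻¹) (hf : ML f p) (hg : ML g q) :
    ML (fun x => f x * g x) r := by
  have : ENNReal.HolderTriple p q r := ⟨hpq⟩
  exact hg.mul' hf

theorem hold_nm {p q r : ENNReal} {f g : E3 → ℝ} (hpq : p⁻¹ + q⁻¹ = r⁻¹) (hf : ML f p) (hg : ML g q) :
    nm r (fun x => f x * g x) ≤ nm p f * nm q g := by
  have : ENNReal.HolderTriple p q r := ⟨hpq⟩
  have h := eLpNorm_smul_le_mul_eLpNorm (p := p) (q := q) (r := r) hg.1 hf.1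
  rw [nm, nm, nm, ← ENNReal.toReal_mul]
  exact ENNReal.toReal_mono (ENNReal.mul_ne_top hf.2.ne hg.2.ne) h

theorem int_le_nm {f : E3 → ℝ} : |∫ x, f x| ≤ nm 1 f := by
  rw [nm, eLpNorm_one_eq_lintegral_enorm, ← Real.norm_eq_abs]
  have := enorm_integral_le_lintegral_enorm (μ := (volume : Measure E3)) f
  by_cases h : Integrable f volume
  · have h2 := ENNReal.toReal_mono h.2.ne this
    simpa using h2
  · rw [integral_undef h]; simp

theorem hold_le {p q : ENNReal} {f g : E3 → ℝ} (hpq : p⁻¹ + q⁻¹ = 1) (hf : ML f p) (hg : ML g q) :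
    |∫ x, f x * g x| ≤ nm p f * nm q g :=
  int_le_nm.trans (hold_nm (by simpa using hpq) hf hg)

theorem LpT.nmt {p : ENNReal} {f : ℕ → E3 → ℝ} {g : E3 → ℝ} (h : LpT p f g) :
    Tendsto (fun n => nm p (fun x => f n x - g x)) atTop (𝓝 0) := by
  have := (ENNReal.tendsto_toReal ENNReal.zero_ne_top).comp h
  exact this

theorem LpT_of_nm {p : ENNReal} {f : ℕ → E3 → ℝ} {g : E3 → ℝ} (hf : ∀ n, ML (fun x => f n x - g x) p)
    (h : Tendsto (fun n => nm p (fun x => f n x - g x)) atTop (𝓝 0)) : LpT p f g := by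
  have := ENNReal.tendsto_ofReal h
  simp only [ENNReal.ofReal_zero] at this
  refine this.congr fun n => ?_
  rw [nm, ENNReal.ofReal_toReal (hf n).2.ne]

theorem LpT.mul {p q r : ENNReal} {f : ℕ → E3 → ℝ} {f' g : E3 → ℝ} (hpq : p⁻¹ + q⁻¹ = r⁻¹) (hg : ML g p)
    (hf : ∀ n, ML (f n) q) (hf' : ML f' q) (h : LpT q f f') : LpT r (fun n x => g x * f n x) (fun x => g x * f' x) := by
  have e : ∀ n, (fun x => g x * f n x - g x * f' x) = fun x => g x * (f n x - f' x) := by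
    intro n; ext x; ring
  refine LpT_of_nm (fun n => ?_) ?_
  · rw [e]; exact hold_mem hpq hg ((hf n).sub hf')
  · simp only [e]
    have := h.nmt.const_mul (nm p g)
    rw [mul_zero] at this
    refine squeeze_zero (fun n => nm_nonneg _ _) (fun n => hold_nm hpq hg ((hf n).sub hf')) this

theorem LpT.int_left {p q : ENNReal} {f : ℕ → E3 → ℝ} {f' g : E3 → ℝ} (hpq : p⁻¹ + q⁻¹ = 1) (hg : ML g q)
    (hf : ∀ n, ML (f n) p) (hf' : ML f' p) (h : LpT p f f') :
    Tendsto (fun n => ∫ x, f n x * g x) atTop (𝓝 (∫ x, f' x * g x)) := by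
  rw [tendsto_iff_norm_sub_tendsto_zero]
  have := h.nmt.mul_const (nm q g)
  rw [zero_mul] at this
  refine squeeze_zero (fun n => norm_nonneg _) (fun n => ?_) this
  rw [← integral_sub (hold_int hpq (hf n) hg) (hold_int hpq hf' hg), Real.norm_eq_abs]
  simp only [← sub_mul]
  exact hold_le hpq ((hf n).sub hf') hg

theorem nm_triangle {p : ENNReal} (hp : 1 ≤ p) {f g : E3 → ℝ} (hf : ML f p) (hg : ML g p) :
    nm p f ≤ nm p (fun x => f x - g x) + nm p g := by
  have h := eLpNorm_add_le (hf.sub hg).1 hg.1 hp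
  rw [sub_add_cancel] at h
  rw [nm, nm, nm, ← ENNReal.toReal_add]
  · exact ENNReal.toReal_mono (ENNReal.add_ne_top.mpr ⟨(hf.sub hg).2.ne, hg.2.ne⟩) h
  · exact (hf.sub hg).2.ne
  · exact hg.2.ne

theorem LpT.int_mul {p q : ENNReal} {f g : ℕ → E3 → ℝ} {f' g' : E3 → ℝ} (hq : 1 ≤ q) (hpq : p⁻¹ + q⁻¹ = 1)
    (hf : ∀ n, ML (f n) p) (hf' : ML f' p) (h : LpT p f f')
    (hg : ∀ n, ML (g n) q) (hg' : ML g' q) (k : LpT q g g') :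
    Tendsto (fun n => ∫ x, f n x * g n x) atTop (𝓝 (∫ x, f' x * g' x)) := by
  rw [tendsto_iff_norm_sub_tendsto_zero]
  have t1 := h.nmt.mul (k.nmt.add_const (nm q g'))
  have t2 := k.nmt.const_mul (nm p f')
  have t := t1.add t2
  simp only [zero_mul, mul_zero, add_zero] at t
  refine squeeze_zero (fun n => norm_nonneg _) (fun n => ?_) t
  have e : (∫ x, f n x * g n x) - ∫ x, f' x * g' x =
      (∫ x, (f n x - f' x) * g n x) + ∫ x, f' x * (g n x - g' x) := by
    have hfm : ML (fun x => f n x - f' x) p := (hf n).sub hf'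
    have hgm : ML (fun x => g n x - g' x) q := (hg n).sub hg'
    rw [← integral_sub (hold_int hpq (hf n) (hg n)) (hold_int hpq hf' hg'),
      ← integral_add (hold_int hpq hfm (hg n)) (hold_int hpq hf' hgm)]
    refine integral_congr_ae (ae_of_all _ fun x => ?_)
    ring
  rw [e]
  refine (norm_add_le _ _).trans (add_le_add ?_ ?_)
  · refine (hold_le hpq ((hf n).sub hf') (hg n)).trans ?_
    exact mul_le_mul_of_nonneg_left (nm_triangle hq (hg n) hg') (nm_nonneg _ _)
  · exact hold_le hpq hf' ((hg n).sub hg')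

theorem inv22 : (2:ENNReal)⁻¹ + 2⁻¹ = 1 := ENNReal.inv_two_add_inv_two

theorem nm_two_sq {f : E3 → ℝ} (hf : ML f 2) : nm 2 f ^ 2 = ∫ x, f x ^ 2 := by
  have h := hf.eLpNorm_eq_integral_rpow_norm (by norm_num) (by norm_num)
  have hn : 0 ≤ ∫ x, f x ^ 2 := integral_nonneg fun x => sq_nonneg _
  have e : ∫ x, ‖f x‖ ^ (2:ENNReal).toReal = ∫ x, f x ^ 2 := by
    congr 1; ext x; simp
  rw [e] at h
  rw [nm, h, ENNReal.toReal_ofReal (by positivity), ENNReal.toReal_ofNat, show (2:ℝ)⁻¹ = 1/2 by norm_num, ← Real.sqrt_eq_rpow]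
  exact Real.sq_sqrt hn

theorem sm_mem {f : E3 → ℝ} (hf : Continuous f) (hc : HasCompactSupport f) (p : ENNReal) : ML f p :=
  hf.memLp_of_hasCompactSupport hc

theorem lp_complete {p : ENNReal} (hp : 1 ≤ p) {f : ℕ → E3 → ℝ} (hf : ∀ n, ML (f n) p) {b : ℕ → ℝ}
    (hb : Tendsto b atTop (𝓝 0)) (h : ∀ N n m, N ≤ n → N ≤ m → nm p (fun x => f n x - f m x) ≤ b N) :
    ∃ g, ML g p ∧ LpT p f g := by
  have : Fact (1 ≤ p) := ⟨hp⟩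
  have hC : CauchySeq (fun n => (hf n).toLp (f n)) := by
    refine cauchySeq_of_le_tendsto_0 b (fun n m N hn hm => ?_) hb
    rw [dist_eq_norm, ← MemLp.toLp_sub, Lp.norm_toLp]
    exact h N n m hn hm
  obtain ⟨g, hg⟩ := cauchySeq_tendsto_of_complete hC
  refine ⟨g, Lp.memLp g, ?_⟩
  have := (Lp.tendsto_Lp_iff_tendsto_eLpNorm' _ _).mp hg
  refine this.congr fun n => ?_
  apply eLpNorm_congr_ae
  filter_upwards [(hf n).coeFn_toLp] with x hx
  simp [hx]

theorem LpT_unique_zero {p : ENNReal} (hp : 1 ≤ p) {f : ℕ → E3 → ℝ} {g : E3 → ℝ} (hf : ∀ n, ML (f n) p) (hg : ML g p)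
    (h : LpT p f g) (h0 : Tendsto (fun n => nm p (f n)) atTop (𝓝 0)) : ∀ᵐ x, g x = 0 := by
  have hz : nm p g = 0 := by
    refine le_antisymm ?_ (nm_nonneg _ _)
    have t := h.nmt.add h0
    rw [add_zero] at t
    refine ge_of_tendsto t (Eventually.of_forall fun n => ?_)
    have := nm_triangle hp hg (hf n)
    have e : nm p (fun x => g x - f n x) = nm p (fun x => f n x - g x) := by
      simp only [nm]; congr 1
      exact eLpNorm_sub_comm g (f n) p volume
    rw [e] at this; exact this
  have h1 : eLpNorm g p volume = 0 := by
    rcases (ENNReal.toReal_eq_zero_iff _).mp hz with h | h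
    · exact h
    · exact absurd h hg.2.ne
  exact (eLpNorm_eq_zero_iff hg.1 (by intro h; simp [h] at hp)).mp h1

/-- Sobolev inequality -/
theorem sobolev : ∃ C : ℝ, 0 ≤ C ∧ ∀ f : E3 → ℝ, ContDiff ℝ 1 f → HasCompactSupport f →
    nm 6 f ^ 2 ≤ C * ∑ j, ∫ x, pd f j x ^ 2 := by
  refine ⟨(SNormLESNormFDerivOfEqConst ℝ (volume : Measure E3) 2 : ℝ) ^ 2, by positivity, ?_⟩
  intro f hf hc
  have h := eLpNorm_le_eLpNorm_fderiv_of_eq (volume : Measure E3) hf hc (p := 2) (p' := 6) (by norm_num)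
    (by simp) (by simp; norm_num)
  have hfd : MemLp (fderiv ℝ f) 2 (volume : Measure E3) :=
    (hf.continuous_fderiv (by simp)).memLp_of_hasCompactSupport (hc.fderiv ℝ)
  have h2 : nm 6 f ≤ SNormLESNormFDerivOfEqConst ℝ (volume : Measure E3) 2 *
      (eLpNorm (fderiv ℝ f) 2 volume).toReal := by
    have := ENNReal.toReal_mono (ENNReal.mul_ne_top (by simp) hfd.2.ne) h
    rw [ENNReal.toReal_mul] at this
    exact this
  have h3 : (eLpNorm (fderiv ℝ f) 2 volume).toReal ^ 2 = ∫ x, ‖fderiv ℝ f x‖ ^ 2 := by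
    have h := hfd.eLpNorm_eq_integral_rpow_norm (by norm_num) (by norm_num)
    have hn : 0 ≤ ∫ x, ‖fderiv ℝ f x‖ ^ 2 := integral_nonneg fun x => sq_nonneg _
    have e : ∫ x, ‖fderiv ℝ f x‖ ^ (2:ENNReal).toReal = ∫ x, ‖fderiv ℝ f x‖ ^ 2 := by
      congr 1; ext x; simp
    rw [e] at h
    rw [h, ENNReal.toReal_ofReal (by positivity), ENNReal.toReal_ofNat, show (2:ℝ)⁻¹ = 1/2 by norm_num, ← Real.sqrt_eq_rpow]
    exact Real.sq_sqrt hn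
  have h4 : ∫ x, ‖fderiv ℝ f x‖ ^ 2 ≤ ∑ j, ∫ x, pd f j x ^ 2 := by
    have ip : ∀ j, Integrable (fun x => pd f j x ^ 2) volume := fun j => 
      (sm_mem (pd_cont hf j) (hcs_pd hc j) 2).integrable_sq
    rw [← integral_finsetSum _ fun j _ => ip j]
    refine integral_mono_of_nonneg (ae_of_all _ fun x => sq_nonneg _) (integrable_finsetSum _ fun j _ => ip j) 
      (ae_of_all _ fun x => ?_)
    have hb : ‖fderiv ℝ f x‖ ≤ √(∑ j, pd f j x ^ 2) := by
      refine ContinuousLinearMap.opNorm_le_bound _ (Real.sqrt_nonneg _) fun v => ?_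
      have hv : fderiv ℝ f x v = ∑ j, pd f j x * v j := by
        conv_lhs => rw [← (EuclideanSpace.basisFun (Fin 3) ℝ).sum_repr v]
        simp [pd, mul_comm]
      rw [hv, EuclideanSpace.norm_eq, ← Real.sqrt_mul (Finset.sum_nonneg fun j _ => sq_nonneg _), Real.norm_eq_abs]
      apply Real.abs_le_sqrt
      simp only [Real.norm_eq_abs, sq_abs]
      exact Finset.sum_mul_sq_le_sq_mul_sq _ _ _
    calc ‖fderiv ℝ f x‖ ^ 2 ≤ √(∑ j, pd f j x ^ 2) ^ 2 := by gcongr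
      _ = _ := Real.sq_sqrt (Finset.sum_nonneg fun j _ => sq_nonneg _)
  calc nm 6 f ^ 2 ≤ (SNormLESNormFDerivOfEqConst ℝ (volume : Measure E3) 2 *
      (eLpNorm (fderiv ℝ f) 2 volume).toReal) ^ 2 := by gcongr; exact nm_nonneg _ _
    _ = _ := by rw [mul_pow, h3]
    _ ≤ _ := by gcongr

/-- abstract minimisation -/
theorem minseq {V : Type*} [AddCommGroup V] [Module ℝ V] (S : V → Prop) (a : V → V → ℝ) (l : V → ℝ)
    (hadd : ∀ v w, S v → S w → S (v + w)) (hsm : ∀ (t : ℝ) v, S v → S (t • v)) (h0 : S 0)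
    (asym : ∀ v w, a v w = a w v) (aadd : ∀ v w z, S v → S w → S z → a (v + w) z = a v z + a w z)
    (asm : ∀ (t : ℝ) v w, S v → S w → a (t • v) w = t * a v w)
    (ladd : ∀ v w, S v → S w → l (v + w) = l v + l w) (lsm : ∀ (t : ℝ) v, S v → l (t • v) = t * l v)
    (D : ℝ) (hD : ∀ v, S v → l v ≤ a v v / 2 + D) :
    ∃ v : ℕ → V, (∀ n, S (v n)) ∧
      (∀ n m, a (v n + (-1:ℝ) • v m) (v n + (-1:ℝ) • v m) ≤ 4 * (((n:ℝ)+1)⁻¹ + ((m:ℝ)+1)⁻¹)) ∧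
      ∀ ψ, S ψ → Tendsto (fun n => a (v n) ψ) atTop (𝓝 (l ψ)) := by
  set J : V → ℝ := fun v => a v v / 2 - l v with hJ
  have bdd : BddBelow (J '' {v | S v}) := by
    refine ⟨-D, ?_⟩
    rintro _ ⟨v, hv, rfl⟩
    have := hD v hv
    simp only [hJ]; linarith
  set m := sInf (J '' {v | S v}) with hm
  have hlow : ∀ v, S v → m ≤ J v := fun v hv => csInf_le bdd ⟨v, hv, rfl⟩
  have hex : ∀ n : ℕ, ∃ v, S v ∧ J v < m + ((n:ℝ)+1)⁻¹ := by
    intro n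
    obtain ⟨_, ⟨v, hv, rfl⟩, h⟩ := exists_lt_of_csInf_lt (s := J '' {v | S v}) ⟨J 0, 0, h0, rfl⟩
      (show sInf (J '' {v | S v}) < m + ((n:ℝ)+1)⁻¹ by have := inv_pos.mpr (np n); linarith)
    exact ⟨v, hv, h⟩
  choose v hv hJv using hex
  have expand : ∀ v w, S v → S w → ∀ t : ℝ, a (v + t • w) (v + t • w) = a v v + 2 * t * a v w + t^2 * a w w := by
    intro v w hv hw t
    have htw := hsm t w hw
    have hs := hadd v _ hv htw
    rw [aadd v (t • w) _ hv htw hs, asm t w _ hw hs, asym v, asym w, aadd v (t • w) v hv htw hv,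
      aadd v (t • w) w hv htw hw, asm t w v hw hv, asm t w w hw hw, asym w v]; ring
  refine ⟨v, hv, fun n k => ?_, fun ψ hψ => ?_⟩
  · have hn := hv n; have hk := hv k
    have h1 := hlow ((1/2:ℝ) • (v n + (1:ℝ) • v k)) (hsm _ _ (hadd _ _ hn (hsm _ _ hk)))
    have hs := hadd _ _ hn (hsm 1 _ hk)
    have e1 : a ((1/2:ℝ) • (v n + (1:ℝ) • v k)) ((1/2:ℝ) • (v n + (1:ℝ) • v k)) =
        (1/4) * (a (v n) (v n) + 2 * a (v n) (v k) + a (v k) (v k)) := by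
      rw [asm _ _ _ hs (hsm _ _ hs), asym, asm _ _ _ hs hs, expand _ _ hn hk]; ring
    have e2 : l ((1/2:ℝ) • (v n + (1:ℝ) • v k)) = (1/2) * (l (v n) + l (v k)) := by
      rw [lsm _ _ hs, ladd _ _ hn (hsm _ _ hk), lsm _ _ hk]; ring
    simp only [hJ, e1, e2] at h1
    have h2 := hJv n; have h3 := hJv k
    simp only [hJ] at h2 h3
    rw [expand _ _ hn hk]
    linarith
  · rw [tendsto_iff_norm_sub_tendsto_zero]
    have ht : Tendsto (fun n : ℕ => √(((n:ℝ)+1)⁻¹) * (1 + a ψ ψ / 2)) atTop (𝓝 0) := by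
      have : Tendsto (fun n : ℕ => ((n:ℝ)+1)⁻¹) atTop (𝓝 0) :=
        tendsto_inv_atTop_zero.comp (tendsto_atTop_add_const_right _ _ tendsto_natCast_atTop_atTop)
      have := (this.sqrt).mul_const (1 + a ψ ψ / 2)
      simpa using this
    refine squeeze_zero (fun n => norm_nonneg _) (fun n => ?_) ht
    set ε := ((n:ℝ)+1)⁻¹ with hε
    have hε0 : 0 < ε := inv_pos.mpr (np n)
    set s := √ε with hs
    have hs0 : 0 < s := Real.sqrt_pos.mpr hε0
    have hss : s^2 = ε := Real.sq_sqrt hε0.le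
    have key : ∀ t : ℝ, 0 ≤ ε + t * (a (v n) ψ - l ψ) + t^2 * a ψ ψ / 2 := by
      intro t
      have h1 := hlow (v n + t • ψ) (hadd _ _ (hv n) (hsm _ _ hψ))
      have h2 := hJv n
      simp only [hJ] at h1 h2
      rw [expand _ _ (hv n) hψ, ladd _ _ (hv n) (hsm _ _ hψ), lsm _ _ hψ] at h1
      linarith
    have k1 := key s
    have k2 := key (-s)
    rw [Real.norm_eq_abs, abs_le]
    rw [neg_sq, hss] at k2
    rw [hss] at k1
    have f1 : ε = s * s := by rw [← hss]; ring
    constructor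
    · have : 0 ≤ s * (s * (1 + a ψ ψ/2) + (a (v n) ψ - l ψ)) := by rw [f1] at k1; linarith
      have := nonneg_of_mul_nonneg_right this hs0
      linarith
    · have : 0 ≤ s * (s * (1 + a ψ ψ/2) - (a (v n) ψ - l ψ)) := by rw [f1] at k2; linarith
      have := nonneg_of_mul_nonneg_right this hs0
      linarith


/-! ### Variational solution -/

abbrev VF := Fin 3 → E3 → ℝ

def TF (v : VF) : Prop := ∀ i, Sm (v i) ∧ HasCompactSupport (v i)

def aF (μ κ : ℝ) (v w : VF) : ℝ :=
  μ * ∑ i, ∑ j, Ip (pd (v i) j) (pd (w i) j) + κ * ∑ k, ∑ l, Ip (pd (v k) k) (pd (w l) l)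

def lF (T : Fin 3 → Fin 3 → E3 → ℝ) (g : VF) (v : VF) : ℝ :=
  ∑ i, ∑ j, Ip (T i j) (pd (v i) j) + ∑ i, Ip (g i) (v i)

theorem Ip_comm (f g : E3 → ℝ) : Ip f g = Ip g f := by
  simp only [Ip, mul_comm]

theorem aF_symm (μ κ : ℝ) (v w : VF) : aF μ κ v w = aF μ κ w v := by
  simp only [aF]
  congr 2
  · exact Finset.sum_congr rfl fun i _ => Finset.sum_congr rfl fun j _ => Ip_comm _ _
  · rw [Finset.sum_comm]
    exact Finset.sum_congr rfl fun i _ => Finset.sum_congr rfl fun j _ => Ip_comm _ _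

theorem TF.pd_mem {v : VF} (hv : TF v) (i j : Fin 3) (p : ENNReal) : ML (pd (v i) j) p :=
  sm_mem ((hv i).1.pd j).continuous (hcs_pd (hv i).2 j) p

theorem TF.mem {v : VF} (hv : TF v) (i : Fin 3) (p : ENNReal) : ML (v i) p :=
  sm_mem (hv i).1.continuous (hv i).2 p

theorem TF.add {v w : VF} (hv : TF v) (hw : TF w) : TF (v + w) := fun i =>
  ⟨(hv i).1.add (hw i).1, (hv i).2.add (hw i).2⟩

theorem TF.smul {v : VF} (t : ℝ) (hv : TF v) : TF (t • v) := fun i =>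
  ⟨(hv i).1.const_smul t, (hv i).2.smul_left (f := fun _ => t)⟩

theorem pd_padd {v w : VF} (hv : TF v) (hw : TF w) (i j : Fin 3) :
    pd ((v + w) i) j = fun x => pd (v i) j x + pd (w i) j x := by
  ext x; simp only [pd, Pi.add_apply]
  rw [fderiv_add (hv i).1.d.differentiableAt (hw i).1.d.differentiableAt]; rfl

theorem pd_psmul {v : VF} (t : ℝ) (hv : TF v) (i j : Fin 3) :
    pd ((t • v) i) j = fun x => t * pd (v i) j x := by
  ext x; simp only [pd, Pi.smul_apply]
  rw [fderiv_const_smul (hv i).1.d.differentiableAt]; rfl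

theorem Ip_add_left {p q : ENNReal} (hpq : p⁻¹ + q⁻¹ = 1) {f g h : E3 → ℝ} (hf : ML f p) (hg : ML g p) (hh : ML h q) :
    Ip (fun x => f x + g x) h = Ip f h + Ip g h := by
  simp only [Ip, add_mul]
  exact integral_add (hold_int hpq hf hh) (hold_int hpq hg hh)

theorem Ip_add_right {p q : ENNReal} (hpq : p⁻¹ + q⁻¹ = 1) {f g h : E3 → ℝ} (hf : ML f q) (hg : ML g q) (hh : ML h p) :
    Ip h (fun x => f x + g x) = Ip h f + Ip h g := by
  simp only [Ip, mul_add]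
  exact integral_add (hold_int hpq hh hf) (hold_int hpq hh hg)

theorem Ip_mul_left (t : ℝ) (f h : E3 → ℝ) : Ip (fun x => t * f x) h = t * Ip f h := by
  simp only [Ip, mul_assoc]; exact integral_const_mul _ _

theorem Ip_mul_right (t : ℝ) (f h : E3 → ℝ) : Ip h (fun x => t * f x) = t * Ip h f := by
  rw [Ip_comm, Ip_mul_left, Ip_comm]

theorem inv65 : (6/5 : ENNReal)⁻¹ + (6:ENNReal)⁻¹ = 1 := by
  rw [ENNReal.inv_div (by simp) (by simp), ← one_div, ENNReal.div_add_div_same]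
  rw [show (5:ENNReal) + 1 = 6 by norm_num]
  exact ENNReal.div_self (by simp) (by simp)

theorem aF_ge {μ κ : ℝ} (hκ : 0 ≤ κ) {v : VF} (hv : TF v) :
    μ * ∑ i, ∑ j, ∫ x, pd (v i) j x ^ 2 ≤ aF μ κ v v := by
  have h1 : ∀ i j, Ip (pd (v i) j) (pd (v i) j) = ∫ x, pd (v i) j x ^ 2 := by
    intro i j; simp only [Ip, sq]
  have h2 : 0 ≤ ∑ k, ∑ l, Ip (pd (v k) k) (pd (v l) l) := by
    have : ∑ k, ∑ l, Ip (pd (v k) k) (pd (v l) l) = ∫ x, (∑ k, pd (v k) k x) ^ 2 := by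
      have ii : ∀ k l, Integrable (fun x => pd (v k) k x * pd (v l) l x) volume := fun k l =>
        hold_int inv22 (hv.pd_mem k k 2) (hv.pd_mem l l 2)
      simp only [Ip]
      rw [← Finset.sum_congr rfl fun k _ => integral_finsetSum Finset.univ fun l _ => ii k l]
      rw [← integral_finsetSum _ fun k _ => integrable_finsetSum _ fun l _ => ii k l]
      refine integral_congr_ae (ae_of_all _ fun x => ?_)
      simp only [sq, Finset.sum_mul_sum]
    rw [this]; exact integral_nonneg fun x => sq_nonneg _
  simp only [aF, h1]
  have := mul_nonneg hκ h2
  linarith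

theorem lF_le {μ κ : ℝ} (hμ : 0 < μ) (hκ : 0 ≤ κ) {T : Fin 3 → Fin 3 → E3 → ℝ} {g : VF}
    (hT : ∀ i j, ML (T i j) 2) (hg : ∀ i, ML (g i) (6/5)) :
    ∃ D, ∀ v, TF v → lF T g v ≤ aF μ κ v v / 2 + D := by
  obtain ⟨C, hC, hS⟩ := sobolev
  refine ⟨∑ i, ∑ j, nm 2 (T i j) ^ 2 / μ + ∑ i, (C+1) * nm (6/5) (g i) ^ 2 / μ, fun v hv => ?_⟩
  have a1 : ∀ i j, Ip (T i j) (pd (v i) j) ≤ nm 2 (T i j) ^ 2 / μ + μ / 4 * ∫ x, pd (v i) j x ^ 2 := by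
    intro i j
    have h := (le_abs_self _).trans (hold_le inv22 (hT i j) (hv.pd_mem i j 2))
    rw [← nm_two_sq (hv.pd_mem i j 2)]
    refine h.trans ?_
    have : nm 2 (T i j) ^ 2 / μ + μ / 4 * nm 2 (pd (v i) j) ^ 2 - nm 2 (T i j) * nm 2 (pd (v i) j) =
        (nm 2 (T i j) - μ / 2 * nm 2 (pd (v i) j)) ^ 2 / μ := by field_simp; ring
    have h2 : 0 ≤ (nm 2 (T i j) - μ / 2 * nm 2 (pd (v i) j)) ^ 2 / μ := by positivity
    linarith
  have a2 : ∀ i, Ip (g i) (v i) ≤ (C+1) * nm (6/5) (g i) ^ 2 / μ + μ / 4 * ∑ j, ∫ x, pd (v i) j x ^ 2 := by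
    intro i
    have h := (le_abs_self _).trans (hold_le inv65 (hg i) (hv.mem i 6))
    have hs := hS (v i) (hv i).1.c1 (hv i).2
    set X := ∑ j, ∫ x, pd (v i) j x ^ 2
    have hX : 0 ≤ X := Finset.sum_nonneg fun j _ => integral_nonneg fun x => sq_nonneg _
    have hs2 : nm 6 (v i) ^ 2 ≤ (C + 1) * X := hs.trans (by nlinarith)
    have hC1 : 0 < C + 1 := by linarith
    refine h.trans ?_
    have e : (C+1) * nm (6/5) (g i) ^ 2 / μ + μ / (4 * (C+1)) * nm 6 (v i) ^ 2 - nm (6/5) (g i) * nm 6 (v i) =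
        ((C+1) * nm (6/5) (g i) - μ / 2 * nm 6 (v i)) ^ 2 / (μ * (C+1)) := by field_simp; ring
    have h2 : 0 ≤ ((C+1) * nm (6/5) (g i) - μ / 2 * nm 6 (v i)) ^ 2 / (μ * (C+1)) := by positivity
    have h3 : μ / (4 * (C+1)) * nm 6 (v i) ^ 2 ≤ μ / 4 * X := by
      have h4 : μ / (4 * (C+1)) * nm 6 (v i) ^ 2 ≤ μ / (4 * (C+1)) * ((C+1) * X) := by gcongr
      refine h4.trans (le_of_eq ?_)
      field_simp
    linarith
  have a3 := aF_ge (μ := μ) hκ hv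
  have b1 := Finset.sum_le_sum fun i (_ : i ∈ Finset.univ) => Finset.sum_le_sum fun j (_ : j ∈ Finset.univ) => a1 i j
  have b2 := Finset.sum_le_sum fun i (_ : i ∈ Finset.univ) => a2 i
  simp only [Finset.sum_add_distrib, ← Finset.mul_sum] at b1 b2
  simp only [lF]
  linarith

theorem tinv : Tendsto (fun n : ℕ => ((n:ℝ)+1)⁻¹) atTop (𝓝 0) :=
  tendsto_inv_atTop_zero.comp (tendsto_atTop_add_const_right _ _ tendsto_natCast_atTop_atTop)

/-- data of a variational solution -/
structure VS (μ κ : ℝ) (T : Fin 3 → Fin 3 → E3 → ℝ) (g : VF) (v : ℕ → VF) (w : VF)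
    (W : Fin 3 → Fin 3 → E3 → ℝ) : Prop where
  tf : ∀ n, TF (v n)
  w6 : ∀ i, ML (w i) 6
  W2 : ∀ i j, ML (W i j) 2
  cw : ∀ i, LpT 6 (fun n => v n i) (w i)
  cW : ∀ i j, LpT 2 (fun n => pd (v n i) j) (W i j)
  eq : ∀ ψ, TF ψ → μ * ∑ i, ∑ j, Ip (W i j) (pd (ψ i) j) + κ * ∑ k, ∑ l, Ip (W k k) (pd (ψ l) l) = lF T g ψ

theorem solve {μ κ : ℝ} (hμ : 0 < μ) (hκ : 0 ≤ κ) {T : Fin 3 → Fin 3 → E3 → ℝ} {g : VF}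
    (hT : ∀ i j, ML (T i j) 2) (hg : ∀ i, ML (g i) (6/5)) :
    ∃ v w W, VS μ κ T g v w W := by
  obtain ⟨D, hD⟩ := lF_le hμ hκ hT hg
  obtain ⟨C, hC, hS⟩ := sobolev
  have h0 : TF (0 : VF) := fun i => ⟨contDiff_const, HasCompactSupport.zero⟩
  obtain ⟨v, hv, hcau, hlim⟩ := minseq TF (aF μ κ) (lF T g) (fun v w => TF.add) (fun t v => TF.smul t) h0
    (aF_symm μ κ)
    (by
      intro v w z hv hw hz
      simp only [aF, pd_padd hv hw]
      have : ∀ i j k l, Ip (fun x => pd (v i) j x + pd (w i) j x) (pd (z k) l) = _ := fun i j k l =>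
        Ip_add_left inv22 (hv.pd_mem i j 2) (hw.pd_mem i j 2) (hz.pd_mem k l 2)
      simp only [this, Finset.sum_add_distrib]; ring)
    (by
      intro t v w hv hw
      simp only [aF, pd_psmul t hv, Ip_mul_left, ← Finset.mul_sum]; ring)
    (by
      intro v w hv hw
      simp only [lF, pd_padd hv hw]
      have a1 : ∀ i j, Ip (T i j) (fun x => pd (v i) j x + pd (w i) j x) = _ := fun i j =>
        Ip_add_right inv22 (hv.pd_mem i j 2) (hw.pd_mem i j 2) (hT i j)
      have a2 : ∀ i, Ip (g i) ((v + w) i) = _ := fun i =>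
        Ip_add_right inv65 (hv.mem i 6) (hw.mem i 6) (hg i)
      simp only [a1, a2, Finset.sum_add_distrib]; ring)
    (by
      intro t v hv
      have a2 : ∀ i, Ip (g i) ((t • v) i) = _ := fun i => Ip_mul_right t (v i) (g i)
      simp only [lF, pd_psmul t hv, Ip_mul_right, a2, ← Finset.mul_sum]; ring)
    D hD
  have hd : ∀ n m, TF (v n + (-1:ℝ) • v m) := fun n m => (hv n).add ((hv m).smul _)
  have hpd : ∀ n m i j, pd ((v n + (-1:ℝ) • v m) i) j = fun x => pd (v n i) j x - pd (v m i) j x := by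
    intro n m i j
    rw [pd_padd (hv n) ((hv m).smul _), pd_psmul _ (hv m)]
    ext x; ring
  have hsum : ∀ N n m, N ≤ n → N ≤ m → ∑ i, ∑ j, ∫ x, (pd (v n i) j x - pd (v m i) j x) ^ 2 ≤ 8 / μ * ((N:ℝ)+1)⁻¹ := by
    intro N n m hn hm
    have h1 := (aF_ge (μ := μ) hκ (hd n m)).trans (hcau n m)
    simp only [hpd] at h1
    have i1 : ((n:ℝ)+1)⁻¹ ≤ ((N:ℝ)+1)⁻¹ := inv_anti₀ (np N) (by have hNn : (N:ℝ) ≤ n := Nat.cast_le.mpr hn; linarith)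
    have i2 : ((m:ℝ)+1)⁻¹ ≤ ((N:ℝ)+1)⁻¹ := inv_anti₀ (np N) (by have hNn : (N:ℝ) ≤ m := Nat.cast_le.mpr hm; linarith)
    have h2 : μ * ∑ i, ∑ j, ∫ x, (pd (v n i) j x - pd (v m i) j x) ^ 2 ≤ 8 * ((N:ℝ)+1)⁻¹ := by linarith
    rw [div_mul_eq_mul_div, le_div_iff₀ hμ]; linarith
  have hA : ∀ N n m, N ≤ n → N ≤ m → ∀ i, ∑ j, ∫ x, (pd (v n i) j x - pd (v m i) j x) ^ 2 ≤ 8 / μ * ((N:ℝ)+1)⁻¹ := by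
    intro N n m hn hm i
    refine le_trans ?_ (hsum N n m hn hm)
    exact Finset.single_le_sum (f := fun i => ∑ j, ∫ x, (pd (v n i) j x - pd (v m i) j x) ^ 2)
      (fun i _ => Finset.sum_nonneg fun j _ => integral_nonneg fun x => sq_nonneg _) (Finset.mem_univ i)
  have hB : ∀ N n m, N ≤ n → N ≤ m → ∀ i j, ∫ x, (pd (v n i) j x - pd (v m i) j x) ^ 2 ≤ 8 / μ * ((N:ℝ)+1)⁻¹ := by
    intro N n m hn hm i j
    refine le_trans ?_ (hA N n m hn hm i)
    exact Finset.single_le_sum (f := fun j => ∫ x, (pd (v n i) j x - pd (v m i) j x) ^ 2)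
      (fun j _ => integral_nonneg fun x => sq_nonneg _) (Finset.mem_univ j)
  have exW : ∀ i j, ∃ Wij, ML Wij 2 ∧ LpT 2 (fun n => pd (v n i) j) Wij := by
    intro i j
    refine lp_complete (by norm_num) (fun n => (hv n).pd_mem i j 2) (b := fun N => √(8 / μ * ((N:ℝ)+1)⁻¹)) ?_ ?_
    · simpa using (tinv.const_mul (8/μ)).sqrt
    · intro N n m hn hm
      apply Real.le_sqrt_of_sq_le
      have hm2 : ML (fun x => pd (v n i) j x - pd (v m i) j x) 2 := ((hv n).pd_mem i j 2).sub ((hv m).pd_mem i j 2)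
      rw [nm_two_sq hm2]
      exact hB N n m hn hm i j
  have exw : ∀ i, ∃ wi, ML wi 6 ∧ LpT 6 (fun n => v n i) wi := by
    intro i
    refine lp_complete (by norm_num) (fun n => (hv n).mem i 6) (b := fun N => √(C * (8 / μ * ((N:ℝ)+1)⁻¹))) ?_ ?_
    · simpa using ((tinv.const_mul (8/μ)).const_mul C).sqrt
    · intro N n m hn hm
      apply Real.le_sqrt_of_sq_le
      have h1 := hS ((v n + (-1:ℝ) • v m) i) (hd n m i).1.c1 (hd n m i).2
      simp only [hpd] at h1
      have e : (v n + (-1:ℝ) • v m) i = fun x => v n i x - v m i x := by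
        ext x; simp; ring
      rw [e] at h1
      exact h1.trans (mul_le_mul_of_nonneg_left (hA N n m hn hm i) hC)
  choose W hW hcW using exW
  choose w hw hcw using exw
  refine ⟨v, w, W, hv, hw, hW, hcw, hcW, fun ψ hψ => ?_⟩
  have ht : ∀ i j k l, Tendsto (fun n => Ip (pd (v n i) j) (pd (ψ k) l)) atTop (𝓝 (Ip (W i j) (pd (ψ k) l))) :=
    fun i j k l => (hcW i j).int_left inv22 (hψ.pd_mem k l 2) (fun n => (hv n).pd_mem i j 2) (hW i j)
  have hl := hlim ψ hψ
  refine tendsto_nhds_unique ?_ hl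
  simp only [aF]
  refine Tendsto.add (Tendsto.const_mul _ ?_) (Tendsto.const_mul _ ?_)
  · exact tendsto_finsetSum _ fun i _ => tendsto_finsetSum _ fun j _ => ht i j i j
  · exact tendsto_finsetSum _ fun i _ => tendsto_finsetSum _ fun j _ => ht i i j j

theorem LI_of_mem {p : ENNReal} (hp : 1 ≤ p) {f : E3 → ℝ} (hf : ML f p) : LI f :=
  hf.locallyIntegrable hp

theorem conj_ex2 : (2:ENNReal)⁻¹ + 2⁻¹ = 1 := inv22

theorem VS.wd {μ κ : ℝ} {T : Fin 3 → Fin 3 → E3 → ℝ} {g : VF} {v : ℕ → VF} {w : VF}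
    {W : Fin 3 → Fin 3 → E3 → ℝ} (h : VS μ κ T g v w W) (i j : Fin 3) {φ : E3 → ℝ} (hφ : Sm φ) (hc : HasCompactSupport φ) :
    Ip (w i) (pd φ j) = - Ip (W i j) φ := by
  have t1 : Tendsto (fun n => Ip (v n i) (pd φ j)) atTop (𝓝 (Ip (w i) (pd φ j))) :=
    (h.cw i).int_left (by rw [add_comm]; exact inv65) (sm_mem (hφ.pd j).continuous (hcs_pd hc j) _)
      (fun n => (h.tf n).mem i 6) (h.w6 i)
  have t2 : Tendsto (fun n => Ip (pd (v n i) j) φ) atTop (𝓝 (Ip (W i j) φ)) :=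
    (h.cW i j).int_left inv22 (sm_mem hφ.continuous hc _) (fun n => (h.tf n).pd_mem i j 2) (h.W2 i j)
  refine tendsto_nhds_unique t1 (t2.neg.congr fun n => ?_)
  simp only [Ip]
  rw [integral_ibp ((h.tf n) i).1.c1 hφ.c1 hc]

theorem VS.vw {μ κ : ℝ} {T : Fin 3 → Fin 3 → E3 → ℝ} {g : VF} {v : ℕ → VF} {w : VF}
    {W : Fin 3 → Fin 3 → E3 → ℝ} (h : VS μ κ T g v w W) (lT : ∀ i j, LI (T i j)) (lg : ∀ i, LI (g i)) :
    VW μ κ w T g := by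
  refine ⟨fun i => LI_of_mem (by norm_num) (h.w6 i), lT, lg, ?_⟩
  intro i φ hφ hc
  have e := h.eq (fun k => if k = i then φ else 0) (by
    intro k
    by_cases hk : k = i
    · simp only [hk, if_true]; exact ⟨hφ, hc⟩
    · simp only [hk, if_false]; exact ⟨contDiff_const, HasCompactSupport.zero⟩)
  have p1 : ∀ k j, pd (if k = i then φ else 0) j = if k = i then pd φ j else 0 := by
    intro k j
    by_cases hk : k = i
    · simp [hk]
    · simp only [hk, if_false]; exact pd_const 0 j
  have p2 : ∀ k (f ψ : E3 → ℝ), Ip f (if k = i then ψ else 0) = if k = i then Ip f ψ else 0 := by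
    intro k f ψ
    by_cases hk : k = i
    · simp [hk]
    · simp [hk, Ip]
  simp only [lF, p1, p2] at e
  have q : ∀ a b c, Ip (w a) (pd (pd φ b) c) = - Ip (W a c) (pd φ b) := fun a b c =>
    h.wd a c (hφ.pd b) (hcs_pd hc b)
  simp only [q]
  simp only [Fin.sum_univ_three] at e ⊢
  fin_cases i <;> simp at e ⊢ <;> linarith

theorem VS.pd_mo {μ κ : ℝ} {T : Fin 3 → Fin 3 → E3 → ℝ} {g : VF} {v : ℕ → VF} {w : VF}
    {W : Fin 3 → Fin 3 → E3 → ℝ} (h : VS μ κ T g v w W) (n : ℕ) (i j : Fin 3) (x : E3) :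
    pd (mo n (w i)) j x = mo n (W i j) x := by
  have hl : LI (w i) := LI_of_mem (by norm_num) (h.w6 i)
  rw [mo_pd n hl]
  have e := h.wd i j (refl_sm (ker_sm n) x) (refl_hcs (ker_hcs n) x)
  rw [refl_pd _ (ker_sm n).d x j] at e
  have e2 := Ip_neg (w i) (fun y => pd (ker n) j (x - y))
  rw [e2] at e
  exact neg_injective e


/-! ### Vanishing at infinity, and the Liouville arguments -/

theorem VI_of_dom {f : E3 → ℝ} (hf : AEStronglyMeasurable f volume)
    (h : ∀ δ : ℝ, 0 < δ → ∃ k : E3 → ℝ, Integrable k volume ∧ ∀ᵐ x, |f x| ≤ δ ∨ |f x| ≤ k x) : VI f := by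
  intro δ hδ
  obtain ⟨k, hk, hfk⟩ := h δ hδ
  refine ⟨fun x => f x - max (-δ) (min δ (f x)), ?_, ?_⟩
  · refine hk.norm.mono' ?_ ?_
    · have hc : Continuous (fun t : ℝ => t - max (-δ) (min δ t)) := by fun_prop
      exact hc.comp_aestronglyMeasurable hf
    · filter_upwards [hfk] with x hx
      rw [Real.norm_eq_abs, Real.norm_eq_abs]
      rcases hx with hx | hx
      · rw [abs_le] at hx
        rw [min_eq_right hx.2, max_eq_right hx.1]; simp
      · refine le_trans ?_ (hx.trans (le_abs_self _))
        rcases le_total 0 (f x) with h0 | h0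
        · have h1 : 0 ≤ min δ (f x) := le_min hδ.le h0
          have h2 : min δ (f x) ≤ f x := min_le_right _ _
          rw [max_eq_right (by linarith), abs_of_nonneg (by linarith), abs_of_nonneg h0]; linarith
        · rw [min_eq_right (by linarith)]
          have h1 : max (-δ) (f x) ≤ 0 := max_le (by linarith) h0
          have h2 : f x ≤ max (-δ) (f x) := le_max_right _ _
          rw [abs_of_nonpos (by linarith), abs_of_nonpos h0]; linarith
  · refine ae_of_all _ fun x => ?_
    have : f x - (f x - max (-δ) (min δ (f x))) = max (-δ) (min δ (f x)) := by ring
    rw [this, abs_le]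
    exact ⟨le_max_left _ _, max_le (by linarith) (min_le_left _ _)⟩

theorem VI_of_mem {f : E3 → ℝ} {k : ℕ} (hk : k ≠ 0) (hf : ML f k) : VI f := by
  refine VI_of_dom hf.1 fun δ hδ => ⟨fun x => ‖f x‖ ^ k / δ ^ (k-1), (hf.integrable_norm_pow hk).div_const _, ?_⟩
  refine ae_of_all _ fun x => ?_
  rcases le_total |f x| δ with h | h
  · exact Or.inl h
  · right
    rw [le_div_iff₀ (by positivity), Real.norm_eq_abs]
    obtain ⟨m, rfl⟩ := Nat.exists_eq_succ_of_ne_zero hk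
    simp only [Nat.succ_eq_add_one, Nat.add_sub_cancel, pow_succ]
    rw [mul_comm]
    gcongr

theorem VI.add {f g : E3 → ℝ} (hf : VI f) (hg : VI g) : VI (fun x => f x + g x) := by
  intro δ hδ
  obtain ⟨a, ha, h1⟩ := hf (δ/2) (by linarith)
  obtain ⟨b, hb, h2⟩ := hg (δ/2) (by linarith)
  refine ⟨fun x => a x + b x, ha.add hb, ?_⟩
  filter_upwards [h1, h2] with x h1 h2
  have : f x + g x - (a x + b x) = (f x - a x) + (g x - b x) := by ring
  rw [this]
  exact (abs_add_le _ _).trans (by linarith)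

theorem VI.neg {f : E3 → ℝ} (hf : VI f) : VI (fun x => - f x) := by
  intro δ hδ
  obtain ⟨a, ha, h1⟩ := hf δ hδ
  refine ⟨fun x => - a x, ha.neg, ?_⟩
  filter_upwards [h1] with x h1
  rw [show - f x - - a x = -(f x - a x) by ring, abs_neg]; exact h1

theorem VI.sub {f g : E3 → ℝ} (hf : VI f) (hg : VI g) : VI (fun x => f x - g x) := by
  simpa [sub_eq_add_neg] using hf.add hg.neg

theorem Sm.cm {f : E3 → ℝ} (c : ℝ) (hf : Sm f) : Sm (fun x => c * f x) := contDiff_const.mul hf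

theorem Sm.ad {f g : E3 → ℝ} (hf : Sm f) (hg : Sm g) : Sm (fun x => f x + g x) := ContDiff.add hf hg

theorem Sm.ml {f g : E3 → ℝ} (hf : Sm f) (hg : Sm g) : Sm (fun x => f x * g x) := ContDiff.mul hf hg

theorem Sm.sb {f g : E3 → ℝ} (hf : Sm f) (hg : Sm g) : Sm (fun x => f x - g x) := ContDiff.sub hf hg

theorem pd_lin3 {μ κ : ℝ} {a b : Fin 3 → E3 → ℝ} (ha : ∀ j, Sm (a j)) (hb : ∀ j, Sm (b j)) (i : Fin 3) (x : E3) :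
    pd (fun x => μ * ∑ j, a j x + κ * ∑ k, b k x) i x = μ * ∑ j, pd (a j) i x + κ * ∑ k, pd (b k) i x := by
  have s1 : Sm (fun x => ∑ j, a j x) := ContDiff.sum fun j _ => ha j
  have s2 : Sm (fun x => ∑ j, b j x) := ContDiff.sum fun j _ => hb j
  rw [pd_add (Sm.cm μ s1).d (Sm.cm κ s2).d, pd_const_mul _ s1.d, pd_const_mul _ s2.d,
    pd_sum _ (fun j _ => (ha j).d), pd_sum _ (fun j _ => (hb j).d)]

theorem stage1 {μ κ : ℝ} {z : VF} {T : Fin 3 → Fin 3 → E3 → ℝ} {g : VF} {P : E3 → ℝ}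
    (h : VW μ κ z T g) (hT : ∀ i j x, T i j x = if i = j then P x else 0) (hg : ∀ i x, g i x = 0)
    (lP : LI P) (vz : ∀ i, VI (z i)) (vP : VI P) (n : ℕ) (x : E3) :
    (μ + κ) * ∑ k, pd (mo n (z k)) k x = mo n P x := by
  set Z : Fin 3 → E3 → ℝ := fun i => mo n (z i) with hZ
  have sZ : ∀ i, Sm (Z i) := fun i => mo_sm n (h.lz i)
  have sP : Sm (mo n P) := mo_sm n lP
  have e1 : ∀ i x, μ * ∑ j, pd (pd (Z i) j) j x + κ * ∑ k, pd (pd (Z k) k) i x = pd (mo n P) i x := by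
    intro i x
    have e := h.pointwise n i x
    have hT' : ∀ j, T i j = if i = j then P else fun _ => 0 := by
      intro j; ext y; rw [hT]; by_cases hij : i = j <;> simp [hij]
    have hg' : g i = fun _ => 0 := by ext y; exact hg i y
    have hz : mo n (fun _ => 0) = fun _ => 0 := by ext y; exact cv_zero _ _
    rw [hg', hz, sub_zero] at e
    have q : ∀ j, pd (mo n (T i j)) j x = if i = j then pd (mo n P) j x else 0 := by
      intro j; rw [hT']
      by_cases hij : i = j
      · simp only [hij, if_true]
      · simp only [hij, if_false]; rw [hz, pd_const]
    simp only [q, Finset.sum_ite_eq, Finset.mem_univ, if_true] at e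
    exact e
  have e2 : ∀ i x, μ * ∑ j, pd (pd (pd (Z i) j) j) i x + κ * ∑ k, pd (pd (pd (Z k) k) i) i x
      = pd (pd (mo n P) i) i x := by
    intro i x
    have : (fun x => μ * ∑ j, pd (pd (Z i) j) j x + κ * ∑ k, pd (pd (Z k) k) i x) = pd (mo n P) i := by
      ext x; exact e1 i x
    rw [← this, pd_lin3 (fun j => ((sZ i).pd j).pd j) (fun k => ((sZ k).pd k).pd i)]
  have c : ∀ i j, pd (pd (pd (Z i) j) j) i = pd (pd (pd (Z i) i) j) j := by
    intro i j
    rw [pd_comm ((sZ i).pd j).c2 j i, pd_comm (sZ i).c2 j i]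
  set D : E3 → ℝ := fun x => ∑ k, pd (Z k) k x with hD
  have sD : Sm D := ContDiff.sum fun k _ => (sZ k).pd k
  have pD : ∀ i, pd D i = fun x => ∑ k, pd (pd (Z k) k) i x := by
    intro i; ext x; rw [hD, pd_sum Finset.univ (fun k _ => ((sZ k).pd k).d)]
  have ppD : ∀ i x, pd (pd D i) i x = ∑ k, pd (pd (pd (Z k) k) i) i x := by
    intro i x; rw [pD, pd_sum Finset.univ (fun k _ => (((sZ k).pd k).pd i).d)]
  have hh := liouville_harm (f := fun x => (μ + κ) * D x + (-1) * mo n P x)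
    (Sm.ad (Sm.cm (μ+κ) sD) (Sm.cm (-1) sP)).c2 ?_ ?_ x
  · linarith
  · intro x
    have q : ∀ i, pd (pd (fun x => (μ + κ) * D x + (-1) * mo n P x) i) i x =
        (μ + κ) * pd (pd D i) i x + (-1) * pd (pd (mo n P) i) i x := by
      intro i
      have : pd (fun x => (μ + κ) * D x + (-1) * mo n P x) i = fun x => (μ + κ) * pd D i x + (-1) * pd (mo n P) i x := by
        ext x
        rw [pd_add (Sm.cm (μ+κ) sD).d (Sm.cm (-1) sP).d, pd_const_mul _ sD.d, pd_const_mul _ sP.d]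
      rw [this, pd_add (Sm.cm (μ+κ) (sD.pd i)).d (Sm.cm (-1) (sP.pd i)).d,
        pd_const_mul _ (sD.pd i).d, pd_const_mul _ (sP.pd i).d]
    simp only [q, ppD, ← e2, c]
    simp only [Fin.sum_univ_three]; ring
  · have tD : Tendsto D (cocompact E3) (𝓝 0) := by
      have : ∀ k, Tendsto (fun x => pd (Z k) k x) (cocompact E3) (𝓝 0) := by
        intro k
        simp only [hZ]
        rw [mo_pd n (h.lz k)]
        exact cv_tendsto_zero ((ker_sm n).pd k).continuous (hcs_pd (ker_hcs n) k) (h.lz k) (vz k)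
      simpa using tendsto_finsetSum Finset.univ fun k _ => this k
    have tP : Tendsto (mo n P) (cocompact E3) (𝓝 0) := cv_tendsto_zero (ker_cont n) (ker_hcs n) lP vP
    simpa using (tD.const_mul (μ+κ)).add (tP.const_mul (-1))

theorem stage2 {μ κ : ℝ} (hμ : 0 < μ) (hκ : 0 ≤ κ) {z : VF} {T : Fin 3 → Fin 3 → E3 → ℝ} {g : VF}
    (h : VW μ κ z T g) (hT : ∀ i j x, T i j x = 0) (hg : ∀ i x, g i x = 0)
    (vz : ∀ i, VI (z i)) (i : Fin 3) : ∀ᵐ x, z i x = 0 := by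
  have v0 : VI (fun _ => 0) := fun δ hδ => ⟨fun _ => 0, integrable_zero _ _ _, by simp [hδ.le]⟩
  have d0 : ∀ n x, ∑ k, pd (mo n (z k)) k x = 0 := by
    intro n x
    have := stage1 (P := fun _ => 0) h (by simpa using hT) hg (locallyIntegrable_const 0) vz v0 n x
    rw [mo, cv_zero] at this
    rcases mul_eq_zero.mp this with h | h
    · linarith
    · exact h
  have z0 : ∀ n x, mo n (z i) x = 0 := by
    intro n
    have sZ : ∀ i, Sm (mo n (z i)) := fun i => mo_sm n (h.lz i)
    refine liouville_harm (sZ i).c2 ?_ (cv_tendsto_zero (ker_cont n) (ker_hcs n) (h.lz i) (vz i))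
    intro x
    have e := h.pointwise n i x
    have hT' : ∀ i j, T i j = fun _ => 0 := by intro i j; ext y; exact hT i j y
    have hg' : g i = fun _ => 0 := by ext y; exact hg i y
    have hz : mo n (fun _ => 0) = fun _ => 0 := by ext y; exact cv_zero _ _
    have : ∑ k, pd (pd (mo n (z k)) k) i x = 0 := by
      refine (congrFun (pd_sum Finset.univ (fun k _ => ((sZ k).pd k).d) i) x).symm.trans ?_
      have : (fun x => ∑ k, pd (mo n (z k)) k x) = fun _ => 0 := by ext x; exact d0 n x
      rw [this, pd_const]
    rw [this, hg'] at e
    simp only [hT', hz, pd_const, Finset.sum_const_zero, mul_zero, add_zero, sub_zero] at e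
    rcases mul_eq_zero.mp e with h | h
    · linarith
    · exact h
  filter_upwards [ae_tendsto_mo (h.lz i)] with x hx
  simp only [z0] at hx
  exact tendsto_nhds_unique hx tendsto_const_nhds |>.symm ▸ rfl

theorem stage1_lap {μ κ : ℝ} (hμ : 0 < μ) (hκ : 0 ≤ κ) {z : VF} {T : Fin 3 → Fin 3 → E3 → ℝ} {g : VF} {P : E3 → ℝ}
    (h : VW μ κ z T g) (hT : ∀ i j x, T i j x = if i = j then P x else 0) (hg : ∀ i x, g i x = 0)
    (lP : LI P) (vz : ∀ i, VI (z i)) (vP : VI P) (n : ℕ) (i : Fin 3) (x : E3) :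
    ∑ j, pd (pd (mo n (z i)) j) j x = (μ + κ)⁻¹ * pd (mo n P) i x := by
  have sZ : ∀ i, Sm (mo n (z i)) := fun i => mo_sm n (h.lz i)
  have sP : Sm (mo n P) := mo_sm n lP
  have hn : μ + κ ≠ 0 := by positivity
  have e := h.pointwise n i x
  have hT' : ∀ j, T i j = if i = j then P else fun _ => 0 := by
    intro j; ext y; rw [hT]; by_cases hij : i = j <;> simp [hij]
  have hg' : g i = fun _ => 0 := by ext y; exact hg i y
  have hz : mo n (fun _ => 0) = fun _ => 0 := by ext y; exact cv_zero _ _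
  rw [hg', hz, sub_zero] at e
  have q : ∀ j, pd (mo n (T i j)) j x = if i = j then pd (mo n P) j x else 0 := by
    intro j; rw [hT']
    by_cases hij : i = j
    · simp only [hij, if_true]
    · simp only [hij, if_false]; rw [hz, pd_const]
  simp only [q, Finset.sum_ite_eq, Finset.mem_univ, if_true] at e
  have d : (fun x => ∑ k, pd (mo n (z k)) k x) = fun x => (μ+κ)⁻¹ * mo n P x := by
    ext x
    rw [← stage1 h hT hg lP vz vP n x]; field_simp
  have d2 : ∑ k, pd (pd (mo n (z k)) k) i x = (μ+κ)⁻¹ * pd (mo n P) i x := by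
    refine (congrFun (pd_sum Finset.univ (fun k _ => ((sZ k).pd k).d) i) x).symm.trans ?_
    rw [d, pd_const_mul _ sP.d]
  rw [d2] at e
  have : μ * ∑ j, pd (pd (mo n (z i)) j) j x = μ * ((μ + κ)⁻¹ * pd (mo n P) i x) := by
    have e2 : pd (mo n P) i x = (μ+κ) * ((μ + κ)⁻¹ * pd (mo n P) i x) := by field_simp
    linarith
  exact mul_left_cancel₀ hμ.ne' this


/-! ### Local energy estimate, translation estimate, commutator estimate -/

theorem mo_sq_le (n : ℕ) {f : E3 → ℝ} (hf : LI f) (hf2 : LI (fun x => f x ^ 2)) (x : E3) :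
    (mo n f x) ^ 2 ≤ mo n (fun y => f y ^ 2) x := by
  set c := mo n f x with hc
  have i1 := cv_int (ker_cont n) (ker_hcs n) hf x
  have i2 := cv_int (ker_cont n) (ker_hcs n) hf2 x
  have i3 : Integrable (fun y => ker n (x - y)) volume := (ker_integrable n).comp_sub_left x
  have h0 : 0 ≤ ∫ y, (f y - c) ^ 2 * ker n (x - y) :=
    integral_nonneg fun y => mul_nonneg (sq_nonneg _) (ker_nonneg _ _)
  have e : ∫ y, (f y - c) ^ 2 * ker n (x - y)
      = ∫ y, (f y ^ 2 * ker n (x - y) - 2 * c * (f y * ker n (x - y)) + c ^ 2 * ker n (x - y)) := by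
    refine integral_congr_ae (ae_of_all _ fun y => ?_)
    simp only; ring
  have j2 : Integrable (fun y => 2 * c * (f y * ker n (x - y))) volume := i1.const_mul _
  have j1 : Integrable (fun y => f y ^ 2 * ker n (x - y) - 2 * c * (f y * ker n (x - y))) volume := i2.sub j2
  have j3 : Integrable (fun y => c ^ 2 * ker n (x - y)) volume := i3.const_mul _
  rw [e, integral_add j1 j3, integral_sub i2 j2, integral_const_mul, integral_const_mul, ker_int'] at h0
  have e1 : ∫ y, f y * ker n (x - y) = c := rfl
  have e2 : ∫ y, f y ^ 2 * ker n (x - y) = mo n (fun y => f y ^ 2) x := rfl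
  rw [e1, e2] at h0
  nlinarith

theorem ccs_int {f : E3 → ℝ} (h1 : Continuous f) (h2 : HasCompactSupport f) : Integrable f volume :=
  h1.integrable_of_hasCompactSupport h2

theorem cacc {z Q φ : E3 → ℝ} (hz : Sm z) (hQ : Sm Q) (hφ : Sm φ) (hc : HasCompactSupport φ) (i : Fin 3)
    (h : ∀ x, ∑ j, pd (pd z j) j x = pd Q i x) :
    ∫ x, (∑ j, pd z j x ^ 2) * φ x ^ 2 ≤ ∫ x, (4 * (Q x ^ 2 * φ x ^ 2) + 10 * (z x ^ 2 * ∑ j, pd φ j x ^ 2)) := by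
  set q : Fin 3 → E3 → ℝ := fun j x => if i = j then Q x else 0 with hq
  have sq : ∀ j, Sm (q j) := by
    intro j
    by_cases hij : i = j
    · have : q j = Q := by ext x; simp [hq, hij]
      rw [this]; exact hQ
    · have : q j = fun _ => 0 := by ext x; simp [hq, hij]
      rw [this]; exact contDiff_const
  have pq : ∀ j x, pd (q j) j x = if i = j then pd Q j x else 0 := by
    intro j x
    by_cases hij : i = j
    · have : q j = Q := by ext x; simp [hq, hij]
      rw [this]; simp [hij]
    · have : q j = fun _ => 0 := by ext x; simp [hq, hij]
      rw [this, pd_const]; simp [hij]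
  set a : Fin 3 → E3 → ℝ := fun j x => pd z j x - q j x with ha
  have sa : ∀ j, Sm (a j) := fun j => (hz.pd j).sb (sq j)
  have da : ∀ x, ∑ j, pd (a j) j x = 0 := by
    intro x
    have : ∀ j, pd (a j) j x = pd (pd z j) j x - if i = j then pd Q j x else 0 := by
      intro j
      rw [ha, ← pq]
      exact congrFun (pd_sub (hz.pd j).d (sq j).d j) x
    simp only [this, Finset.sum_sub_distrib, h]
    simp
  set b : E3 → ℝ := fun x => z x * (φ x * φ x) with hb
  have sb : Sm b := hz.ml (hφ.ml hφ)
  have pb : ∀ j x, pd b j x = z x * (φ x * pd φ j x + pd φ j x * φ x) + pd z j x * (φ x * φ x) := by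
    intro j x
    rw [hb, pd_mul hz.d (hφ.ml hφ).d, pd_mul hφ.d hφ.d]
  have hcb : HasCompactSupport b := (hc.mul_left (f' := φ)).mul_left
  set V : Fin 3 → E3 → ℝ := fun j x => a j x * b x with hV
  have sV : ∀ j, Sm (V j) := fun j => (sa j).ml sb
  have hcV : ∀ j, HasCompactSupport (V j) := fun j => hcb.mul_left
  have dV : ∀ x, ∑ j, pd (V j) j x = ∑ j, a j x * pd b j x := by
    intro x
    have : ∀ j, pd (V j) j x = a j x * pd b j x + pd (a j) j x * b x := by
      intro j; rw [hV]; exact congrFun (pd_mul (sa j).d sb.d j) x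
    simp only [this, Finset.sum_add_distrib, ← Finset.sum_mul, da]; ring
  have i0 := integral_div_zero (fun j => (sV j).c1) hcV
  have hcφ2 : HasCompactSupport (fun x => φ x ^ 2) := by
    have : (fun x => φ x ^ 2) = fun x => φ x * φ x := by ext x; ring
    rw [this]; exact hc.mul_left
  have cz : ∀ j, Continuous (pd z j) := fun j => (hz.pd j).continuous
  have cφ : ∀ j, Continuous (pd φ j) := fun j => (hφ.pd j).continuous
  have hcp : HasCompactSupport (fun x => ∑ j, pd φ j x ^ 2) := by
    have : ∀ j, HasCompactSupport (fun x => pd φ j x ^ 2) := by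
      intro j
      have e : (fun x => pd φ j x ^ 2) = fun x => pd φ j x * pd φ j x := by ext x; ring
      rw [e]; exact (hcs_pd hc j).mul_left
    simp only [Fin.sum_univ_three]
    exact ((this 0).add (this 1)).add (this 2)
  have I1 : Integrable (fun x => (∑ j, pd z j x ^ 2) * φ x ^ 2) volume :=
    ccs_int ((continuous_finsetSum _ fun j _ => (cz j).pow 2).mul (hφ.continuous.pow 2)) hcφ2.mul_left
  have I2 : Integrable (fun x => 4 * (Q x ^ 2 * φ x ^ 2) + 10 * (z x ^ 2 * ∑ j, pd φ j x ^ 2)) volume := by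
    have h1 : Integrable (fun x => Q x ^ 2 * φ x ^ 2) volume :=
      ccs_int ((hQ.continuous.pow 2).mul (hφ.continuous.pow 2)) hcφ2.mul_left
    have h2 : Integrable (fun x => z x ^ 2 * ∑ j, pd φ j x ^ 2) volume :=
      ccs_int ((hz.continuous.pow 2).mul (continuous_finsetSum _ fun j _ => (cφ j).pow 2)) hcp.mul_left
    exact (h1.const_mul 4).add (h2.const_mul 10)
  have I3 : Integrable (fun x => ∑ j, pd (V j) j x) volume :=
    integrable_finsetSum _ fun j _ => ccs_int ((sV j).pd j).continuous (hcs_pd (hcV j) j)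
  have I4 : Integrable (fun x => 2 * ∑ j, pd (V j) j x) volume := I3.const_mul 2
  have key : ∫ x, (∑ j, pd z j x ^ 2) * φ x ^ 2 ≤
      ∫ x, ((4 * (Q x ^ 2 * φ x ^ 2) + 10 * (z x ^ 2 * ∑ j, pd φ j x ^ 2)) + 2 * ∑ j, pd (V j) j x) := by
    refine integral_mono I1 (I2.add I4) fun x => ?_
    simp only [dV, pb, ha, hq]
    generalize hp0 : z x = Z
    generalize hp1 : φ x = f
    have y1 : ∀ s : ℝ, 2 * Q x * s * f ^ 2 ≤ (1/2) * s ^ 2 * f ^ 2 + 2 * (Q x ^ 2 * f ^ 2) := by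
      intro s; nlinarith [sq_nonneg (s * f - 2 * Q x * f)]
    have y2 : ∀ s t : ℝ, -(4 * Z * f * s * t) ≤ (1/2) * s ^ 2 * f ^ 2 + 8 * (Z ^ 2 * t ^ 2) := by
      intro s t; nlinarith [sq_nonneg (s * f + 4 * Z * t)]
    have y3 : ∀ t : ℝ, 4 * Q x * Z * f * t ≤ 2 * (Q x ^ 2 * f ^ 2) + 2 * (Z ^ 2 * t ^ 2) := by
      intro t; nlinarith [sq_nonneg (Q x * f - Z * t)]
    have p1 := fun j => mul_nonneg (sq_nonneg (pd z j x)) (sq_nonneg f)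
    have p2 := fun j => mul_nonneg (sq_nonneg Z) (sq_nonneg (pd φ j x))
    have a0 := y2 (pd z 0 x) (pd φ 0 x)
    have a1 := y2 (pd z 1 x) (pd φ 1 x)
    have a2 := y2 (pd z 2 x) (pd φ 2 x)
    have b0 := y1 (pd z i x)
    have b1 := y3 (pd φ i x)
    have q0 := p1 0
    have q1 := p1 1
    have q2 := p1 2
    have r0 := p2 0
    have r1 := p2 1
    have r2 := p2 2
    fin_cases i <;> simp [Fin.sum_univ_three] at * <;> nlinarith
  rw [integral_add I2 I4, integral_const_mul, i0] at key
  linarith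

theorem pd_mo_bound {z u w P φ : E3 → ℝ} {M : ℝ} (hu : AEStronglyMeasurable u volume) (hM : ∀ᵐ x, |u x| ≤ M)
    (hw : ML w 6) (hzu : ∀ x, z x = u x - w x) (hP : AEStronglyMeasurable P volume) (hPM : ∀ᵐ x, |P x| ≤ M)
    (i : Fin 3) (ν : ℝ) (h : ∀ n x, ∑ j, pd (pd (mo n z) j) j x = ν * pd (mo n P) i x)
    (hφ : Sm φ) (hc : HasCompactSupport φ) :
    ∃ C, ∀ n, ∫ x, (∑ j, pd (mo n z) j x ^ 2) * φ x ^ 2 ≤ C := by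
  have lu : LI u := LI_of_mem (p := ⊤) (by norm_num) (memLp_top_of_bound hu M (by simpa using hM))
  have lP : LI P := LI_of_mem (p := ⊤) (by norm_num) (memLp_top_of_bound hP M (by simpa using hPM))
  have lw : LI w := LI_of_mem (by norm_num) hw
  have zz : z = fun x => u x - w x := funext hzu
  have lz : LI z := by rw [zz]; exact lu.sub lw
  have i6 : Integrable (fun x => w x ^ 6) volume := by
    have := hw.integrable_norm_pow (p := 6) (by norm_num)
    refine this.congr (ae_of_all _ fun x => ?_)
    simp [Real.norm_eq_abs, Even.pow_abs (show Even 6 by decide)]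
  have l6 : LI (fun x => 1 + w x ^ 6) := (locallyIntegrable_const 1).add i6.locallyIntegrable
  have lw2 : LI (fun x => w x ^ 2) := by
    refine l6.mono (hw.1.pow 2) (ae_of_all _ fun x => ?_)
    rw [Real.norm_eq_abs, Real.norm_eq_abs, abs_of_nonneg (by positivity), abs_of_nonneg (by positivity)]
    nlinarith [sq_nonneg (w x ^ 2 - 1), sq_nonneg (w x), sq_nonneg (w x ^ 2), sq_nonneg (w x ^ 3)]
  have b1 : ∀ n x, mo n z x ^ 2 ≤ 2 * M ^ 2 + 2 + 2 * mo n (fun x => w x ^ 6) x := by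
    intro n x
    have e : mo n z x = mo n u x - mo n w x := by
      rw [zz]; exact cv_sub (ker_cont n) (ker_hcs n) lu lw x
    have h1 := mo_abs_le n lu hM x
    have h1' : mo n u x ^ 2 ≤ M ^ 2 := sq_le_sq' (by linarith [(abs_le.mp h1).1]) (abs_le.mp h1).2
    have h2 := mo_sq_le n lw lw2 x
    have h3 : 0 ≤ mo n (fun x => (1 + w x ^ 6) - w x ^ 2) x := by
      refine mo_ge n (l6.sub lw2) (ae_of_all _ fun x => ?_) x
      change 0 ≤ (1 + w x ^ 6) - w x ^ 2
      nlinarith [sq_nonneg (w x ^ 2 - 1), sq_nonneg (w x), sq_nonneg (w x ^ 2), sq_nonneg (w x ^ 3)]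
    have h4 : mo n (fun x => (1 + w x ^ 6) - w x ^ 2) x = mo n (fun x => 1 + w x ^ 6) x - mo n (fun x => w x ^ 2) x :=
      cv_sub (ker_cont n) (ker_hcs n) l6 lw2 x
    have h5 : mo n (fun x => 1 + w x ^ 6) x = mo n (fun _ => 1) x + mo n (fun x => w x ^ 6) x :=
      cv_add (ker_cont n) (ker_hcs n) (locallyIntegrable_const 1) i6.locallyIntegrable x
    have h6 : mo n (fun _ => 1) x = 1 := by simp [mo, cv, ker_int']
    rw [e]
    nlinarith [sq_nonneg (mo n u x + mo n w x)]
  have sp : Sm (fun x => ∑ j, pd φ j x ^ 2) := ContDiff.sum fun j _ => (hφ.pd j).pow 2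
  have hcp : HasCompactSupport (fun x => ∑ j, pd φ j x ^ 2) := by
    have : ∀ j, HasCompactSupport (fun x => pd φ j x ^ 2) := by
      intro j
      have e : (fun x => pd φ j x ^ 2) = fun x => pd φ j x * pd φ j x := by ext x; ring
      rw [e]; exact (hcs_pd hc j).mul_left
    simp only [Fin.sum_univ_three]
    exact ((this 0).add (this 1)).add (this 2)
  obtain ⟨K, hK⟩ := hcp.exists_bound_of_continuous sp.continuous
  have hcφ2 : HasCompactSupport (fun x => φ x ^ 2) := by
    have : (fun x => φ x ^ 2) = fun x => φ x * φ x := by ext x; ring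
    rw [this]; exact hc.mul_left
  have I1 : Integrable (fun x => φ x ^ 2) volume := ccs_int (hφ.continuous.pow 2) hcφ2
  have I2 : Integrable (fun x => ∑ j, pd φ j x ^ 2) volume := ccs_int sp.continuous hcp
  refine ⟨4 * (ν ^ 2 * M ^ 2) * (∫ x, φ x ^ 2) + 10 * (2 * M ^ 2 + 2) * (∫ x, ∑ j, pd φ j x ^ 2)
    + 20 * K * ∫ x, w x ^ 6, fun n => ?_⟩
  have sz : Sm (mo n z) := mo_sm n lz
  have sP : Sm (mo n P) := mo_sm n lP
  refine (cacc (Q := fun x => ν * mo n P x) sz (sP.cm ν) hφ hc i ?_).trans ?_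
  · intro x; rw [h, pd_const_mul _ sP.d]
  rw [← mo_integral n i6, ← integral_const_mul, ← integral_const_mul, ← integral_const_mul]
  have J1 : Integrable (fun x => 4 * (ν ^ 2 * M ^ 2) * φ x ^ 2) volume := I1.const_mul _
  have J2 : Integrable (fun x => 10 * (2 * M ^ 2 + 2) * ∑ j, pd φ j x ^ 2) volume := I2.const_mul _
  have J3 : Integrable (fun x => 20 * K * mo n (fun x => w x ^ 6) x) volume := (mo_integrable n i6).const_mul _
  have J12 : Integrable (fun x => 4 * (ν ^ 2 * M ^ 2) * φ x ^ 2 + 10 * (2 * M ^ 2 + 2) * ∑ j, pd φ j x ^ 2) volume :=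
    J1.add J2
  rw [← integral_add J1 J2, ← integral_add J12 J3]
  refine integral_mono ?_ (J12.add J3) fun x => ?_
  · have h1 : Integrable (fun x => (ν * mo n P x) ^ 2 * φ x ^ 2) volume :=
      ccs_int (((sP.cm ν).continuous.pow 2).mul (hφ.continuous.pow 2)) hcφ2.mul_left
    have h2 : Integrable (fun x => mo n z x ^ 2 * ∑ j, pd φ j x ^ 2) volume :=
      ccs_int ((sz.continuous.pow 2).mul sp.continuous) hcp.mul_left
    exact (h1.const_mul 4).add (h2.const_mul 10)
  · have h1 := mo_abs_le n lP hPM x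
    have h1' : mo n P x ^ 2 ≤ M ^ 2 := sq_le_sq' (by linarith [(abs_le.mp h1).1]) (abs_le.mp h1).2
    have h2 := b1 n x
    have h3 : 0 ≤ mo n (fun x => w x ^ 6) x := mo_ge n i6.locallyIntegrable (ae_of_all _ fun x => by positivity) x
    have h4 := hK x
    have h5 : 0 ≤ ∑ j, pd φ j x ^ 2 := Finset.sum_nonneg fun j _ => sq_nonneg _
    rw [Real.norm_eq_abs, abs_of_nonneg h5] at h4
    simp only
    have e1 : (ν * mo n P x) ^ 2 * φ x ^ 2 ≤ ν ^ 2 * M ^ 2 * φ x ^ 2 := by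
      rw [mul_pow]; gcongr
    have e2 := mul_le_mul_of_nonneg_right h2 h5
    have e3 := mul_le_mul_of_nonneg_left h4 h3
    nlinarith


theorem fderiv_eq_sum {U : E3 → ℝ} (x v : E3) : fderiv ℝ U x v = ∑ j, v j * pd U j x := by
  have hv : v = ∑ j, v j • EuclideanSpace.single j (1:ℝ) := by
    ext k; simp [Pi.single_apply]
  conv_lhs => rw [hv]
  rw [map_sum]
  simp only [map_smul, smul_eq_mul, pd]

theorem fderiv_sq_le {U : E3 → ℝ} (x v : E3) : (fderiv ℝ U x v) ^ 2 ≤ ‖v‖ ^ 2 * ∑ j, pd U j x ^ 2 := by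
  rw [fderiv_eq_sum, EuclideanSpace.norm_sq_eq]
  simp only [Real.norm_eq_abs, sq_abs]
  exact Finset.sum_mul_sq_le_sq_mul_sq _ _ _

/-- translation estimate for smooth functions -/
theorem trans_smooth {U φ : E3 → ℝ} {R : ℝ} (hU : Sm U) (hφ : Sm φ) (hc : HasCompactSupport φ)
    (h1 : ∀ x, ‖x‖ ≤ R + 1 → φ x = 1) (y : E3) (hy : ‖y‖ ≤ 1) :
    ∫⁻ x in closedBall (0:E3) R, ENNReal.ofReal ((U (x - y) - U x) ^ 2)
      ≤ ENNReal.ofReal (‖y‖ ^ 2 * ∫ x, (∑ j, pd U j x ^ 2) * φ x ^ 2) := by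
  set g : E3 → ℝ := fun x => (∑ j, pd U j x ^ 2) * φ x ^ 2 with hg
  have cg : Continuous g := (continuous_finsetSum _ fun j _ => (hU.pd j).continuous.pow 2).mul (hφ.continuous.pow 2)
  have hcφ2 : HasCompactSupport (fun x => φ x ^ 2) := by
    have : (fun x => φ x ^ 2) = fun x => φ x * φ x := by ext x; ring
    rw [this]; exact hc.mul_left
  have ig : Integrable g volume := ccs_int cg hcφ2.mul_left
  have g0 : ∀ x, 0 ≤ g x := fun x => mul_nonneg (Finset.sum_nonneg fun j _ => sq_nonneg _) (sq_nonneg _)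
  have pt : ∀ x ∈ closedBall (0:E3) R, ENNReal.ofReal ((U (x - y) - U x) ^ 2) ≤
      ∫⁻ t in Icc (0:ℝ) 1, ENNReal.ofReal (‖y‖ ^ 2 * g (x - t • y)) := by
    intro x hx
    have hd : ∀ t : ℝ, HasDerivAt (fun t : ℝ => U (x - t • y)) (fderiv ℝ U (x - t • y) (-y)) t := by
      intro t
      have h1 : HasDerivAt (fun t : ℝ => x - t • y) (-y) t := by
        simpa using ((hasDerivAt_id t).smul_const y).const_sub x
      exact (hU.d (x - t • y)).hasFDerivAt.comp_hasDerivAt t h1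
    have cF : Continuous (fun t : ℝ => fderiv ℝ U (x - t • y) (-y)) := by
      have := hU.continuous_fderiv (by simp)
      exact (this.comp (by fun_prop)).clm_apply continuous_const
    have ftc : ∫ t in (0:ℝ)..1, fderiv ℝ U (x - t • y) (-y) = U (x - y) - U x := by
      rw [intervalIntegral.integral_eq_sub_of_hasDerivAt (fun t _ => hd t) (cF.intervalIntegrable _ _)]
      simp
    rw [intervalIntegral.integral_of_le zero_le_one, ← integral_Icc_eq_integral_Ioc] at ftc
    have cs : (∫ t in Icc (0:ℝ) 1, fderiv ℝ U (x - t • y) (-y)) ^ 2 ≤ ∫ t in Icc (0:ℝ) 1, (fderiv ℝ U (x - t • y) (-y)) ^ 2 := by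
      set c := ∫ t in Icc (0:ℝ) 1, fderiv ℝ U (x - t • y) (-y) with hcc
      have i1 : Integrable (fun t : ℝ => fderiv ℝ U (x - t • y) (-y)) (volume.restrict (Icc (0:ℝ) 1)) :=
        cF.integrableOn_Icc
      have i2 : Integrable (fun t : ℝ => (fderiv ℝ U (x - t • y) (-y)) ^ 2) (volume.restrict (Icc (0:ℝ) 1)) :=
        (cF.pow 2).integrableOn_Icc
      have h0 : 0 ≤ ∫ t in Icc (0:ℝ) 1, (fderiv ℝ U (x - t • y) (-y) - c) ^ 2 := integral_nonneg fun t => sq_nonneg _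
      have e : ∫ t in Icc (0:ℝ) 1, (fderiv ℝ U (x - t • y) (-y) - c) ^ 2 =
          ∫ t in Icc (0:ℝ) 1, ((fderiv ℝ U (x - t • y) (-y)) ^ 2 - 2 * c * fderiv ℝ U (x - t • y) (-y) + c ^ 2) := by
        congr 1; ext t; ring
      have j2 : Integrable (fun t : ℝ => 2 * c * fderiv ℝ U (x - t • y) (-y)) (volume.restrict (Icc (0:ℝ) 1)) := i1.const_mul _
      have j3 : Integrable (fun t : ℝ => (fderiv ℝ U (x - t • y) (-y)) ^ 2 - 2 * c * fderiv ℝ U (x - t • y) (-y))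
        (volume.restrict (Icc (0:ℝ) 1)) := i2.sub j2
      have hk : ∫ _ in Icc (0:ℝ) 1, c ^ 2 = c ^ 2 := by simp
      rw [e, integral_add j3 (integrable_const _), integral_sub i2 j2, integral_const_mul, ← hcc, hk] at h0
      nlinarith
    rw [ftc] at cs
    have i3 : Integrable (fun t : ℝ => ‖y‖ ^ 2 * g (x - t • y)) (volume.restrict (Icc (0:ℝ) 1)) :=
      Continuous.integrableOn_Icc (by fun_prop)
    have i2 : Integrable (fun t : ℝ => (fderiv ℝ U (x - t • y) (-y)) ^ 2) (volume.restrict (Icc (0:ℝ) 1)) :=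
        (cF.pow 2).integrableOn_Icc
    rw [← ofReal_integral_eq_lintegral_ofReal i3 (ae_of_all _ fun t => mul_nonneg (sq_nonneg _) (g0 _))]
    refine ENNReal.ofReal_le_ofReal (cs.trans ?_)
    refine integral_mono_ae i2 i3 ?_
    refine (ae_restrict_iff' measurableSet_Icc).mpr (ae_of_all _ fun t ht => ?_)
    have hφ1 : φ (x - t • y) = 1 := by
      apply h1
      have := norm_sub_le x (t • y)
      rw [norm_smul, Real.norm_eq_abs, abs_of_nonneg ht.1] at this
      have hx' : ‖x‖ ≤ R := by simpa using hx
      have : t * ‖y‖ ≤ 1 := mul_le_one₀ ht.2 (norm_nonneg _) hy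
      linarith
    have := fderiv_sq_le (U := U) (x - t • y) (-y)
    rw [norm_neg] at this
    simpa [hg, hφ1] using this
  calc _ ≤ ∫⁻ x in closedBall (0:E3) R, ∫⁻ t in Icc (0:ℝ) 1, ENNReal.ofReal (‖y‖ ^ 2 * g (x - t • y)) :=
        setLIntegral_mono' measurableSet_closedBall pt
    _ ≤ ∫⁻ x, ∫⁻ t in Icc (0:ℝ) 1, ENNReal.ofReal (‖y‖ ^ 2 * g (x - t • y)) := setLIntegral_le_lintegral _ _
    _ = ∫⁻ t in Icc (0:ℝ) 1, ∫⁻ x, ENNReal.ofReal (‖y‖ ^ 2 * g (x - t • y)) := by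
        rw [lintegral_lintegral_swap]
        refine Measurable.aemeasurable ?_
        refine ENNReal.measurable_ofReal.comp (Continuous.measurable ?_)
        fun_prop
    _ = ∫⁻ t in Icc (0:ℝ) 1, ENNReal.ofReal (‖y‖ ^ 2 * ∫ x, g x) := by
        congr 1; ext t
        rw [lintegral_sub_right_eq_self (fun x => ENNReal.ofReal (‖y‖ ^ 2 * g x)) (t • y), ← integral_const_mul,
          ofReal_integral_eq_lintegral_ofReal (ig.const_mul _) (ae_of_all _ fun t => mul_nonneg (sq_nonneg _) (g0 _))]
    _ ≤ _ := by simp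

theorem trans_est {u φ : E3 → ℝ} {R C : ℝ} (lu : LI u) (hφ : Sm φ) (hc : HasCompactSupport φ)
    (h1 : ∀ x, ‖x‖ ≤ R + 1 → φ x = 1) (hC : ∀ n, ∫ x, (∑ j, pd (mo n u) j x ^ 2) * φ x ^ 2 ≤ C)
    (y : E3) (hy : ‖y‖ ≤ 1) :
    ∫⁻ x in closedBall (0:E3) R, ENNReal.ofReal ((u (x - y) - u x) ^ 2) ≤ ENNReal.ofReal (‖y‖ ^ 2 * C) := by
  have sm : ∀ n, Sm (mo n u) := fun n => mo_sm n lu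
  have b : ∀ n, ∫⁻ x in closedBall (0:E3) R, ENNReal.ofReal ((mo n u (x - y) - mo n u x) ^ 2)
      ≤ ENNReal.ofReal (‖y‖ ^ 2 * C) := fun n =>
    (trans_smooth (sm n) hφ hc h1 y hy).trans (ENNReal.ofReal_le_ofReal (by gcongr; exact hC n))
  have t1 := ae_tendsto_mo lu
  have t2 : ∀ᵐ x, Tendsto (fun n => mo n u (x - y)) atTop (𝓝 (u (x - y))) :=
    (measurePreserving_sub_right volume y).quasiMeasurePreserving.ae t1
  have e : ∫⁻ x in closedBall (0:E3) R, ENNReal.ofReal ((u (x - y) - u x) ^ 2) =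
      ∫⁻ x in closedBall (0:E3) R, liminf (fun n => ENNReal.ofReal ((mo n u (x - y) - mo n u x) ^ 2)) atTop := by
    refine lintegral_congr_ae (ae_restrict_of_ae ?_)
    filter_upwards [t1, t2] with x h1 h2
    exact (Tendsto.liminf_eq (ENNReal.tendsto_ofReal ((h2.sub h1).pow 2))).symm
  rw [e]
  refine (lintegral_liminf_le fun n => ?_).trans ?_
  · have := (sm n).continuous
    refine ENNReal.measurable_ofReal.comp (Continuous.measurable ?_)
    fun_prop
  · refine (liminf_le_liminf (Eventually.of_forall b)).trans ?_
    simp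

theorem comm_est {u ρ φ : E3 → ℝ} {R C M : ℝ} (mu : AEStronglyMeasurable u volume) (hu : ∀ᵐ x, |u x| ≤ M)
    (mρ : AEStronglyMeasurable ρ volume) (hρ : ∀ᵐ x, |ρ x| ≤ M)
    (hφ : Sm φ) (hc : HasCompactSupport φ)
    (h1 : ∀ x, ‖x‖ ≤ R + 1 → φ x = 1) (hC : ∀ n, ∫ x, (∑ j, pd (mo n u) j x ^ 2) * φ x ^ 2 ≤ C) (n : ℕ) :
    ∫ x in closedBall (0:E3) R, (mo n (fun y => ρ y * u y) x - mo n ρ x * mo n u x) ^ 2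
      ≤ 4 * M ^ 2 * C * (((n:ℝ)+1)⁻¹) ^ 2 := by
  have M0 : 0 ≤ M := by obtain ⟨x, hx⟩ := hu.exists; exact (abs_nonneg _).trans hx
  have C0 : 0 ≤ C := le_trans (integral_nonneg fun x => by positivity) (hC 0)
  have bd : ∀ f : E3 → ℝ, ∀ K : ℝ, AEStronglyMeasurable f volume → (∀ᵐ x, |f x| ≤ K) → LI f := fun f K hf h =>
    LI_of_mem (p := ⊤) (by norm_num) (memLp_top_of_bound hf K (by simpa using h))
  have lu : LI u := bd u M mu hu
  have lρ : LI ρ := bd ρ M mρ hρ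
  have lm : LI (fun y => ρ y * u y) := by
    refine bd _ (M * M) (mρ.mul mu) ?_
    filter_upwards [hu, hρ] with x h1 h2
    rw [abs_mul]; gcongr
  -- pointwise bound
  have pw : ∀ x, |u x| ≤ M → (mo n (fun y => ρ y * u y) x - mo n ρ x * mo n u x) ^ 2
      ≤ 4 * M ^ 2 * ∫ y, (u (x - y) - u x) ^ 2 * ker n y := by
    intro x hx
    set a := u x with ha
    have lua : LI (fun y => u y - a) := lu.sub (locallyIntegrable_const a)
    have bua : ∀ᵐ y, |u y - a| ≤ 2 * M := by
      filter_upwards [hu] with y hy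
      exact (abs_sub _ _).trans (by linarith)
    have lua2 : LI (fun y => (u y - a) ^ 2) := by
      refine bd _ ((2 * M)^2) ((mu.sub aestronglyMeasurable_const).pow 2) ?_
      filter_upwards [bua] with y hy
      rw [abs_pow]; gcongr
    have lr : LI (fun y => ρ y * (u y - a)) := by
      refine bd _ (M * (2 * M)) (mρ.mul (mu.sub aestronglyMeasurable_const)) ?_
      filter_upwards [bua, hρ] with y hy h
      rw [abs_mul]; gcongr
    have lr2 : LI (fun y => (ρ y * (u y - a)) ^ 2) := by
      refine bd _ ((M * (2 * M)) ^ 2) ((mρ.mul (mu.sub aestronglyMeasurable_const)).pow 2) ?_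
      filter_upwards [bua, hρ] with y hy h
      rw [abs_pow, abs_mul]; gcongr
    have e1 : mo n (fun y => ρ y * (u y - a)) x = mo n (fun y => ρ y * u y) x - a * mo n ρ x := by
      have h1 : mo n (fun y => ρ y * u y - a * ρ y) x = mo n (fun y => ρ y * u y) x - mo n (fun y => a * ρ y) x :=
        cv_sub (ker_cont n) (ker_hcs n) lm (lρ.smul a) x
      have h2 : mo n (fun y => a * ρ y) x = a * mo n ρ x := cv_const_mul _ _ _ _
      rw [← h2, ← h1]; congr 1; ext y; ring
    have e2 : mo n (fun y => u y - a) x = mo n u x - a := by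
      have h1 : mo n (fun y => u y - a) x = mo n u x - mo n (fun y => a) x :=
        cv_sub (ker_cont n) (ker_hcs n) lu (locallyIntegrable_const a) x
      rw [h1]; congr 1
      simp [mo, cv, integral_const_mul, ker_int']
    have q1 := mo_sq_le n lr lr2 x
    have q2 := mo_sq_le n lua lua2 x
    have q3 : mo n (fun y => (ρ y * (u y - a)) ^ 2) x ≤ M ^ 2 * mo n (fun y => (u y - a) ^ 2) x := by
      have h2 : mo n (fun y => M ^ 2 * (u y - a) ^ 2) x = M ^ 2 * mo n (fun y => (u y - a) ^ 2) x := cv_const_mul _ _ _ _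
      rw [← h2]
      have lk : LI (fun y => M ^ 2 * (u y - a) ^ 2) := lua2.smul (M ^ 2)
      refine integral_mono_ae (cv_int (ker_cont n) (ker_hcs n) lr2 x) (cv_int (ker_cont n) (ker_hcs n) lk x) ?_
      filter_upwards [hρ] with y hy
      have : ρ y ^ 2 ≤ M ^ 2 := by rw [← sq_abs]; gcongr
      refine mul_le_mul_of_nonneg_right ?_ (ker_nonneg _ _)
      rw [mul_pow]; gcongr
    have q4 : mo n ρ x ^ 2 ≤ M ^ 2 := by
      rw [← sq_abs]; gcongr; exact mo_abs_le n lρ hρ x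
    have e3 : ∫ y, (u (x - y) - a) ^ 2 * ker n y = mo n (fun y => (u y - a) ^ 2) x := by
      have := integral_sub_left_eq_self (fun y => (u y - a) ^ 2 * ker n (x - y)) volume x
      simp only [sub_sub_cancel] at this
      exact this
    rw [e3]
    have e4 : mo n (fun y => ρ y * u y) x - mo n ρ x * mo n u x =
      mo n (fun y => ρ y * (u y - a)) x - mo n ρ x * mo n (fun y => u y - a) x := by rw [e1, e2]; ring
    rw [e4]
    have q5 : (mo n ρ x * mo n (fun y => u y - a) x) ^ 2 ≤ M ^ 2 * mo n (fun y => (u y - a) ^ 2) x := by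
      rw [mul_pow]; gcongr
    nlinarith [sq_nonneg (mo n (fun y => ρ y * (u y - a)) x + mo n ρ x * mo n (fun y => u y - a) x)]
  -- Tonelli
  set s := closedBall (0:E3) R
  have mu' : AEMeasurable u volume := mu.aemeasurable
  have L : ∫⁻ x in s, ∫⁻ y, ENNReal.ofReal ((u (x - y) - u x) ^ 2) * ENNReal.ofReal (ker n y)
      ≤ ENNReal.ofReal (C * (((n:ℝ)+1)⁻¹) ^ 2) := by
    rw [lintegral_lintegral_swap]
    · calc _ = ∫⁻ y, (∫⁻ x in s, ENNReal.ofReal ((u (x - y) - u x) ^ 2)) * ENNReal.ofReal (ker n y) := by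
            congr 1; ext y
            rw [lintegral_mul_const' _ _ ENNReal.ofReal_ne_top]
        _ ≤ ∫⁻ y, ENNReal.ofReal (C * (((n:ℝ)+1)⁻¹) ^ 2) * ENNReal.ofReal (ker n y) := by
            refine lintegral_mono fun y => ?_
            by_cases hy : ((n:ℝ)+1)⁻¹ < ‖y‖
            · rw [ker_supp n hy]; simp
            · push Not at hy
              have hn : ((n:ℝ)+1)⁻¹ ≤ 1 := inv_le_one_of_one_le₀ (by linarith [Nat.cast_nonneg (α := ℝ) n])
              refine mul_le_mul' ?_ le_rfl
              refine (trans_est lu hφ hc h1 hC y (hy.trans hn)).trans (ENNReal.ofReal_le_ofReal ?_)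
              rw [mul_comm]; gcongr
        _ = _ := by
            rw [lintegral_const_mul' _ _ ENNReal.ofReal_ne_top,
              ← ofReal_integral_eq_lintegral_ofReal (ker_integrable n) (ae_of_all _ (ker_nonneg n)), ker_int]
            simp
    · have a1 : AEMeasurable (fun z : E3 × E3 => u (z.1 - z.2)) ((volume.restrict s).prod volume) := by
        refine mu'.comp_quasiMeasurePreserving ?_
        refine (quasiMeasurePreserving_sub_of_right_invariant volume volume).mono_left ?_
        exact (Measure.AbsolutelyContinuous.prod Measure.absolutelyContinuous_restrict  Measure.AbsolutelyContinuous.rfl)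
      have a2 : AEMeasurable (fun z : E3 × E3 => u z.1) ((volume.restrict s).prod volume) :=
        mu'.restrict.comp_fst
      have a3 : AEMeasurable (fun z : E3 × E3 => ENNReal.ofReal (ker n z.2)) ((volume.restrict s).prod volume) :=
        (ENNReal.measurable_ofReal.comp ((ker_cont n).comp continuous_snd).measurable).aemeasurable
      exact (((a1.sub a2).pow_const 2).ennreal_ofReal).mul a3
  have cc : Continuous (fun x => (mo n (fun y => ρ y * u y) x - mo n ρ x * mo n u x) ^ 2) :=
    (((mo_sm n lm).continuous).sub ((mo_sm n lρ).continuous.mul (mo_sm n lu).continuous)).pow 2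
  rw [integral_eq_lintegral_of_nonneg_ae (ae_of_all _ fun x => sq_nonneg _) cc.aestronglyMeasurable]
  refine ENNReal.toReal_le_of_le_ofReal (by positivity) ?_
  calc _ ≤ ∫⁻ x in s, ENNReal.ofReal (4 * M ^ 2) * ∫⁻ y, ENNReal.ofReal ((u (x - y) - u x) ^ 2) * ENNReal.ofReal (ker n y) := by
        refine lintegral_mono_ae (ae_restrict_of_ae ?_)
        filter_upwards [hu] with x hx
        have h0 := pw x hx
        refine (ENNReal.ofReal_le_ofReal h0).trans ?_
        rw [ENNReal.ofReal_mul (by positivity)]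
        gcongr
        by_cases hi : Integrable (fun y => (u (x - y) - u x) ^ 2 * ker n y) volume
        · rw [ofReal_integral_eq_lintegral_ofReal hi (ae_of_all _ fun y => mul_nonneg (sq_nonneg _) (ker_nonneg _ _))]
          refine le_of_eq ?_
          congr 1; ext y
          rw [ENNReal.ofReal_mul (sq_nonneg _)]
        · rw [integral_undef hi]; simp
    _ = ENNReal.ofReal (4 * M ^ 2) * ∫⁻ x in s, ∫⁻ y, ENNReal.ofReal ((u (x - y) - u x) ^ 2) * ENNReal.ofReal (ker n y) := by
        rw [lintegral_const_mul' _ _ ENNReal.ofReal_ne_top]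
    _ ≤ ENNReal.ofReal (4 * M ^ 2) * ENNReal.ofReal (C * (((n:ℝ)+1)⁻¹) ^ 2) := by gcongr
    _ = _ := by rw [← ENNReal.ofReal_mul (by positivity)]; congr 1; ring


/-! ### Renormalized continuity equation -/

theorem tend_mul {F : E3 → ℝ} {Fn Gn : ℕ → E3 → ℝ} {G : E3 → ℝ} {K : ℝ}
    (h1 : Tendsto (fun n => ∫ x, |Fn n x - F x|) atTop (𝓝 0)) (iF : Integrable F volume)
    (iFn : ∀ n, Integrable (Fn n) volume) (mG : ∀ n, AEStronglyMeasurable (Gn n) volume)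
    (bG : ∀ n, ∀ᵐ x, |Gn n x| ≤ K) (tG : ∀ᵐ x, Tendsto (fun n => Gn n x) atTop (𝓝 (G x))) :
    Tendsto (fun n => ∫ x, Fn n x * Gn n x) atTop (𝓝 (∫ x, F x * G x)) := by
  have t1 : Tendsto (fun n => ∫ x, F x * Gn n x) atTop (𝓝 (∫ x, F x * G x)) := by
    refine tendsto_integral_of_dominated_convergence (fun x => ‖F x‖ * K) (fun n => iF.1.mul (mG n))
      (iF.norm.mul_const K) (fun n => ?_) ?_
    · filter_upwards [bG n] with x hx
      rw [norm_mul]; gcongr; exact hx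
    · filter_upwards [tG] with x hx using hx.const_mul _
  have i1 : ∀ n, Integrable (fun x => F x * Gn n x) volume := fun n => iF.mul_bdd (mG n) (by filter_upwards [bG n] with x hx using hx)
  have i2 : ∀ n, Integrable (fun x => (Fn n x - F x) * Gn n x) volume := fun n =>
    ((iFn n).sub iF).mul_bdd (mG n) (by filter_upwards [bG n] with x hx using hx)
  have t2 : Tendsto (fun n => ∫ x, (Fn n x - F x) * Gn n x) atTop (𝓝 0) := by
    rw [tendsto_zero_iff_abs_tendsto_zero]
    refine squeeze_zero (fun n => abs_nonneg _) (fun n => ?_) (by simpa using h1.mul_const K)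
    refine (abs_integral_le_integral_abs).trans ?_
    rw [← integral_mul_const]
    refine integral_mono_ae (i2 n).abs (((iFn n).sub iF).abs.mul_const K) ?_
    filter_upwards [bG n] with x hx
    simp only [abs_mul]
    gcongr
  have : ∀ n, ∫ x, Fn n x * Gn n x = (∫ x, (Fn n x - F x) * Gn n x) + ∫ x, F x * Gn n x := by
    intro n
    rw [← integral_add (i2 n) (i1 n)]
    congr 1; ext x; ring
  simp only [this]
  simpa using t2.add t1

theorem small_int {c b : ℕ → E3 → ℝ} {s : Set E3} {K : ℝ} (hs : IsCompact s) (cc : ∀ n, Continuous (c n)) (cb : ∀ n, Continuous (b n))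
    (b0 : ∀ n x, x ∉ s → b n x = 0)
    (hc : ∀ n : ℕ, ∫ x in s, (c n x) ^ 2 ≤ K * (((n:ℝ)+1)⁻¹) ^ 2)
    (hb : Tendsto (fun n : ℕ => ∫ x, (((n:ℝ)+1)⁻¹ * b n x) ^ 2) atTop (𝓝 0)) :
    Tendsto (fun n => ∫ x, c n x * b n x) atTop (𝓝 0) := by
  have K0 : 0 ≤ K := by
    have := hc 0
    have h0 : 0 ≤ ∫ x in s, (c 0 x) ^ 2 := integral_nonneg fun x => sq_nonneg _
    norm_num at this; linarith
  have ib : ∀ n : ℕ, ∀ F : E3 → ℝ, Continuous F → IntegrableOn F s volume := fun n F hF => hF.continuousOn.integrableOn_compact hs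
  have est : ∀ n : ℕ, ∀ ε > 0, |∫ x, c n x * b n x| ≤ ε * K + ε⁻¹ * ∫ x, (((n:ℝ)+1)⁻¹ * b n x) ^ 2 := by
    intro n ε hε
    have hN := np n
    set N := (n:ℝ)+1
    have e1 : ∫ x, c n x * b n x = ∫ x in s, c n x * b n x :=
      (setIntegral_eq_integral_of_forall_compl_eq_zero fun x hx => by rw [b0 n x hx, mul_zero]).symm
    have e2 : ∫ x, (N⁻¹ * b n x) ^ 2 = ∫ x in s, (N⁻¹ * b n x) ^ 2 :=
      (setIntegral_eq_integral_of_forall_compl_eq_zero fun x hx => by rw [b0 n x hx]; simp).symm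
    rw [e1, e2]
    have j1 : Integrable (fun x => ε * N ^ 2 * (c n x) ^ 2) (volume.restrict s) := ib n _ (by have := cc n; fun_prop)
    have j2 : Integrable (fun x => ε⁻¹ * (N⁻¹ * b n x) ^ 2) (volume.restrict s) := ib n _ (by have := cb n; fun_prop)
    have j3 : Integrable (fun x => c n x * b n x) (volume.restrict s) := ib n _ ((cc n).mul (cb n))
    calc |∫ x in s, c n x * b n x| ≤ ∫ x in s, |c n x * b n x| := abs_integral_le_integral_abs
      _ ≤ ∫ x in s, (ε * N ^ 2 * (c n x) ^ 2 + ε⁻¹ * (N⁻¹ * b n x) ^ 2) := by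
          refine integral_mono j3.abs (j1.add j2) fun x => ?_
          have h : c n x * b n x = (N * c n x) * (N⁻¹ * b n x) := by field_simp
          simp only
          rw [h]
          have e : ε * N ^ 2 * c n x ^ 2 = ε * (N * c n x) ^ 2 := by ring
          rw [e]
          generalize N * c n x = A
          generalize N⁻¹ * b n x = B
          have h1 : 0 ≤ ε⁻¹ * (ε * |A| - |B|) ^ 2 := by positivity
          have h2 : ε⁻¹ * (ε * |A| - |B|) ^ 2 = ε * |A| ^ 2 - 2 * (|A| * |B|) + ε⁻¹ * |B| ^ 2 := by field_simp; ring
          rw [h2, sq_abs, sq_abs] at h1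
          rw [abs_mul]
          have := mul_nonneg (abs_nonneg A) (abs_nonneg B)
          linarith
      _ = (ε * N ^ 2 * ∫ x in s, (c n x) ^ 2) + ε⁻¹ * ∫ x in s, (N⁻¹ * b n x) ^ 2 := by
          rw [integral_add j1 j2, integral_const_mul, integral_const_mul]
      _ ≤ ε * K + ε⁻¹ * ∫ x in s, (N⁻¹ * b n x) ^ 2 := by
          refine add_le_add ?_ le_rfl
          calc ε * N ^ 2 * ∫ x in s, (c n x) ^ 2 ≤ ε * N ^ 2 * (K * (N⁻¹) ^ 2) := by gcongr; exact hc n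
            _ = ε * K := by field_simp
  rw [Metric.tendsto_atTop]
  intro δ hδ
  set ε := δ / (2 * (K + 1)) with hε
  have ε0 : 0 < ε := by positivity
  have hb' : Tendsto (fun n : ℕ => ε⁻¹ * ∫ x, (((n:ℝ)+1)⁻¹ * b n x) ^ 2) atTop (𝓝 0) := by simpa using hb.const_mul ε⁻¹
  obtain ⟨N, hN⟩ := eventually_atTop.mp (hb'.eventually_lt_const (show 0 < δ / 2 by linarith))
  refine ⟨N, fun n hn => ?_⟩
  rw [Real.dist_eq, sub_zero]
  have := est n ε ε0
  have h2 := hN n hn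
  have h3 : ε * K < δ / 2 := by
    rw [hε, div_mul_eq_mul_div, div_lt_div_iff₀ (by positivity) (by positivity)]; nlinarith
  linarith

/-- smooth identity -/
theorem renorm_smooth {r χ : E3 → ℝ} {m U : VF} {f f' Q : ℝ → ℝ} (sr : Sm r) (sm : ∀ j, Sm (m j)) (sU : ∀ j, Sm (U j))
    (hf : ∀ s, HasDerivAt f (f' s) s) (hQ : ∀ s, HasDerivAt Q (s * f' s) s) (cf' : Continuous f')
    (sχ : Sm χ) (hc : HasCompactSupport χ) (dm : ∀ x, ∑ j, pd (m j) j x = 0) :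
    0 = (∑ j, ∫ x, (m j x - r x * U j x) * (f' (r x) * pd r j x * χ x)) + (∑ j, ∫ x, m j x * f (r x) * pd χ j x)
      - ((∫ x, (∑ j, pd (U j) j x) * (Q (r x) * χ x)) + ∑ j, ∫ x, Q (r x) * (U j x * pd χ j x)) := by
  have C1 : ∀ {h h' : ℝ → ℝ}, (∀ s, HasDerivAt h (h' s) s) → Continuous h' → ContDiff ℝ 1 (fun x => h (r x)) := by
    intro h h' hh ch
    have : ContDiff ℝ 1 h := by
      rw [contDiff_one_iff_deriv]
      refine ⟨fun s => (hh s).differentiableAt, ?_⟩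
      have : deriv h = h' := funext fun s => (hh s).deriv
      rw [this]; exact ch
    exact this.comp sr.c1
  have cQ' : Continuous (fun s => s * f' s) := continuous_id.mul cf'
  have Cf := C1 hf cf'
  have CQ := C1 hQ cQ'
  have cf : Continuous f := continuous_iff_continuousAt.mpr fun s => (hf s).continuousAt
  have cQ : Continuous Q := continuous_iff_continuousAt.mpr fun s => (hQ s).continuousAt
  have dfr : Differentiable ℝ (fun x => f (r x)) := Cf.differentiable (by norm_num)
  have dQr : Differentiable ℝ (fun x => Q (r x)) := CQ.differentiable (by norm_num)
  have Cfχ : ContDiff ℝ 1 (fun x => f (r x) * χ x) := Cf.mul sχ.c1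
  have CQχ : ContDiff ℝ 1 (fun x => Q (r x) * χ x) := CQ.mul sχ.c1
  have i1 := integral_div_zero (V := fun j x => m j x * (f (r x) * χ x)) (fun j => (sm j).c1.mul Cfχ) (fun j => (hc.mul_left (f := fun x => f (r x))).mul_left)
  have i2 := integral_div_zero (V := fun j x => U j x * (Q (r x) * χ x)) (fun j => (sU j).c1.mul CQχ) (fun j => (hc.mul_left (f := fun x => Q (r x))).mul_left)
  have p1 : ∀ j x, pd (fun x => m j x * (f (r x) * χ x)) j x =
      m j x * (f' (r x) * pd r j x * χ x) + m j x * f (r x) * pd χ j x + pd (m j) j x * (f (r x) * χ x) := by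
    intro j x
    rw [pd_mul (sm j).d (Cfχ.differentiable (by norm_num)), pd_mul dfr sχ.d, pd_comp sr.d hf]; ring
  have p2 : ∀ j x, pd (fun x => U j x * (Q (r x) * χ x)) j x =
      r x * U j x * (f' (r x) * pd r j x * χ x) + Q (r x) * (U j x * pd χ j x) + pd (U j) j x * (Q (r x) * χ x) := by
    intro j x
    rw [pd_mul (sU j).d (CQχ.differentiable (by norm_num)), pd_mul dQr sχ.d, pd_comp sr.d hQ]; ring
  have cr := sr.continuous
  have cχ := sχ.continuous
  have cU := fun j => (sU j).continuous
  have cm := fun j => (sm j).continuous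
  have cpr := fun j => (sr.pd j).continuous
  have cpχ := fun j => (sχ.pd j).continuous
  have cpU := fun j => ((sU j).pd j).continuous
  have I1 : ∀ j, Integrable (fun x => (m j x - r x * U j x) * (f' (r x) * pd r j x * χ x)) volume := fun j =>
    ccs_int (((cm j).sub (cr.mul (cU j))).mul (((cf'.comp cr).mul (cpr j)).mul cχ)) (HasCompactSupport.mul_left (HasCompactSupport.mul_left hc))
  have I2 : ∀ j, Integrable (fun x => m j x * f (r x) * pd χ j x) volume := fun j =>
    ccs_int (((cm j).mul (cf.comp cr)).mul (cpχ j)) (hcs_pd hc j).mul_left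
  have I3 : Integrable (fun x => (∑ j, pd (U j) j x) * (Q (r x) * χ x)) volume :=
    ccs_int ((continuous_finsetSum _ fun j _ => cpU j).mul ((cQ.comp cr).mul cχ)) (HasCompactSupport.mul_left (HasCompactSupport.mul_left hc))
  have I4 : ∀ j, Integrable (fun x => Q (r x) * (U j x * pd χ j x)) volume := fun j =>
    ccs_int ((cQ.comp cr).mul ((cU j).mul (cpχ j))) (HasCompactSupport.mul_left (HasCompactSupport.mul_left (hcs_pd hc j)))
  have D1 : Integrable (fun x => ∑ j, pd (fun x => m j x * (f (r x) * χ x)) j x) volume :=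
    integrable_finsetSum _ fun j _ => ccs_int (pd_cont ((sm j).c1.mul Cfχ) j) (hcs_pd (HasCompactSupport.mul_left (HasCompactSupport.mul_left hc)) j)
  have D2 : Integrable (fun x => ∑ j, pd (fun x => U j x * (Q (r x) * χ x)) j x) volume :=
    integrable_finsetSum _ fun j _ => ccs_int (pd_cont ((sU j).c1.mul CQχ) j) (hcs_pd (HasCompactSupport.mul_left (HasCompactSupport.mul_left hc)) j)
  have S1 : Integrable (fun x => ∑ j, (m j x - r x * U j x) * (f' (r x) * pd r j x * χ x)) volume := integrable_finsetSum _ fun j _ => I1 j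
  have S2 : Integrable (fun x => ∑ j, m j x * f (r x) * pd χ j x) volume := integrable_finsetSum _ fun j _ => I2 j
  have S4 : Integrable (fun x => ∑ j, Q (r x) * (U j x * pd χ j x)) volume := integrable_finsetSum _ fun j _ => I4 j
  have S12 : Integrable (fun x => (∑ j, (m j x - r x * U j x) * (f' (r x) * pd r j x * χ x)) + ∑ j, m j x * f (r x) * pd χ j x) volume := S1.add S2
  have S34 : Integrable (fun x => (∑ j, pd (U j) j x) * (Q (r x) * χ x) + ∑ j, Q (r x) * (U j x * pd χ j x)) volume := I3.add S4
  rw [← integral_finsetSum _ fun j _ => I1 j, ← integral_finsetSum _ fun j _ => I2 j, ← integral_finsetSum _ fun j _ => I4 j,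
    ← integral_add S1 S2, ← integral_add I3 S4, ← integral_sub S12 S34]
  have e : ∫ x, ((∑ j, pd (fun x => m j x * (f (r x) * χ x)) j x) - ∑ j, pd (fun x => U j x * (Q (r x) * χ x)) j x) = 0 := by
    rw [integral_sub D1 D2, i1, i2, sub_zero]
  rw [← e]
  congr 1; ext x
  have dmx := dm x
  simp only [p1, p2, Fin.sum_univ_three] at dmx ⊢
  linear_combination (f (r x) * χ x) * dmx

theorem cutoff (R : ℝ) : ∃ φ : E3 → ℝ, Sm φ ∧ HasCompactSupport φ ∧ (∀ x, ‖x‖ ≤ R → φ x = 1) ∧ ∀ x, |φ x| ≤ 1 := by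
  let b : ContDiffBump (0:E3) := ⟨max R 1, max R 1 + 1, by positivity, by linarith⟩
  refine ⟨b, b.contDiff, b.hasCompactSupport, fun x hx => b.one_of_mem_closedBall ?_, fun x => ?_⟩
  · simpa [b] using Or.inl hx
  · rw [abs_of_nonneg b.nonneg]; exact b.le_one

theorem mo_local {d : E3 → ℝ} {R : ℝ} (n : ℕ) {x : E3} (hx : ‖x‖ ≤ R) :
    mo n ((closedBall (0:E3) (R+1)).indicator d) x = mo n d x := by
  refine integral_congr_ae (ae_of_all _ fun y => ?_)
  simp only
  by_cases hy : y ∈ closedBall (0:E3) (R+1)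
  · rw [indicator_of_mem hy]
  · rw [indicator_of_notMem hy, ker_supp n, mul_zero, mul_zero]
    have hn : ((n:ℝ)+1)⁻¹ ≤ 1 := inv_le_one_of_one_le₀ (by linarith [Nat.cast_nonneg (α := ℝ) n])
    have hy' : R + 1 < ‖y‖ := by simpa using hy
    have := norm_sub_norm_le y x
    rw [norm_sub_rev] at this
    linarith

theorem LI_bd {f : E3 → ℝ} {K : ℝ} (hf : AEStronglyMeasurable f volume) (h : ∀ᵐ x, |f x| ≤ K) : LI f :=
  LI_of_mem (p := ⊤) (by norm_num) (memLp_top_of_bound hf K (by simpa using h))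

theorem renorm {ρ d χ : E3 → ℝ} {u : VF} {M : ℝ} {f f' Q : ℝ → ℝ}
    (mρ : AEStronglyMeasurable ρ volume) (hρ : ∀ᵐ x, |ρ x| ≤ M)
    (mu : ∀ i, AEStronglyMeasurable (u i) volume) (hu : ∀ i, ∀ᵐ x, |u i x| ≤ M)
    (mass : ∀ n x, ∑ i, pd (mo n (fun y => ρ y * u i y)) i x = 0)
    (ld : LI d) (div : ∀ n x, ∑ k, pd (mo n (u k)) k x = mo n d x)
    (gb : ∀ φ, Sm φ → HasCompactSupport φ → ∀ i, ∃ C, ∀ n, ∫ x, (∑ j, pd (mo n (u i)) j x ^ 2) * φ x ^ 2 ≤ C)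
    (hf : ∀ s, HasDerivAt f (f' s) s) (hQ : ∀ s, HasDerivAt Q (s * f' s) s) (cf' : Continuous f')
    (sχ : Sm χ) (hc : HasCompactSupport χ) :
    ∑ j, ∫ x, ρ x * u j x * f (ρ x) * pd χ j x = (∫ x, d x * (Q (ρ x) * χ x)) + ∑ j, ∫ x, Q (ρ x) * (u j x * pd χ j x) := by
  have M0 : 0 ≤ M := by obtain ⟨x, hx⟩ := hρ.exists; exact (abs_nonneg _).trans hx
  have lρ : LI ρ := LI_bd mρ hρ
  have lu : ∀ i, LI (u i) := fun i => LI_bd (mu i) (hu i)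
  have bm : ∀ i, ∀ᵐ x, |ρ x * u i x| ≤ M * M := by
    intro i
    filter_upwards [hu i, hρ] with x h1 h2
    rw [abs_mul]; gcongr
  have lm : ∀ i, LI (fun y => ρ y * u i y) := fun i => LI_bd (mρ.mul (mu i)) (bm i)
  have cf : Continuous f := continuous_iff_continuousAt.mpr fun s => (hf s).continuousAt
  have cQ : Continuous Q := continuous_iff_continuousAt.mpr fun s => (hQ s).continuousAt
  have bdd : ∀ h : ℝ → ℝ, Continuous h → ∃ K, 0 ≤ K ∧ ∀ n x, |h (mo n ρ x)| ≤ K := by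
    intro h ch
    obtain ⟨K, hK⟩ := (isCompact_Icc (a := -M) (b := M)).exists_bound_of_continuousOn ch.continuousOn
    have : ∀ n x, |h (mo n ρ x)| ≤ K := fun n x => hK _ (abs_le.mp (mo_abs_le n lρ hρ x))
    exact ⟨K, (abs_nonneg _).trans (this 0 0), this⟩
  obtain ⟨Kf, Kf0, hKf⟩ := bdd f cf
  obtain ⟨Kf', Kf'0, hKf'⟩ := bdd f' cf'
  obtain ⟨KQ, KQ0, hKQ⟩ := bdd Q cQ
  have sr : ∀ n, Sm (mo n ρ) := fun n => mo_sm n lρ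
  have sm : ∀ n i, Sm (mo n (fun y => ρ y * u i y)) := fun n i => mo_sm n (lm i)
  have sU : ∀ n i, Sm (mo n (u i)) := fun n i => mo_sm n (lu i)
  have tr := ae_tendsto_mo lρ
  have tm := fun i => ae_tendsto_mo (lm i)
  have tU := fun i => ae_tendsto_mo (lu i)
  have cχ := sχ.continuous
  have cpχ := fun j => (sχ.pd j).continuous
  obtain ⟨R, hR⟩ : ∃ R : ℝ, ∀ x, R < ‖x‖ → χ x = 0 := by
    obtain ⟨R, hR⟩ := hc.isCompact.isBounded.subset_closedBall (0:E3)
    refine ⟨R, fun x hx => image_eq_zero_of_notMem_tsupport fun h => ?_⟩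
    have := hR h
    simp at this; linarith
  obtain ⟨Kχ, hKχ⟩ := hc.exists_bound_of_continuous cχ
  -- commutator term
  have A : ∀ j, Tendsto (fun n => ∫ x, (mo n (fun y => ρ y * u j y) x - mo n ρ x * mo n (u j) x) * (f' (mo n ρ x) * pd (mo n ρ) j x * χ x)) atTop (𝓝 0) := by
    intro j
    obtain ⟨φ, sφ, hcφ, h1, -⟩ := cutoff (R + 1)
    obtain ⟨C, hC⟩ := gb φ sφ hcφ j
    refine small_int (s := closedBall (0:E3) R) (K := 4 * M ^ 2 * C) (isCompact_closedBall _ _) (fun n => ?_) (fun n => ?_) (fun n x hx => ?_)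
      (fun n => comm_est (mu j) (hu j) mρ hρ sφ hcφ h1 hC n) ?_
    · exact (sm n j).continuous.sub ((sr n).continuous.mul (sU n j).continuous)
    · exact ((cf'.comp (sr n).continuous).mul ((sr n).pd j).continuous).mul cχ
    · rw [hR x (by simpa using hx), mul_zero]
    · set Kp := M * ∫ y, |pd kap j y|
      have Kp0 : 0 ≤ Kp := (abs_nonneg _).trans (pd_mo_abs_le lρ hρ j 0 0)
      have : Tendsto (fun n : ℕ => ∫ x, (((n:ℝ)+1)⁻¹ * (f' (mo n ρ x) * pd (mo n ρ) j x * χ x)) ^ 2) atTop (𝓝 (∫ _ : E3, (0:ℝ))) := by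
        refine tendsto_integral_of_dominated_convergence (fun x => (Kf' * Kp) ^ 2 * (χ x * χ x)) (fun n => ?_) ?_ (fun n => ?_) ?_
        · exact ((continuous_const.mul (((cf'.comp (sr n).continuous).mul ((sr n).pd j).continuous).mul cχ)).pow 2).aestronglyMeasurable
        · exact (ccs_int (cχ.mul cχ) hc.mul_left).const_mul _
        · refine ae_of_all _ fun x => ?_
          have e : (((n:ℝ)+1)⁻¹ * (f' (mo n ρ x) * pd (mo n ρ) j x * χ x)) ^ 2 =
            (f' (mo n ρ x) * (((n:ℝ)+1)⁻¹ * pd (mo n ρ) j x)) ^ 2 * (χ x * χ x) := by ring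
          rw [Real.norm_eq_abs, abs_of_nonneg (sq_nonneg _), e]
          refine mul_le_mul_of_nonneg_right ?_ (mul_self_nonneg _)
          rw [← sq_abs, abs_mul]
          gcongr
          · exact hKf' n x
          · exact pd_mo_abs_le lρ hρ j n x
        · filter_upwards [tr, ae_tendsto_pd_mo lρ j] with x h1 h2
          have h3 := (((cf'.tendsto _).comp h1).mul h2).mul_const (χ x)
          have h4 := h3.pow 2
          simp only [mul_zero, zero_mul, ne_eq, OfNat.ofNat_ne_zero, not_false_eq_true, zero_pow] at h4
          refine h4.congr fun n => ?_
          simp only [Function.comp]; ring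
      simpa using this
  have B : ∀ j, Tendsto (fun n => ∫ x, mo n (fun y => ρ y * u j y) x * f (mo n ρ x) * pd χ j x) atTop (𝓝 (∫ x, ρ x * u j x * f (ρ x) * pd χ j x)) := by
    intro j
    refine tendsto_integral_of_dominated_convergence (fun x => (M * M * Kf) * ‖pd χ j x‖) (fun n => ?_) ?_ (fun n => ?_) ?_
    · exact (((sm n j).continuous.mul (cf.comp (sr n).continuous)).mul (cpχ j)).aestronglyMeasurable
    · exact (ccs_int (cpχ j) (hcs_pd hc j)).norm.const_mul _
    · refine ae_of_all _ fun x => ?_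
      rw [norm_mul, norm_mul]
      gcongr
      · exact mo_abs_le n (lm j) (bm j) x
      · exact hKf n x
    · filter_upwards [tr, tm j] with x h1 h2
      exact (h2.mul ((cf.tendsto _).comp h1)).mul_const _
  have B2 : ∀ j, Tendsto (fun n => ∫ x, Q (mo n ρ x) * (mo n (u j) x * pd χ j x)) atTop (𝓝 (∫ x, Q (ρ x) * (u j x * pd χ j x))) := by
    intro j
    refine tendsto_integral_of_dominated_convergence (fun x => KQ * (M * ‖pd χ j x‖)) (fun n => ?_) ?_ (fun n => ?_) ?_
    · exact ((cQ.comp (sr n).continuous).mul ((sU n j).continuous.mul (cpχ j))).aestronglyMeasurable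
    · exact ((ccs_int (cpχ j) (hcs_pd hc j)).norm.const_mul _).const_mul _
    · refine ae_of_all _ fun x => ?_
      rw [norm_mul, norm_mul]
      gcongr
      · exact hKQ n x
      · exact mo_abs_le n (lu j) (hu j) x
    · filter_upwards [tr, tU j] with x h1 h2
      exact ((cQ.tendsto _).comp h1).mul (h2.mul_const _)
  have Dt : Tendsto (fun n => ∫ x, (∑ k, pd (mo n (u k)) k x) * (Q (mo n ρ x) * χ x)) atTop (𝓝 (∫ x, d x * (Q (ρ x) * χ x))) := by
    set d' := (closedBall (0:E3) (R+1)).indicator d with hd'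
    have id' : Integrable d' volume := (integrable_indicator_iff measurableSet_closedBall).mpr (ld.integrableOn_isCompact (isCompact_closedBall _ _))
    have e1 : ∀ n x, (∑ k, pd (mo n (u k)) k x) * (Q (mo n ρ x) * χ x) = mo n d' x * (Q (mo n ρ x) * χ x) := by
      intro n x
      rw [div]
      by_cases hx : ‖x‖ ≤ R
      · rw [hd', mo_local n hx]
      · rw [hR x (by linarith)]; simp
    have e2 : ∀ x, d x * (Q (ρ x) * χ x) = d' x * (Q (ρ x) * χ x) := by
      intro x
      by_cases hx : ‖x‖ ≤ R
      · rw [hd', indicator_of_mem]; simp; linarith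
      · rw [hR x (by linarith)]; simp
    simp only [e1, e2]
    refine tend_mul (K := KQ * Kχ) (mo_tendsto_L1 id') id' (fun n => mo_integrable n id') (fun n => ?_) (fun n => ?_) ?_
    · exact ((cQ.comp (sr n).continuous).mul cχ).aestronglyMeasurable
    · refine ae_of_all _ fun x => ?_
      rw [abs_mul]
      have := hKχ x
      rw [Real.norm_eq_abs] at this
      gcongr
      exact hKQ n x
    · filter_upwards [tr] with x h1
      exact ((cQ.tendsto _).comp h1).mul_const _
  have lim := ((tendsto_finsetSum Finset.univ fun j _ => A j).add (tendsto_finsetSum Finset.univ fun j _ => B j)).sub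
    (Dt.add (tendsto_finsetSum Finset.univ fun j _ => B2 j))
  have z := tendsto_nhds_unique (lim.congr fun n => (renorm_smooth (sr n) (sm n) (sU n) hf hQ cf' sχ hc (mass n)).symm) tendsto_const_nhds
  simp only [Finset.sum_const_zero, zero_add] at z
  linarith


theorem cutoffs : ∃ (χ : ℕ → E3 → ℝ) (C : ℝ), (∀ n, Sm (χ n)) ∧ (∀ n, HasCompactSupport (χ n)) ∧
    (∀ n x, |χ n x| ≤ 1) ∧ (∀ x, Tendsto (fun n => χ n x) atTop (𝓝 1)) ∧
    ∀ n j x, |pd (χ n) j x| ≤ C * ((n:ℝ)+1)⁻¹ := by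
  obtain ⟨φ, sφ, cφ, h1, h2⟩ := cutoff 1
  have hb : ∀ j, ∃ C, ∀ x, |pd φ j x| ≤ C := fun j => by
    obtain ⟨C, hC⟩ := (hcs_pd cφ j).exists_bound_of_continuous (sφ.pd j).continuous
    exact ⟨C, hC⟩
  choose C hC using hb
  have hpd : ∀ n j x, pd (fun x => φ (((n:ℝ)+1)⁻¹ • x)) j x = ((n:ℝ)+1)⁻¹ * pd φ j (((n:ℝ)+1)⁻¹ • x) := by
    intro n j x
    simp only [pd]
    have h := (sφ.d (((n:ℝ)+1)⁻¹ • x)).hasFDerivAt.comp x ((hasFDerivAt_id x).const_smul (((n:ℝ)+1)⁻¹))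
    have h2 : HasFDerivAt (fun x => φ (((n:ℝ)+1)⁻¹ • x)) _ x := h
    rw [h2.fderiv]
    simp
  refine ⟨fun n x => φ (((n:ℝ)+1)⁻¹ • x), ∑ j, C j, fun n => sφ.comp (contDiff_const_smul _), fun n => ?_,
    fun n x => h2 _, fun x => ?_, fun n j x => ?_⟩
  · exact cφ.comp_smul (inv_ne_zero (np n).ne')
  · apply tendsto_const_nhds.congr'
    filter_upwards [eventually_ge_atTop ⌈‖x‖⌉₊] with n hn
    refine (h1 _ ?_).symm
    rw [norm_smul, Real.norm_of_nonneg (inv_nonneg.2 (np n).le), inv_mul_le_iff₀ (np n)]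
    have := Nat.ceil_le.1 hn
    linarith
  · rw [hpd, abs_mul, abs_of_nonneg (inv_nonneg.2 (np n).le), mul_comm]
    refine mul_le_mul_of_nonneg_right ((hC j _).trans ?_) (inv_nonneg.2 (np n).le)
    exact Finset.single_le_sum (f := C) (fun i _ => (abs_nonneg _).trans (hC i 0)) (Finset.mem_univ j)

theorem cut_zero {h : E3 → ℝ} {b : ℕ → E3 → ℝ} {C : ℝ} (ih : Integrable h volume)
    (hb : ∀ (n:ℕ) x, |b n x| ≤ C * ((n:ℝ)+1)⁻¹) :
    Tendsto (fun n => ∫ x, h x * b n x) atTop (𝓝 0) := by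
  refine squeeze_zero_norm (a := fun n : ℕ => (∫ x, |h x|) * (C * ((n:ℝ)+1)⁻¹)) (fun n => ?_) ?_
  · rw [← integral_mul_const]
    refine norm_integral_le_of_norm_le (ih.abs.mul_const _) (ae_of_all _ fun x => ?_)
    rw [Real.norm_eq_abs, abs_mul]
    exact mul_le_mul_of_nonneg_left (hb n x) (abs_nonneg _)
  · have := (tinv.const_mul C).const_mul (∫ x, |h x|)
    simpa using this

theorem cut_one {h : E3 → ℝ} {b : ℕ → E3 → ℝ} (ih : Integrable h volume) (cb : ∀ n, Continuous (b n))
    (hb : ∀ (n:ℕ) x, |b n x| ≤ 1) (ht : ∀ x, Tendsto (fun n => b n x) atTop (𝓝 1)) :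
    Tendsto (fun n => ∫ x, h x * b n x) atTop (𝓝 (∫ x, h x)) := by
  refine tendsto_integral_of_dominated_convergence (fun x => |h x|)
    (fun n => ih.aestronglyMeasurable.mul (cb n).aestronglyMeasurable) ih.abs
    (fun n => ae_of_all _ fun x => ?_) (ae_of_all _ fun x => ?_)
  · rw [Real.norm_eq_abs, abs_mul]
    exact mul_le_of_le_one_right (abs_nonneg _) (hb n x)
  · simpa using (ht x).const_mul (h x)

theorem bdd_comp {ρ : E3 → ℝ} {M : ℝ} {f : ℝ → ℝ} (mρ : AEStronglyMeasurable ρ volume) (hρ : ∀ᵐ x, |ρ x| ≤ M)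
    (cf : Continuous f) : AEStronglyMeasurable (fun x => f (ρ x)) volume ∧ ∃ K, ∀ᵐ x, |f (ρ x)| ≤ K := by
  refine ⟨cf.comp_aestronglyMeasurable mρ, ?_⟩
  obtain ⟨K, hK⟩ := isCompact_Icc.exists_bound_of_continuousOn (s := Icc (-M) M) cf.continuousOn
  refine ⟨K, ?_⟩
  filter_upwards [hρ] with x hx
  exact hK _ (abs_le.1 hx)

theorem renorm_inf {ρ d : E3 → ℝ} {u : VF} {M K : ℝ} {f f' Q : ℝ → ℝ}
    (mρ : AEStronglyMeasurable ρ volume) (hρ : ∀ᵐ x, |ρ x| ≤ M)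
    (mu : ∀ i, AEStronglyMeasurable (u i) volume) (hu : ∀ i, ∀ᵐ x, |u i x| ≤ M)
    (mass : ∀ n x, ∑ i, pd (mo n (fun y => ρ y * u i y)) i x = 0)
    (ld : LI d) (div : ∀ n x, ∑ k, pd (mo n (u k)) k x = mo n d x)
    (gb : ∀ φ, Sm φ → HasCompactSupport φ → ∀ i, ∃ C, ∀ n, ∫ x, (∑ j, pd (mo n (u i)) j x ^ 2) * φ x ^ 2 ≤ C)
    (hf : ∀ s, HasDerivAt f (f' s) s) (hQ : ∀ s, HasDerivAt Q (s * f' s) s) (cf' : Continuous f')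
    (iρ : Integrable ρ volume) (hQb : ∀ s, |s| ≤ M → |Q s| ≤ K * |s|)
    (iQ : Integrable (fun x => d x * Q (ρ x)) volume) :
    ∫ x, d x * Q (ρ x) = 0 := by
  obtain ⟨χ, C, sχ, cχ, b1, t1, bC⟩ := cutoffs
  have cf : Continuous f := continuous_iff_continuousAt.2 fun s => (hf s).continuousAt
  have cQ : Continuous Q := continuous_iff_continuousAt.2 fun s => (hQ s).continuousAt
  obtain ⟨mf, Kf, hKf⟩ := bdd_comp mρ hρ cf
  have i1 : ∀ j, Integrable (fun x => ρ x * u j x * f (ρ x)) volume := fun j => by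
    have a : Integrable (fun x => ρ x * u j x) volume := iρ.mul_bdd (c := M) (mu j) (hu j)
    exact a.mul_bdd (c := Kf) mf hKf
  have i2 : Integrable (fun x => Q (ρ x)) volume := by
    refine (iρ.abs.const_mul K).mono' (cQ.comp_aestronglyMeasurable mρ) ?_
    filter_upwards [hρ] with x hx
    exact hQb _ hx
  have i3 : ∀ j, Integrable (fun x => Q (ρ x) * u j x) volume := fun j => i2.mul_bdd (c := M) (mu j) (hu j)
  have key : ∀ n, ∑ j, ∫ x, ρ x * u j x * f (ρ x) * pd (χ n) j x
      = (∫ x, d x * Q (ρ x) * χ n x) + ∑ j, ∫ x, Q (ρ x) * u j x * pd (χ n) j x := by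
    intro n
    have := renorm mρ hρ mu hu mass ld div gb hf hQ cf' (sχ n) (cχ n)
    simp only [← mul_assoc] at this ⊢
    exact this
  have l1 : Tendsto (fun n => ∑ j, ∫ x, ρ x * u j x * f (ρ x) * pd (χ n) j x) atTop (𝓝 (∑ j : Fin 3, 0)) :=
    tendsto_finsetSum _ fun j _ => cut_zero (i1 j) (fun n x => bC n j x)
  have l3 : Tendsto (fun n => ∑ j, ∫ x, Q (ρ x) * u j x * pd (χ n) j x) atTop (𝓝 (∑ j : Fin 3, 0)) :=
    tendsto_finsetSum _ fun j _ => cut_zero (i3 j) (fun n x => bC n j x)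
  have l2 := (cut_one iQ (fun n => (sχ n).continuous) b1 t1).add l3
  have := tendsto_nhds_unique (l1.congr key) l2
  simpa using this.symm


theorem Qex {p p' : ℝ → ℝ} (hp_nonneg : ∀ s, 0 ≤ s → 0 ≤ p s)
    (hp_deriv : ∀ s, 0 < s → HasDerivAt p (p' s) s)
    (hp'_cont : ContinuousOn p' (Ioi 0)) {δ : ℝ} (hδ : 0 < δ) :
    ∃ f f' Q : ℝ → ℝ, (∀ s, HasDerivAt f (f' s) s) ∧ (∀ s, HasDerivAt Q (s * f' s) s) ∧ Continuous f' ∧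
      (∀ M, ∃ K, ∀ s, |s| ≤ M → |Q s| ≤ K * |s|) ∧ (∀ s, 0 ≤ s → 0 ≤ Q s) ∧ (∀ s, 0 ≤ s → Q s ≤ p s) ∧
      ∀ s, 2 * δ ≤ s → Q s = p s := by
  set θ : ℝ → ℝ := fun s => Real.smoothTransition ((s - δ) / δ) with hθ
  have sθ : ContDiff ℝ 1 θ := Real.smoothTransition.contDiff.comp ((contDiff_id.sub contDiff_const).div_const δ)
  have θ0 : ∀ s, s ≤ δ → θ s = 0 := fun s hs =>
    Real.smoothTransition.zero_of_nonpos (div_nonpos_of_nonpos_of_nonneg (by linarith) hδ.le)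
  have dθ : ∀ s, HasDerivAt θ (deriv θ s) s := fun s => (sθ.differentiable (by norm_num) s).hasDerivAt
  have cdθ : Continuous (deriv θ) := sθ.continuous_deriv (by norm_num)
  have dθ0 : ∀ s, s < δ → deriv θ s = 0 := fun s hs => by
    have : θ =ᶠ[𝓝 s] fun _ => 0 := by
      filter_upwards [Iio_mem_nhds hs] with t ht using θ0 t (le_of_lt ht)
    rw [this.deriv_eq]; simp
  set q : ℝ → ℝ := fun s => deriv θ s * p s + θ s * p' s with hq
  have q0 : ∀ s, s < δ → q s = 0 := fun s hs => by simp only [hq, dθ0 s hs, θ0 s hs.le]; ring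
  have cf' : Continuous (fun s => q s / s) := by
    rw [continuous_iff_continuousAt]
    intro s
    rcases lt_or_ge 0 s with hs | hs
    · have cp : ContinuousAt p s := (hp_deriv s hs).continuousAt
      have cp' : ContinuousAt p' s := hp'_cont.continuousAt (Ioi_mem_nhds hs)
      exact ((cdθ.continuousAt.mul cp).add (sθ.continuous.continuousAt.mul cp')).div continuousAt_id hs.ne'
    · have : (fun s => q s / s) =ᶠ[𝓝 s] fun _ => 0 := by
        filter_upwards [Iio_mem_nhds (lt_of_le_of_lt hs hδ)] with t ht
        rw [q0 t ht]; simp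
      exact continuousAt_const.congr this.symm
  have hQ : ∀ s, HasDerivAt (fun s => θ s * p s) (s * (q s / s)) s := by
    intro s
    rcases lt_or_ge 0 s with hs | hs
    · rw [mul_div_cancel₀ _ hs.ne']
      exact (dθ s).mul (hp_deriv s hs)
    · rw [q0 s (lt_of_le_of_lt hs hδ)]
      have : (fun s => θ s * p s) =ᶠ[𝓝 s] fun _ => 0 := by
        filter_upwards [Iio_mem_nhds (lt_of_le_of_lt hs hδ)] with t ht
        rw [θ0 t (le_of_lt ht)]; simp
      simpa using (hasDerivAt_const s (0:ℝ)).congr_of_eventuallyEq this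
  have cQ : Continuous (fun s => θ s * p s) := continuous_iff_continuousAt.2 fun s => (hQ s).continuousAt
  refine ⟨fun s => ∫ t in (0:ℝ)..s, q t / t, fun s => q s / s, fun s => θ s * p s, fun s => ?_, hQ, cf', ?_, ?_, ?_, ?_⟩
  · exact intervalIntegral.integral_hasDerivAt_right (cf'.intervalIntegrable _ _)
      (cf'.stronglyMeasurableAtFilter _ _) cf'.continuousAt
  · intro M
    obtain ⟨B, hB⟩ := isCompact_Icc.exists_bound_of_continuousOn (s := Icc (-M) M) cQ.continuousOn
    refine ⟨|B| / δ, fun s hs => ?_⟩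
    rcases le_or_gt s δ with h | h
    · simp only [θ0 s h, zero_mul, abs_zero]; positivity
    · have h1 : |θ s * p s| ≤ |B| := (hB s (abs_le.1 hs)).trans (le_abs_self _)
      refine h1.trans ?_
      rw [div_mul_eq_mul_div, le_div_iff₀ hδ]
      exact mul_le_mul_of_nonneg_left (h.le.trans (le_abs_self _)) (abs_nonneg _)
  · exact fun s hs => mul_nonneg (Real.smoothTransition.nonneg _) (hp_nonneg s hs)
  · exact fun s hs => mul_le_of_le_one_left (hp_nonneg s hs) (Real.smoothTransition.le_one _)
  · intro s hs
    have : θ s = 1 := Real.smoothTransition.one_of_one_le (by rw [le_div_iff₀ hδ]; linarith)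
    simp [this]


structure QS (p : ℝ → ℝ) (Q : ℕ → ℝ → ℝ) : Prop where
  ex : ∀ k, ∃ f f' : ℝ → ℝ, (∀ s, HasDerivAt f (f' s) s) ∧ (∀ s, HasDerivAt (Q k) (s * f' s) s) ∧ Continuous f'
  lin : ∀ k M, ∃ K, ∀ s, |s| ≤ M → |Q k s| ≤ K * |s|
  nonneg : ∀ k s, 0 ≤ s → 0 ≤ Q k s
  le : ∀ k s, 0 ≤ s → Q k s ≤ p s
  lim : ∀ s, 0 ≤ s → Tendsto (fun k => Q k s) atTop (𝓝 (p s))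

theorem QS.cont {p : ℝ → ℝ} {Q : ℕ → ℝ → ℝ} (h : QS p Q) (k : ℕ) : Continuous (Q k) := by
  obtain ⟨f, f', h1, h2, h3⟩ := h.ex k
  exact continuous_iff_continuousAt.2 fun s => (h2 s).continuousAt

theorem QSex {p p' : ℝ → ℝ} (hp0 : p 0 = 0) (hp_nonneg : ∀ s, 0 ≤ s → 0 ≤ p s)
    (hp_deriv : ∀ s, 0 < s → HasDerivAt p (p' s) s)
    (hp'_cont : ContinuousOn p' (Ioi 0)) : ∃ Q, QS p Q := by
  choose f f' Q h1 h2 h3 h4 h5 h6 h7 using fun k : ℕ => Qex hp_nonneg hp_deriv hp'_cont (inv_pos.2 (np k))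
  refine ⟨Q, fun k => ⟨f k, f' k, h1 k, h2 k, h3 k⟩, h4, h5, h6, fun s hs => ?_⟩
  rcases hs.eq_or_lt with h | h
  · subst h
    have : ∀ k, Q k 0 = p 0 := fun k => le_antisymm (h6 k 0 le_rfl) (by rw [hp0]; exact h5 k 0 le_rfl)
    simp [this]
  · apply tendsto_const_nhds.congr'
    have := (tinv.const_mul 2).eventually (gt_mem_nhds (by simpa using h : 2 * 0 < s))
    filter_upwards [this] with k hk
    exact (h7 k s hk.le).symm

structure Setup (ρ : E3 → ℝ) (u : VF) (M : ℝ) : Prop where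
  mρ : AEStronglyMeasurable ρ volume
  hρ : ∀ᵐ x, |ρ x| ≤ M
  mu : ∀ i, AEStronglyMeasurable (u i) volume
  hu : ∀ i, ∀ᵐ x, |u i x| ≤ M
  mass : ∀ n x, ∑ i, pd (mo n (fun y => ρ y * u i y)) i x = 0
  iρ : Integrable ρ volume
  ρ0 : ∀ᵐ x, 0 ≤ ρ x

def GB (u : VF) : Prop := ∀ φ, Sm φ → HasCompactSupport φ → ∀ i, ∃ C, ∀ n, ∫ x, (∑ j, pd (mo n (u i)) j x ^ 2) * φ x ^ 2 ≤ C

theorem ml_interp {f : E3 → ℝ} {B : ℝ} (h1 : Integrable f volume) (hB : ∀ᵐ x, |f x| ≤ B) {r : ENNReal} (hr : 1 ≤ r) :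
    ML f r := by
  by_cases ht : r = ⊤
  · rw [ht]; exact memLp_top_of_bound h1.aestronglyMeasurable B hB
  have h0 : r ≠ 0 := (lt_of_lt_of_le zero_lt_one hr).ne'
  have h1r : 1 ≤ r.toReal := by
    have := ENNReal.toReal_mono ht hr
    simpa using this
  refine (integrable_norm_rpow_iff h1.aestronglyMeasurable h0 ht).1 ?_
  refine (h1.abs.mul_const (|B| ^ (r.toReal - 1))).mono'
    ((h1.aestronglyMeasurable.norm.aemeasurable.pow_const _).aestronglyMeasurable) ?_
  filter_upwards [hB] with x hx
  rw [Real.norm_of_nonneg (by positivity)]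
  by_cases hz : f x = 0
  · rw [hz, norm_zero, Real.zero_rpow (by linarith)]; simp
  have : ‖f x‖ ^ r.toReal = |f x| * |f x| ^ (r.toReal - 1) := by
    rw [Real.norm_eq_abs, Real.rpow_sub_one (abs_pos.2 hz).ne']
    field_simp
  rw [this]
  exact mul_le_mul_of_nonneg_left (Real.rpow_le_rpow (abs_nonneg _) (hx.trans (le_abs_self _)) (by linarith)) (abs_nonneg _)

theorem Q_mem {p : ℝ → ℝ} {Q : ℕ → ℝ → ℝ} {ρ : E3 → ℝ} {u : VF} {M : ℝ} (hQ : QS p Q) (S : Setup ρ u M) (k : ℕ) :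
    Integrable (fun x => Q k (ρ x)) volume ∧ ML (fun x => Q k (ρ x)) ⊤ ∧ ML (fun x => Q k (ρ x)) 2 := by
  obtain ⟨m, B, hB⟩ := bdd_comp S.mρ S.hρ (hQ.cont k)
  obtain ⟨K, hK⟩ := hQ.lin k M
  have i1 : Integrable (fun x => Q k (ρ x)) volume := by
    refine (S.iρ.abs.const_mul K).mono' m ?_
    filter_upwards [S.hρ] with x hx
    exact hK _ hx
  have i2 : ML (fun x => Q k (ρ x)) ⊤ := memLp_top_of_bound m B hB
  exact ⟨i1, i2, ml_interp i1 hB (by norm_num)⟩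

theorem Setup.zero {p : ℝ → ℝ} {Q : ℕ → ℝ → ℝ} {ρ d : E3 → ℝ} {u : VF} {M : ℝ} (hQ : QS p Q) (S : Setup ρ u M) (gb : GB u)
    (ld : LI d) (div : ∀ n x, ∑ k, pd (mo n (u k)) k x = mo n d x) (k : ℕ)
    (iQ : Integrable (fun x => d x * Q k (ρ x)) volume) : ∫ x, d x * Q k (ρ x) = 0 := by
  obtain ⟨f, f', h1, h2, h3⟩ := hQ.ex k
  obtain ⟨K, hK⟩ := hQ.lin k M
  exact renorm_inf S.mρ S.hρ S.mu S.hu S.mass ld div gb h1 h2 h3 S.iρ hK iQ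

theorem P_meas {p : ℝ → ℝ} {Q : ℕ → ℝ → ℝ} {ρ : E3 → ℝ} {u : VF} {M : ℝ} (hQ : QS p Q) (S : Setup ρ u M) :
    AEStronglyMeasurable (fun x => p (ρ x)) volume ∧ ∀ᵐ x, Tendsto (fun k => Q k (ρ x)) atTop (𝓝 (p (ρ x))) := by
  have : ∀ᵐ x, Tendsto (fun k => Q k (ρ x)) atTop (𝓝 (p (ρ x))) := by
    filter_upwards [S.ρ0] with x hx using hQ.lim _ hx
  exact ⟨aestronglyMeasurable_of_tendsto_ae atTop (fun k => (hQ.cont k).comp_aestronglyMeasurable S.mρ) this, this⟩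

theorem P_L2 {p : ℝ → ℝ} {Q : ℕ → ℝ → ℝ} {ρ H : E3 → ℝ} {u : VF} {M c : ℝ} (hQ : QS p Q) (S : Setup ρ u M) (gb : GB u)
    (hP : ∀ᵐ x, |p (ρ x)| ≤ M) (hH : ML H 2) (hc : 0 < c)
    (div : ∀ n x, ∑ k, pd (mo n (u k)) k x = mo n (fun x => c * p (ρ x) + H x) x) : ML (fun x => p (ρ x)) 2 := by
  obtain ⟨mP, lP⟩ := P_meas hQ S
  have ld : LI (fun x => c * p (ρ x) + H x) := by
    have h1 : LI (fun x => p (ρ x)) := LI_bd mP hP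
    exact (h1.smul c).add (LI_of_mem (by norm_num) hH)
  have bd : ∀ k, ∫ x, Q k (ρ x) ^ 2 ≤ (c⁻¹)^2 * ∫ x, H x ^ 2 := by
    intro k
    obtain ⟨i1, i2, i3⟩ := Q_mem hQ S k
    have j1 : Integrable (fun x => p (ρ x) * Q k (ρ x)) volume := i1.bdd_mul mP hP
    have j2 : Integrable (fun x => H x * Q k (ρ x)) volume := hold_int inv22 hH i3
    have e : ∀ x, (c * p (ρ x) + H x) * Q k (ρ x) = c * (p (ρ x) * Q k (ρ x)) + H x * Q k (ρ x) := fun x => by ring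
    have j3 : Integrable (fun x => c * (p (ρ x) * Q k (ρ x)) + H x * Q k (ρ x)) volume := (j1.const_mul c).add j2
    have z := S.zero hQ gb ld div k (by simp only [e]; exact j3)
    simp only [e] at z
    have jQ : Integrable (fun x => Q k (ρ x) ^ 2) volume := i3.integrable_sq
    have jH : Integrable (fun x => H x ^ 2) volume := hH.integrable_sq
    have : ∫ x, (c/2 * Q k (ρ x) ^ 2 - (2*c)⁻¹ * H x ^ 2) ≤ ∫ x, (c * (p (ρ x) * Q k (ρ x)) + H x * Q k (ρ x)) := by
      refine integral_mono_ae ((jQ.const_mul _).sub (jH.const_mul _)) j3 ?_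
      filter_upwards [S.ρ0] with x hx
      have a := hQ.nonneg k _ hx
      have b := hQ.le k _ hx
      have h1 : c * (Q k (ρ x) * Q k (ρ x)) ≤ c * (p (ρ x) * Q k (ρ x)) :=
        mul_le_mul_of_nonneg_left (mul_le_mul_of_nonneg_right b a) hc.le
      have h2 : 0 ≤ (2*c)⁻¹ * (H x + c * Q k (ρ x)) ^ 2 := by positivity
      have h3 : (2*c)⁻¹ * (H x + c * Q k (ρ x)) ^ 2 = (2*c)⁻¹ * H x ^ 2 + H x * Q k (ρ x) + c/2 * Q k (ρ x) ^ 2 := by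
        field_simp; ring
      nlinarith
    rw [z, integral_sub (jQ.const_mul _) (jH.const_mul _), integral_const_mul, integral_const_mul] at this
    have h4 : c / 2 * (((c⁻¹)^2 * ∫ x, H x ^ 2) - ∫ x, Q k (ρ x) ^ 2) ≥ 0 := by
      have : c / 2 * (((c⁻¹)^2 * ∫ x, H x ^ 2) - ∫ x, Q k (ρ x) ^ 2) = (2*c)⁻¹ * (∫ x, H x ^ 2) - c / 2 * ∫ x, Q k (ρ x) ^ 2 := by
        field_simp
      linarith
    have := (mul_nonneg_iff_of_pos_left (by positivity : 0 < c / 2)).1 h4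
    linarith
  refine ⟨mP, ?_⟩
  set B := (c⁻¹)^2 * ∫ x, H x ^ 2
  have h1 := Lp.eLpNorm_lim_le_liminf_eLpNorm (p := 2) (μ := (volume : Measure E3))
    (fun k => (Q_mem hQ S k).1.aestronglyMeasurable) (fun x => p (ρ x)) lP
  refine lt_of_le_of_lt h1 (lt_of_le_of_lt (b := ENNReal.ofReal (Real.sqrt B)) ?_ ENNReal.ofReal_lt_top)
  refine liminf_le_of_le (by isBoundedDefault) fun b hb => ?_
  obtain ⟨k, hk⟩ := hb.exists
  refine hk.trans ?_
  have h3 := (Q_mem hQ S k).2.2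
  rw [← ENNReal.ofReal_toReal h3.2.ne]
  refine ENNReal.ofReal_le_ofReal (Real.le_sqrt_of_sq_le ?_)
  have := nm_two_sq h3
  rw [nm] at this
  rw [this]; exact bd k

theorem P_tr {p : ℝ → ℝ} {Q : ℕ → ℝ → ℝ} {ρ D : E3 → ℝ} {u : VF} {M : ℝ} (hQ : QS p Q) (S : Setup ρ u M) (gb : GB u)
    (hP : ML (fun x => p (ρ x)) 2) (hD : ML D 2)
    (div : ∀ n x, ∑ k, pd (mo n (u k)) k x = mo n D x) : ∫ x, D x * p (ρ x) = 0 := by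
  obtain ⟨mP, lP⟩ := P_meas hQ S
  have hI : Integrable (fun x => D x * p (ρ x)) volume := hold_int inv22 hD hP
  have t : Tendsto (fun k => ∫ x, D x * Q k (ρ x)) atTop (𝓝 (∫ x, D x * p (ρ x))) := by
    refine tendsto_integral_of_dominated_convergence (fun x => |D x * p (ρ x)|)
      (fun k => hD.1.mul (Q_mem hQ S k).1.aestronglyMeasurable) hI.abs (fun k => ?_) ?_
    · filter_upwards [S.ρ0] with x hx
      rw [Real.norm_eq_abs, abs_mul, abs_mul, abs_of_nonneg (hQ.nonneg k _ hx)]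
      exact mul_le_mul_of_nonneg_left ((hQ.le k _ hx).trans (le_abs_self _)) (abs_nonneg _)
    · filter_upwards [lP] with x hx using hx.const_mul _
  refine tendsto_nhds_unique t (tendsto_const_nhds.congr fun k => ?_)
  exact (S.zero hQ gb (LI_of_mem (by norm_num) hD) div k (hold_int inv22 hD (Q_mem hQ S k).2.2)).symm


theorem mul_sq_hcs {f φ : E3 → ℝ} (hc : HasCompactSupport φ) : HasCompactSupport (fun x => f x * φ x ^ 2) := by
  have : (fun x => f x * φ x ^ 2) = fun x => (f x * φ x) * φ x := by ext x; ring
  rw [this]; exact hc.mul_left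

theorem st1 {μ κ M : ℝ} (hμ : 0 < μ) (hκ : 0 ≤ κ) {u g : VF} {F : Fin 3 → Fin 3 → E3 → ℝ} {P : E3 → ℝ}
    (mu : ∀ i, AEStronglyMeasurable (u i) volume) (hu : ∀ i, ∀ᵐ x, |u i x| ≤ M)
    (mP : AEStronglyMeasurable P volume) (hP : ∀ᵐ x, |P x| ≤ M) (vP : VI P) (vu : ∀ i, VI (u i))
    (hF : ∀ i j, ML (F i j) 2) (hg : ∀ i, ML (g i) (6/5))
    (h : VW μ κ u (fun i j x => F i j x + if i = j then P x else 0) g) :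
    ∃ H, ML H 2 ∧ (∀ n x, ∑ k, pd (mo n (u k)) k x = mo n (fun x => (μ+κ)⁻¹ * P x + H x) x) ∧ GB u := by
  have h65 : (1:ENNReal) ≤ 6/5 := by
    rw [ENNReal.le_div_iff_mul_le (by simp) (by simp)]; norm_num
  obtain ⟨v, w, W, hs⟩ := solve hμ hκ hF hg
  have lF : ∀ i j, LI (F i j) := fun i j => LI_of_mem (by norm_num) (hF i j)
  have lg : ∀ i, LI (g i) := fun i => LI_of_mem h65 (hg i)
  have lP : LI P := LI_bd mP hP
  have lu : ∀ i, LI (u i) := fun i => LI_bd (mu i) (hu i)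
  have lw : ∀ i, LI (w i) := fun i => LI_of_mem (by norm_num) (hs.w6 i)
  have lW : ∀ i j, LI (W i j) := fun i j => LI_of_mem (by norm_num) (hs.W2 i j)
  have iW2 : ∀ i j, Integrable (fun x => W i j x ^ 2) volume := fun i j => (hs.W2 i j).integrable_sq
  have hz := h.sub (hs.vw lF lg)
  have hT : ∀ i j x, (F i j x + if i = j then P x else 0) - F i j x = if i = j then P x else 0 := fun i j x => by ring
  have hg0 : ∀ i x, g i x - g i x = 0 := fun i x => sub_self _
  have vz : ∀ i, VI (fun x => u i x - w i x) := fun i => (vu i).sub (VI_of_mem (k := 6) (by norm_num) (hs.w6 i))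
  have lz : ∀ i, LI (fun x => u i x - w i x) := fun i => (lu i).sub (lw i)
  have e1 : ∀ n i, mo n (u i) = fun x => mo n (fun x => u i x - w i x) x + mo n (w i) x := by
    intro n i; ext x
    have a : mo n (fun x => u i x - w i x) x = mo n (u i) x - mo n (w i) x :=
      cv_sub (ker_cont n) (ker_hcs n) (lu i) (lw i) x
    rw [a]; ring
  have e2 : ∀ n i j x, pd (mo n (u i)) j x = pd (mo n (fun x => u i x - w i x)) j x + mo n (W i j) x := by
    intro n i j x
    rw [e1, pd_add (mo_sm n (lz i)).d (mo_sm n (lw i)).d, ← hs.pd_mo]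
  have hsum : μ + κ ≠ 0 := by positivity
  refine ⟨fun x => ∑ k, W k k x, ?_, ?_, ?_⟩
  · exact memLp_finsetSum _ fun k _ => hs.W2 k k
  · intro n x
    have s1 := stage1 hz hT hg0 lP vz vP n x
    have a1 := cv_add (ker_cont n) (ker_hcs n) (lP.smul (μ+κ)⁻¹) (g := fun x => ∑ k, W k k x)
      (locallyIntegrable_finsetSum _ fun k _ => lW k k) x
    have a2 := cv_sum Finset.univ (ker_cont n) (ker_hcs n) (fun k => lW k k) x
    have a3 := cv_const_mul (ker n) P (μ+κ)⁻¹ x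
    simp only [e2, Finset.sum_add_distrib]
    refine Eq.trans ?_ a1.symm
    rw [a2]
    refine congrArg₂ _ ?_ rfl
    refine Eq.trans ?_ a3.symm
    have s2 : cv (_root_.ker n) P x = (μ + κ) * ∑ k, pd (mo n fun x => u k x - w k x) k x := s1.symm
    rw [s2, inv_mul_cancel_left₀ hsum]
  · intro φ sφ cφ i
    obtain ⟨C, hC⟩ := pd_mo_bound (mu i) (hu i) (hs.w6 i) (fun x => rfl) mP hP i (μ+κ)⁻¹
      (fun n x => stage1_lap hμ hκ hz hT hg0 lP vz vP n i x) sφ cφ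
    obtain ⟨B, hB⟩ := cφ.exists_bound_of_continuous sφ.continuous
    refine ⟨2 * C + 2 * (B^2 * ∑ j, ∫ x, W i j x ^ 2), fun n => ?_⟩
    have cz : Continuous (fun x => ∑ j, pd (mo n (fun x => u i x - w i x)) j x ^ 2) :=
      continuous_finsetSum _ fun j _ => ((mo_sm n (lz i)).pd j).continuous.pow 2
    have cu : Continuous (fun x => ∑ j, pd (mo n (u i)) j x ^ 2) :=
      continuous_finsetSum _ fun j _ => ((mo_sm n (lu i)).pd j).continuous.pow 2
    have iz : Integrable (fun x => (∑ j, pd (mo n (fun x => u i x - w i x)) j x ^ 2) * φ x ^ 2) volume :=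
      ccs_int (cz.mul (sφ.continuous.pow 2)) (mul_sq_hcs cφ)
    have iu : Integrable (fun x => (∑ j, pd (mo n (u i)) j x ^ 2) * φ x ^ 2) volume :=
      ccs_int (cu.mul (sφ.continuous.pow 2)) (mul_sq_hcs cφ)
    have im : Integrable (fun x => ∑ j, mo n (fun y => W i j y ^ 2) x) volume :=
      integrable_finsetSum _ fun j _ => mo_integrable n (iW2 i j)
    have : ∫ x, (∑ j, pd (mo n (u i)) j x ^ 2) * φ x ^ 2 ≤
        ∫ x, (2 * ((∑ j, pd (mo n (fun x => u i x - w i x)) j x ^ 2) * φ x ^ 2) +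
          2 * (B^2 * ∑ j, mo n (fun y => W i j y ^ 2) x)) := by
      refine integral_mono iu ((iz.const_mul 2).add ((im.const_mul _).const_mul 2)) fun x => ?_
      have q1 : ∀ j, pd (mo n (u i)) j x ^ 2 ≤ 2 * pd (mo n (fun x => u i x - w i x)) j x ^ 2 + 2 * mo n (fun y => W i j y ^ 2) x := by
        intro j
        have := mo_sq_le n (lW i j) (iW2 i j).locallyIntegrable x
        rw [e2]
        nlinarith [sq_nonneg (pd (mo n (fun x => u i x - w i x)) j x - mo n (W i j) x)]
      have q2 : ∑ j, pd (mo n (u i)) j x ^ 2 ≤ 2 * (∑ j, pd (mo n (fun x => u i x - w i x)) j x ^ 2) + 2 * ∑ j, mo n (fun y => W i j y ^ 2) x := by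
        rw [Finset.mul_sum, Finset.mul_sum, ← Finset.sum_add_distrib]
        exact Finset.sum_le_sum fun j _ => q1 j
      have q3 : φ x ^ 2 ≤ B ^ 2 := by
        have := hB x
        rw [Real.norm_eq_abs] at this
        rw [← sq_abs]; exact pow_le_pow_left₀ (abs_nonneg _) this 2
      have q4 : 0 ≤ ∑ j, mo n (fun y => W i j y ^ 2) x :=
        Finset.sum_nonneg fun j _ => mo_ge n (iW2 i j).locallyIntegrable (ae_of_all _ fun y => sq_nonneg _) x
      have q5 := mul_le_mul_of_nonneg_right q2 (sq_nonneg (φ x))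
      have q6 := mul_le_mul_of_nonneg_right q3 q4
      show (∑ j, pd (mo n (u i)) j x ^ 2) * φ x ^ 2 ≤ _
      linarith
    refine this.trans ?_
    rw [integral_add (iz.const_mul 2) ((im.const_mul _).const_mul 2), integral_const_mul, integral_const_mul, integral_const_mul,
      integral_finsetSum _ fun j _ => mo_integrable n (iW2 i j)]
    simp only [mo_integral n (iW2 i _)]
    linarith [hC n]


theorem energy_zero {μ κ : ℝ} (hμ : 0 < μ) (hκ : 0 ≤ κ) {T : Fin 3 → Fin 3 → E3 → ℝ} {g : VF} {v : ℕ → VF} {w : VF}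
    {W : Fin 3 → Fin 3 → E3 → ℝ} (h : VS μ κ T g v w W)
    (hT : ∀ i j, ML (T i j) 2) (hg : ∀ i, ML (g i) (6/5))
    (z1 : ∑ i, ∑ j, Ip (T i j) (W i j) = 0) (z2 : ∑ i, Ip (g i) (w i) = 0) (i : Fin 3) : ∀ᵐ x, w i x = 0 := by
  have t1 : ∀ (f : E3 → ℝ) (hf : ML f 2) i j, Tendsto (fun n => Ip f (pd (v n i) j)) atTop (𝓝 (Ip f (W i j))) := by
    intro f hf i j
    have := (h.cW i j).int_left inv22 hf (fun n => (h.tf n).pd_mem i j 2) (h.W2 i j)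
    simp only [Ip_comm f]; exact this
  have t2 : ∀ i, Tendsto (fun n => Ip (g i) (v n i)) atTop (𝓝 (Ip (g i) (w i))) := by
    intro i
    have := (h.cw i).int_left (by rw [add_comm]; exact inv65) (hg i) (fun n => (h.tf n).mem i 6) (h.w6 i)
    simp only [Ip_comm (g i)]; exact this
  have tl : Tendsto (fun n => μ * ∑ i, ∑ j, Ip (W i j) (pd (v n i) j) + κ * ∑ k, ∑ l, Ip (W k k) (pd (v n l) l)) atTop
      (𝓝 (μ * ∑ i, ∑ j, Ip (W i j) (W i j) + κ * ∑ k, ∑ l, Ip (W k k) (W l l))) :=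
    ((tendsto_finsetSum _ fun i _ => tendsto_finsetSum _ fun j _ => t1 _ (h.W2 i j) i j).const_mul μ).add
      ((tendsto_finsetSum _ fun k _ => tendsto_finsetSum _ fun l _ => t1 _ (h.W2 k k) l l).const_mul κ)
  have tr : Tendsto (fun n => lF T g (v n)) atTop (𝓝 (∑ i, ∑ j, Ip (T i j) (W i j) + ∑ i, Ip (g i) (w i))) :=
    (tendsto_finsetSum _ fun i _ => tendsto_finsetSum _ fun j _ => t1 _ (hT i j) i j).add
      (tendsto_finsetSum _ fun i _ => t2 i)
  have e := tendsto_nhds_unique (tl.congr fun n => h.eq _ (h.tf n)) tr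
  rw [z1, z2] at e
  have hn : 0 ≤ ∑ k, ∑ l, Ip (W k k) (W l l) := by
    have : ∑ k, ∑ l, Ip (W k k) (W l l) = ∫ x, (∑ k, W k k x) ^ 2 := by
      have ii : ∀ k l, Integrable (fun x => W k k x * W l l x) volume := fun k l =>
        hold_int inv22 (h.W2 k k) (h.W2 l l)
      simp only [Ip]
      rw [← Finset.sum_congr rfl fun k _ => integral_finsetSum Finset.univ fun l _ => ii k l]
      rw [← integral_finsetSum _ fun k _ => integrable_finsetSum _ fun l _ => ii k l]
      refine integral_congr_ae (ae_of_all _ fun x => ?_)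
      simp only [sq, Finset.sum_mul_sum]
    rw [this]; exact integral_nonneg fun x => sq_nonneg _
  have hsq : ∀ i j, Ip (W i j) (W i j) = nm 2 (W i j) ^ 2 := fun i j => by
    rw [nm_two_sq (h.W2 i j)]; simp only [Ip, sq]
  have hnn : ∀ i j, 0 ≤ Ip (W i j) (W i j) := fun i j => by rw [hsq]; positivity
  have hs0 : ∑ i, ∑ j, Ip (W i j) (W i j) = 0 := by
    have : 0 ≤ ∑ i, ∑ j, Ip (W i j) (W i j) := Finset.sum_nonneg fun i _ => Finset.sum_nonneg fun j _ => hnn i j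
    have h2 : 0 ≤ κ * ∑ k, ∑ l, Ip (W k k) (W l l) := mul_nonneg hκ hn
    have h3 : 0 ≤ μ * ∑ i, ∑ j, Ip (W i j) (W i j) := mul_nonneg hμ.le this
    have h4 : μ * ∑ i, ∑ j, Ip (W i j) (W i j) = 0 := by linarith
    exact (mul_eq_zero.1 h4).resolve_left hμ.ne'
  have hW0 : ∀ i j, nm 2 (W i j) = 0 := by
    intro i j
    have a := (Finset.sum_eq_zero_iff_of_nonneg (fun i _ => Finset.sum_nonneg fun j _ => hnn i j)).1 hs0 i (Finset.mem_univ _)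
    have b := (Finset.sum_eq_zero_iff_of_nonneg (fun j _ => hnn i j)).1 a j (Finset.mem_univ _)
    rw [hsq] at b
    exact pow_eq_zero_iff (two_ne_zero) |>.1 b
  have tn : ∀ j, Tendsto (fun n => nm 2 (pd (v n i) j)) atTop (𝓝 0) := by
    intro j
    refine squeeze_zero (fun n => nm_nonneg _ _) (fun n => ?_) (h.cW i j).nmt
    have := nm_triangle (by norm_num) ((h.tf n).pd_mem i j 2) (h.W2 i j)
    rw [hW0, add_zero] at this
    exact this
  obtain ⟨C, hC, hS⟩ := sobolev
  have t6 : Tendsto (fun n => nm 6 (v n i)) atTop (𝓝 0) := by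
    have a : Tendsto (fun n => Real.sqrt (C * ∑ j, nm 2 (pd (v n i) j) ^ 2)) atTop (𝓝 0) := by
      have b : Tendsto (fun n => C * ∑ j, nm 2 (pd (v n i) j) ^ 2) atTop (𝓝 (C * ∑ j : Fin 3, (0:ℝ)^2)) :=
        (tendsto_finsetSum _ fun j _ => (tn j).pow 2).const_mul C
      have c := b.sqrt
      simpa using c
    refine squeeze_zero (fun n => nm_nonneg _ _) (fun n => Real.le_sqrt_of_sq_le ?_) a
    have := hS (v n i) ((h.tf n) i).1.c1 ((h.tf n) i).2
    simp only [nm_two_sq ((h.tf n).pd_mem i _ 2)]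
    exact this
  exact LpT_unique_zero (by norm_num) (fun n => (h.tf n).mem i 6) (h.w6 i) (h.cw i) t6

theorem conv_zero {μ κ M : ℝ} {T : Fin 3 → Fin 3 → E3 → ℝ} {g : VF} {v : ℕ → VF} {w : VF}
    {W : Fin 3 → Fin 3 → E3 → ℝ} (h : VS μ κ T g v w W) {ρ : E3 → ℝ} {u : VF} (S : Setup ρ u M)
    (hm : ∀ φ : E3 → ℝ, Sm φ → HasCompactSupport φ → ∫ x, ρ x * (∑ i, u i x * pd φ i x) = 0)
    (huw : ∀ i, ∀ᵐ x, u i x = w i x) (i : Fin 3) :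
    ∑ j, Ip (fun x => ρ x * u i x * u j x) (W i j) = 0 := by
  have m3 : ∀ j, ML (fun x => ρ x * u j x) 3 := fun j => by
    have : Integrable (fun x => ρ x * u j x) volume := S.iρ.mul_bdd (c := M) (S.mu j) (S.hu j)
    refine ml_interp (B := M * M) this ?_ (by norm_num)
    filter_upwards [S.hρ, S.hu j] with x h1 h2
    rw [abs_mul]; exact mul_le_mul h1 h2 (abs_nonneg _) ((abs_nonneg _).trans h1)
  have h36 : (3:ENNReal)⁻¹ + 6⁻¹ = 2⁻¹ := by
    rw [show (3:ENNReal)⁻¹ = 2 * 6⁻¹ by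
      rw [show (6:ENNReal) = 2 * 3 by norm_num, ENNReal.mul_inv (by simp) (by simp), ← mul_assoc,
        ENNReal.mul_inv_cancel (by simp) (by simp), one_mul]]
    rw [show (2:ENNReal)⁻¹ = 3 * 6⁻¹ by
      rw [show (6:ENNReal) = 3 * 2 by norm_num, ENNReal.mul_inv (by simp) (by simp), ← mul_assoc,
        ENNReal.mul_inv_cancel (by simp) (by simp), one_mul]]
    ring
  have t : ∀ j, Tendsto (fun n => ∫ x, (ρ x * u j x * v n i x) * pd (v n i) j x) atTop
      (𝓝 (∫ x, (ρ x * u j x * w i x) * W i j x)) := fun j =>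
    LpT.int_mul (by norm_num) inv22 (fun n => hold_mem h36 (m3 j) ((h.tf n).mem i 6)) (hold_mem h36 (m3 j) (h.w6 i))
      (LpT.mul h36 (m3 j) (fun n => (h.tf n).mem i 6) (h.w6 i) (h.cw i))
      (fun n => (h.tf n).pd_mem i j 2) (h.W2 i j) (h.cW i j)
  have e : ∀ n, ∑ j, ∫ x, (ρ x * u j x * v n i x) * pd (v n i) j x = 0 := by
    intro n
    have hv := (h.tf n) i
    have q := hm (fun x => v n i x * v n i x) (hv.1.ml hv.1) hv.2.mul_left
    have ii : ∀ j, Integrable (fun x => (ρ x * u j x * v n i x) * pd (v n i) j x) volume := fun j =>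
      hold_int inv22 (hold_mem h36 (m3 j) ((h.tf n).mem i 6)) ((h.tf n).pd_mem i j 2)
    rw [← integral_finsetSum _ fun j _ => ii j]
    have : ∫ x, ρ x * (∑ j, u j x * pd (fun x => v n i x * v n i x) j x) =
        2 * ∫ x, ∑ j, (ρ x * u j x * v n i x) * pd (v n i) j x := by
      rw [← integral_const_mul]
      refine integral_congr_ae (ae_of_all _ fun x => ?_)
      simp only [pd_mul hv.1.d hv.1.d, Finset.mul_sum]
      exact Finset.sum_congr rfl fun j _ => by ring
    rw [this] at q; linarith
  have := tendsto_nhds_unique (tendsto_finsetSum Finset.univ fun j _ => t j) (tendsto_const_nhds.congr fun n => (e n).symm)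
  rw [← this]
  refine Finset.sum_congr rfl fun j _ => ?_
  refine integral_congr_ae ?_
  filter_upwards [huw i] with x hx
  rw [← hx]; ring

theorem force_D {M q : ℝ} {ρ G : E3 → ℝ} {u : VF} {dG : E3 → Fin 3 → ℝ} (S : Setup ρ u M) (hq : 1 < q)
    (hm : ∀ φ : E3 → ℝ, Sm φ → HasCompactSupport φ → ∫ x, ρ x * (∑ i, u i x * pd φ i x) = 0)
    (hG : MemD01q univ G dG q) : ∑ i, Ip (fun x => ρ x * dG x i) (u i) = 0 := by
  obtain ⟨-, hd, Gn, hGn, hl, -⟩ := hG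
  rw [Measure.restrict_univ] at hd
  simp only [Measure.restrict_univ] at hl
  set r := ENNReal.ofReal q with hr
  have h1r : 1 ≤ r := by rw [hr]; exact ENNReal.one_le_ofReal.2 hq.le
  obtain ⟨r', hr'1, hrr⟩ : ∃ r' : ENNReal, 1 ≤ r' ∧ r⁻¹ + r'⁻¹ = 1 := by
    refine ⟨(1 - r⁻¹)⁻¹, ?_, ?_⟩
    · rw [ENNReal.one_le_inv]; exact tsub_le_self
    · rw [inv_inv]; exact add_tsub_cancel_of_le (ENNReal.inv_le_one.2 h1r)
  have mi : ∀ i, ML (fun x => ρ x * u i x) r' := fun i => by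
    have : Integrable (fun x => ρ x * u i x) volume := S.iρ.mul_bdd (c := M) (S.mu i) (S.hu i)
    refine ml_interp (B := M * M) this ?_ hr'1
    filter_upwards [S.hρ, S.hu i] with x h1 h2
    rw [abs_mul]; exact mul_le_mul h1 h2 (abs_nonneg _) ((abs_nonneg _).trans h1)
  have md : ∀ i, ML (fun x => dG x i) r := fun i => MemLp.eval hd i
  have mG : ∀ n i, ML (pd (Gn n) i) r := fun n i =>
    sm_mem (Sm.pd (hGn n).1 i).continuous (hcs_pd (hGn n).2.1 i) r
  have lt : ∀ i, LpT r (fun n => pd (Gn n) i) (fun x => dG x i) := by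
    intro i
    refine tendsto_of_tendsto_of_tendsto_of_le_of_le tendsto_const_nhds hl (fun n => bot_le) fun n => ?_
    refine eLpNorm_mono fun x => ?_
    exact norm_le_pi_norm ((fun i => pd (Gn n) i x) - dG x) i
  have t : ∀ i, Tendsto (fun n => ∫ x, pd (Gn n) i x * (ρ x * u i x)) atTop (𝓝 (∫ x, dG x i * (ρ x * u i x))) := fun i =>
    (lt i).int_left hrr (mi i) (fun n => mG n i) (md i)
  have e : ∀ n, ∑ i, ∫ x, pd (Gn n) i x * (ρ x * u i x) = 0 := by
    intro n
    rw [← integral_finsetSum _ fun i _ => hold_int hrr (mG n i) (mi i), ← hm (Gn n) (hGn n).1 (hGn n).2.1]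
    refine integral_congr_ae (ae_of_all _ fun x => ?_)
    simp only [Finset.mul_sum]
    exact Finset.sum_congr rfl fun j _ => by ring
  have := tendsto_nhds_unique (tendsto_finsetSum Finset.univ fun j _ => t j) (tendsto_const_nhds.congr fun n => (e n).symm)
  rw [← this]
  refine Finset.sum_congr rfl fun j _ => integral_congr_ae (ae_of_all _ fun x => ?_)
  show _ = _
  ring

theorem force_W {M : ℝ} {ρ G : E3 → ℝ} {u : VF} {dG : E3 → Fin 3 → ℝ} (S : Setup ρ u M)
    (hG : MemW1inf univ G dG) : ∑ i, Ip (fun x => ρ x * dG x i) (u i) = 0 := by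
  obtain ⟨hw, h0, hd⟩ := hG
  rw [Measure.restrict_univ] at h0 hd
  simp only [HasWeakGradOn, Measure.restrict_univ] at hw
  have md : ∀ i, ML (fun x => dG x i) ⊤ := fun i => MemLp.eval hd i
  obtain ⟨B0, hB0⟩ : ∃ B, ∀ᵐ x, |G x| ≤ B := ⟨_, ae_le_lpNorm_exponent_top h0⟩
  have hB1 : ∀ i, ∃ B, ∀ᵐ x, |dG x i| ≤ B := fun i => ⟨_, ae_le_lpNorm_exponent_top (md i)⟩
  choose B1 hB1 using hB1
  have im : ∀ i, Integrable (fun x => ρ x * u i x) volume := fun i => S.iρ.mul_bdd (c := M) (S.mu i) (S.hu i)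
  obtain ⟨χ, C, sχ, cχ, b1, tχ, bC⟩ := cutoffs
  have lG : LI G := LI_bd h0.1 hB0
  have ld : ∀ i, LI (fun x => dG x i) := fun i => LI_bd (md i).1 (hB1 i)
  have sm : ∀ n i, Sm (mo n (fun x => ρ x * u i x)) := fun n i => mo_sm n (im i).locallyIntegrable
  have e1 : ∀ k n, ∑ i, ∫ x, mo n (fun x => ρ x * u i x) x * (G x * pd (χ k) i x)
      = - ∑ i, ∫ x, mo n (fun x => ρ x * u i x) x * (dG x i * χ k x) := by
    intro k n
    have a : ∀ i, ∫ x, G x * pd (fun x => mo n (fun x => ρ x * u i x) x * χ k x) i x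
        = - ∫ x, dG x i * (mo n (fun x => ρ x * u i x) x * χ k x) := fun i =>
      hw _ ⟨(sm n i).ml (sχ k), (cχ k).mul_left, subset_univ _⟩ i
    have b : ∑ i, ∫ x, G x * pd (fun x => mo n (fun x => ρ x * u i x) x * χ k x) i x
        = ∑ i, ∫ x, mo n (fun x => ρ x * u i x) x * (G x * pd (χ k) i x) := by
      rw [← integral_finsetSum, ← integral_finsetSum]
      · refine integral_congr_ae (ae_of_all _ fun x => ?_)
        have d := S.mass n x
        simp only [pd_mul (sm n _).d (sχ k).d]
        have : ∑ i, G x * (mo n (fun x => ρ x * u i x) x * pd (χ k) i x + pd (mo n (fun x => ρ x * u i x)) i x * χ k x)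
          = (∑ i, mo n (fun x => ρ x * u i x) x * (G x * pd (χ k) i x)) + G x * χ k x * ∑ i, pd (mo n (fun y => ρ y * u i y)) i x := by
          rw [Finset.mul_sum, ← Finset.sum_add_distrib]
          exact Finset.sum_congr rfl fun i _ => by ring
        rw [this, d]; ring
      · intro i _
        have : Integrable (fun x => G x * (mo n (fun x => ρ x * u i x) x * pd (χ k) i x)) volume :=
          Ip_integrable lG (((sm n i).ml ((sχ k).pd i)).continuous) (hcs_pd (cχ k) i).mul_left
        refine this.congr (ae_of_all _ fun x => ?_)
        show _ = _
        ring
      · intro i _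
        exact Ip_integrable lG (((sm n i).ml (sχ k)).pd i).continuous (hcs_pd (cχ k).mul_left i)
    rw [← b, Finset.sum_congr rfl fun i _ => a i, Finset.sum_neg_distrib]
    congr 1
    refine Finset.sum_congr rfl fun j _ => integral_congr_ae (ae_of_all _ fun x => ?_)
    show _ = _
    ring
  have e2 : ∀ k, ∑ i, ∫ x, (ρ x * u i x) * (G x * pd (χ k) i x)
      = - ∑ i, ∫ x, (ρ x * u i x) * (dG x i * χ k x) := by
    intro k
    refine tendsto_nhds_unique (l := (atTop : Filter ℕ)) (f := fun n => ∑ i, ∫ x, mo n (fun x => ρ x * u i x) x * (G x * pd (χ k) i x))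
      (tendsto_finsetSum Finset.univ fun i _ => ?_)
      (((tendsto_finsetSum Finset.univ fun i _ => ?_).neg).congr fun n => (e1 k n).symm)
    · refine tend_mul (K := B0 * (C * ((k:ℝ)+1)⁻¹)) (mo_tendsto_L1 (im i)) (im i) (fun n => mo_integrable n (im i))
        (fun n => h0.1.mul ((sχ k).pd i).continuous.aestronglyMeasurable) (fun n => ?_) (ae_of_all _ fun x => tendsto_const_nhds)
      filter_upwards [hB0] with x hx
      rw [abs_mul]; exact mul_le_mul hx (bC k i x) (abs_nonneg _) ((abs_nonneg _).trans hx)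
    · refine tend_mul (K := B1 i * 1) (mo_tendsto_L1 (im i)) (im i) (fun n => mo_integrable n (im i))
        (fun n => (md i).1.mul (sχ k).continuous.aestronglyMeasurable) (fun n => ?_) (ae_of_all _ fun x => tendsto_const_nhds)
      filter_upwards [hB1 i] with x hx
      rw [abs_mul]; exact mul_le_mul hx (b1 k x) (abs_nonneg _) ((abs_nonneg _).trans hx)
  have iG : ∀ i, Integrable (fun x => ρ x * u i x * G x) volume := fun i => (im i).mul_bdd (c := B0) h0.1 hB0
  have id : ∀ i, Integrable (fun x => ρ x * u i x * dG x i) volume := fun i => (im i).mul_bdd (c := B1 i) (md i).1 (hB1 i)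
  simp only [← mul_assoc] at e2
  have l1 : Tendsto (fun k => ∑ i, ∫ x, ρ x * u i x * G x * pd (χ k) i x) atTop (𝓝 (∑ i : Fin 3, 0)) :=
    tendsto_finsetSum _ fun j _ => cut_zero (iG j) (fun n x => bC n j x)
  have l2 : Tendsto (fun k => ∑ i, ∫ x, ρ x * u i x * dG x i * χ k x) atTop (𝓝 (∑ i, ∫ x, ρ x * u i x * dG x i)) :=
    tendsto_finsetSum _ fun j _ => cut_one (id j) (fun n => (sχ n).continuous) b1 tχ
  have := tendsto_nhds_unique (l1.congr e2) l2.neg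
  have h3 : ∑ i, ∫ x, ρ x * u i x * dG x i = 0 := by
    simp only [Finset.sum_const_zero] at this; linarith
  rw [← h3]
  refine Finset.sum_congr rfl fun j _ => integral_congr_ae (ae_of_all _ fun x => ?_)
  show _ = _
  ring


theorem vnorm_ge (v : Fin 3 → ℝ) (i : Fin 3) : |v i| ≤ vnorm v := by
  refine Real.abs_le_sqrt ?_
  exact Finset.single_le_sum (f := fun i => v i ^ 2) (fun i _ => sq_nonneg _) (Finset.mem_univ i)

theorem VI_u {u : E3 → Fin 3 → ℝ} {M : ℝ} (i : Fin 3) (mu : AEStronglyMeasurable (fun x => u x i) volume)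
    (hu : ∀ᵐ x, |u x i| ≤ M)
    (hdecay : ∀ ε : ℝ, 0 < ε → ∃ R : ℝ, ∀ᵐ x, R ≤ ‖x‖ → vnorm (u x) ≤ ε) : VI (fun x => u x i) := by
  refine VI_of_dom mu fun δ hδ => ?_
  obtain ⟨R, hR⟩ := hdecay δ hδ
  refine ⟨(ball (0:E3) R).indicator (fun _ => M), ?_, ?_⟩
  · rw [integrable_indicator_iff measurableSet_ball]
    exact integrableOn_const measure_ball_lt_top.ne
  · filter_upwards [hR, hu] with x h1 h2
    rcases le_or_gt R ‖x‖ with h | h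
    · exact Or.inl ((vnorm_ge _ i).trans (h1 h))
    · right
      rw [indicator_of_mem (by simpa using h)]
      exact h2

theorem VI_P {p : ℝ → ℝ} {ρ : E3 → ℝ} {M : ℝ} (hp_cont : ContinuousOn p (Ici 0)) (hp0 : p 0 = 0)
    (mP : AEStronglyMeasurable (fun x => p (ρ x)) volume) (hP : ∀ᵐ x, |p (ρ x)| ≤ M) (iρ : Integrable ρ volume)
    (ρ0 : ∀ᵐ x, 0 ≤ ρ x) : VI (fun x => p (ρ x)) := by
  refine VI_of_dom mP fun δ hδ => ?_
  have hc := Metric.continuousWithinAt_iff.1 (hp_cont 0 (by simp)) δ hδ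
  obtain ⟨s, hs, h⟩ := hc
  refine ⟨fun x => (|M| / s) * ρ x, iρ.const_mul _, ?_⟩
  filter_upwards [hP, ρ0] with x h1 h2
  rcases lt_or_ge (ρ x) s with h3 | h3
  · left
    have := h (x := ρ x) h2 (by rw [Real.dist_eq, sub_zero, abs_of_nonneg h2]; exact h3)
    rw [Real.dist_eq, hp0, sub_zero] at this
    exact this.le
  · right
    refine (h1.trans (le_abs_self _)).trans ?_
    rw [div_mul_eq_mul_div, le_div_iff₀ hs]
    exact mul_le_mul_of_nonneg_left h3 (abs_nonneg _)

theorem one_le_65 : (1:ENNReal) ≤ 6/5 := by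
  rw [ENNReal.le_div_iff_mul_le (by simp) (by simp)]; norm_num

theorem g_mem {ρ d : E3 → ℝ} {M : ℝ} (iρ : Integrable ρ volume) (hρ : ∀ᵐ x, |ρ x| ≤ M) {r : ENNReal} (hr : 6/5 ≤ r)
    (hd : ML d r) : ML (fun x => ρ x * d x) (6/5) := by
  have h1 : r⁻¹ ≤ (6/5 : ENNReal)⁻¹ := ENNReal.inv_le_inv.2 hr
  refine hold_mem (p := ((6/5 : ENNReal)⁻¹ - r⁻¹)⁻¹) (q := r) ?_ (ml_interp iρ hρ ?_) hd
  · rw [inv_inv]; exact tsub_add_cancel_of_le h1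
  · rw [ENNReal.one_le_inv]
    exact tsub_le_self.trans (ENNReal.inv_le_one.2 one_le_65)

theorem main_thm
    (μ η : ℝ) (hμ : 0 < μ) (hη : 0 ≤ η)
    (p p' : ℝ → ℝ) (G : E3 → ℝ) (dG : E3 → Fin 3 → ℝ)
    (hp_cont : ContinuousOn p (Ici 0)) (hp0 : p 0 = 0)
    (hp_nonneg : ∀ s, 0 ≤ s → 0 ≤ p s)
    (hp_deriv : ∀ s, 0 < s → HasDerivAt p (p' s) s)
    (hp'_cont : ContinuousOn p' (Ioi 0))
    (hG : (∃ q : ℝ, 3 / 2 < q ∧ MemD01q univ G dG q) ∨ MemW1inf univ G dG)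
    (ρ : E3 → ℝ) (u : E3 → Fin 3 → ℝ)
    (hsol : VeryWeakSolution μ η p G dG ρ u)
    (hρ1 : MemLp ρ 1 volume) (hρ_top : MemLp ρ ⊤ volume)
    (hu_top : MemLp u ⊤ volume)
    (hdecay : ∀ ε : ℝ, 0 < ε → ∃ R : ℝ, ∀ᵐ x, R ≤ ‖x‖ → vnorm (u x) ≤ ε) :
    ∀ᵐ x, u x = 0 := by
  have hκ : 0 ≤ μ/3 + η := by positivity
  have iρ : Integrable ρ volume := memLp_one_iff_integrable.1 hρ1
  have ui : ∀ i, ML (fun x => u x i) ⊤ := fun i => MemLp.eval hu_top i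
  have mu : ∀ i, AEStronglyMeasurable (fun x => u x i) volume := fun i => (ui i).1
  -- common bound
  obtain ⟨Mr, hMr⟩ : ∃ B, ∀ᵐ x, |ρ x| ≤ B := ⟨_, ae_le_lpNorm_exponent_top hρ_top⟩
  have hMu : ∀ i, ∃ B, ∀ᵐ x, |u x i| ≤ B := fun i => ⟨_, ae_le_lpNorm_exponent_top (ui i)⟩
  choose Mu hMu using hMu
  obtain ⟨Mp, hMp⟩ := isCompact_Icc.exists_bound_of_continuousOn (s := Icc 0 Mr) (hp_cont.mono Icc_subset_Ici_self)
  have hP0 : ∀ᵐ x, |p (ρ x)| ≤ Mp := by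
    filter_upwards [hMr, hsol.ρ_nonneg] with x h1 h2
    exact hMp _ ⟨h2, (le_abs_self _).trans h1⟩
  set M := |Mr| + |Mp| + ∑ i, |Mu i| with hM
  have hs0 : 0 ≤ ∑ i, |Mu i| := Finset.sum_nonneg fun i _ => abs_nonneg _
  have hρ : ∀ᵐ x, |ρ x| ≤ M := by
    filter_upwards [hMr] with x hx
    linarith [le_abs_self Mr, abs_nonneg Mp]
  have hP : ∀ᵐ x, |p (ρ x)| ≤ M := by
    filter_upwards [hP0] with x hx
    linarith [le_abs_self Mp, abs_nonneg Mr]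
  have hu : ∀ i, ∀ᵐ x, |u x i| ≤ M := fun i => by
    filter_upwards [hMu i] with x hx
    have := Finset.single_le_sum (f := fun i => |Mu i|) (fun i _ => abs_nonneg _) (Finset.mem_univ i)
    linarith [le_abs_self (Mu i), abs_nonneg Mr, abs_nonneg Mp]
  have im : ∀ i, Integrable (fun x => ρ x * u x i) volume := fun i => iρ.mul_bdd (c := M) (mu i) (hu i)
  have S : Setup ρ (fun i x => u x i) M := ⟨hρ_top.1, hρ, mu, hu,
    mass_pointwise (fun i => (im i).locallyIntegrable) hsol.mass, iρ, hsol.ρ_nonneg⟩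
  obtain ⟨Q, hQ⟩ := QSex hp0 hp_nonneg hp_deriv hp'_cont
  have mP := (P_meas hQ S).1
  have vP := VI_P hp_cont hp0 mP hP iρ hsol.ρ_nonneg
  have vu : ∀ i, VI (fun x => u x i) := fun i => VI_u i (mu i) (hu i) hdecay
  have hF : ∀ i j, ML (fun x => ρ x * u x i * u x j) 2 := fun i j => by
    have : Integrable (fun x => ρ x * u x i * u x j) volume := (im i).mul_bdd (c := M) (mu j) (hu j)
    refine ml_interp (B := M * M * M) this ?_ (by norm_num)
    filter_upwards [hρ, hu i, hu j] with x h1 h2 h3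
    have h0 : 0 ≤ M := (abs_nonneg _).trans h1
    rw [abs_mul, abs_mul]
    exact mul_le_mul (mul_le_mul h1 h2 (abs_nonneg _) h0) h3 (abs_nonneg _) (mul_nonneg h0 h0)
  have hg : ∀ i, ML (fun x => ρ x * dG x i) (6/5) := by
    intro i
    rcases hG with ⟨q, hq, hG⟩ | hG
    · have hd := hG.2.1
      rw [Measure.restrict_univ] at hd
      refine g_mem iρ hρ ?_ (MemLp.eval hd i)
      rw [ENNReal.div_le_iff_le_mul (by simp) (by simp)]
      rw [show (6:ENNReal) = ENNReal.ofReal 6 by simp, show (5:ENNReal) = ENNReal.ofReal 5 by simp,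
        ← ENNReal.ofReal_mul (by linarith)]
      exact ENNReal.ofReal_le_ofReal (by linarith)
    · have hd := hG.2.2
      rw [Measure.restrict_univ] at hd
      exact g_mem iρ hρ le_top (MemLp.eval hd i)
  have z2 : ∑ i, Ip (fun x => ρ x * dG x i) (fun x => u x i) = 0 := by
    rcases hG with ⟨q, hq, hG⟩ | hG
    · exact force_D S (by linarith) hsol.mass hG
    · exact force_W S hG
  have lF : ∀ i j, LI (fun x => ρ x * u x i * u x j) := fun i j => LI_of_mem (by norm_num) (hF i j)
  have lu : ∀ i, LI (fun x => u x i) := fun i => LI_bd (mu i) (hu i)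
  have lg : ∀ i, LI (fun x => ρ x * dG x i) := fun i => LI_of_mem one_le_65 (hg i)
  have vw := vw_of_sol hsol lF lu lg
  -- stage one
  obtain ⟨H, hH, hdiv, gb⟩ := st1 hμ hκ mu hu mP hP vP vu hF hg vw
  have P2 : ML (fun x => p (ρ x)) 2 := P_L2 hQ S gb hP hH (by positivity) hdiv
  -- stage two
  have hT : ∀ i j : Fin 3, ML (fun x => ρ x * u x i * u x j + if i = j then p (ρ x) else 0) 2 := by
    intro i j
    refine (hF i j).add ?_
    by_cases h : i = j
    · simp only [h, if_true]; exact P2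
    · simp only [h, if_false]; exact MemLp.zero'
  obtain ⟨v, w, W, hs⟩ := solve hμ hκ hT hg
  have hz := vw.sub (hs.vw (fun i j => LI_of_mem (by norm_num) (hT i j)) lg)
  have huw : ∀ i, ∀ᵐ x, u x i = w i x := by
    intro i
    have := stage2 hμ hκ hz (fun i j x => sub_self _) (fun i x => sub_self _)
      (fun i => (vu i).sub (VI_of_mem (k := 6) (by norm_num) (hs.w6 i))) i
    filter_upwards [this] with x hx
    exact sub_eq_zero.1 hx
  have hD : ML (fun x => ∑ k, W k k x) 2 := memLp_finsetSum _ fun k _ => hs.W2 k k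
  have hdiv2 : ∀ n x, ∑ k, pd (mo n (fun x => u x k)) k x = mo n (fun x => ∑ k, W k k x) x := by
    intro n x
    have a2 := cv_sum Finset.univ (ker_cont n) (ker_hcs n)
      (fun k => LI_of_mem (p := 2) (by norm_num) (hs.W2 k k)) x
    refine Eq.trans ?_ a2.symm
    refine Finset.sum_congr rfl fun k _ => ?_
    have : mo n (fun x => u x k) = mo n (w k) := funext fun y => cv_congr (huw k) y
    rw [this]; exact hs.pd_mo n k k x
  have hPD := P_tr hQ S gb P2 hD hdiv2
  have z1 : ∑ i, ∑ j, Ip (fun x => ρ x * u x i * u x j + if i = j then p (ρ x) else 0) (W i j) = 0 := by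
    have e : ∀ i j : Fin 3, Ip (fun x => ρ x * u x i * u x j + if i = j then p (ρ x) else 0) (W i j)
        = Ip (fun x => ρ x * u x i * u x j) (W i j) + if i = j then Ip (fun x => p (ρ x)) (W i j) else 0 := by
      intro i j
      by_cases h : i = j
      · simp only [h, if_true]
        exact Ip_add_left inv22 (hF j j) P2 (hs.W2 j j)
      · simp only [h, if_false, add_zero]
    have c0 : ∀ i, ∑ j, Ip (fun x => ρ x * u x i * u x j) (W i j) = 0 := fun i =>
      conv_zero hs S hsol.mass huw i
    simp only [e, Finset.sum_add_distrib, c0, Finset.sum_ite_eq, Finset.mem_univ, if_true, Finset.sum_const_zero, zero_add]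
    rw [← hPD]
    simp only [Ip]
    rw [← integral_finsetSum _ fun i _ => hold_int inv22 P2 (hs.W2 i i)]
    refine integral_congr_ae (ae_of_all _ fun x => ?_)
    simp only [Finset.sum_mul]
    exact Finset.sum_congr rfl fun i _ => mul_comm _ _
  have z2' : ∑ i, Ip (fun x => ρ x * dG x i) (w i) = 0 := by
    rw [← z2]
    refine Finset.sum_congr rfl fun i _ => integral_congr_ae ?_
    filter_upwards [huw i] with x hx
    rw [hx]
  have fin := energy_zero hμ hκ hs hT hg z1 z2'
  filter_upwards [ae_all_iff.2 fin, ae_all_iff.2 huw] with x h1 h2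
  ext i
  rw [h2 i, h1 i]; rfl

/-- **Theorem 3, part 2.** Let `(ρ, u)` be a very weak solution on `ℝ³` with potential `G`,
where `p` is continuous with `p(0) = 0`, `p ≥ 0`, and `C¹` on `(0,∞)`, and `G` belongs either to
`D₀^{1,q}(ℝ³)` for some `3/2 < q < ∞` or to `W^{1,∞}(ℝ³)`. Assume `ρ ∈ L¹ ∩ L^∞(ℝ³)` and
`u ∈ L^∞(ℝ³)`. If `ess limsup_{|x|→∞} |u(x)| = 0`, then `u = 0` a.e. -/
theorem liouville_very_weak_decay
    (μ η : ℝ) (hμ : 0 < μ) (hη : 0 ≤ η)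
    (p p' : ℝ → ℝ) (G : E3 → ℝ) (dG : E3 → Fin 3 → ℝ)
    (hp_cont : ContinuousOn p (Ici 0)) (hp0 : p 0 = 0)
    (hp_nonneg : ∀ s, 0 ≤ s → 0 ≤ p s)
    (hp_deriv : ∀ s, 0 < s → HasDerivAt p (p' s) s)
    (hp'_cont : ContinuousOn p' (Ioi 0))
    (hG : (∃ q : ℝ, 3 / 2 < q ∧ MemD01q univ G dG q) ∨ MemW1inf univ G dG)
    (ρ : E3 → ℝ) (u : E3 → Fin 3 → ℝ)
    (hsol : VeryWeakSolution μ η p G dG ρ u)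
    (hρ1 : MemLp ρ 1 volume) (hρ_top : MemLp ρ ⊤ volume)
    (hu_top : MemLp u ⊤ volume)
    (hdecay : ∀ ε : ℝ, 0 < ε → ∃ R : ℝ, ∀ᵐ x, R ≤ ‖x‖ → vnorm (u x) ≤ ε) :
    ∀ᵐ x, u x = 0 := by
  exact main_thm μ η hμ hη p p' G dG hp_cont hp0 hp_nonneg hp_deriv hp'_cont hG ρ u hsol hρ1 hρ_top hu_top hdecay
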